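/- Let (R, m) be a commutative noetherian local ring of Krull dimension d ≥ 2 in which 2 is a unit, and let I be a proper ideal of R. Then the group structure on the relative orbit space Um_{d+1}(R[X], I[X])/E_{d+1}(R[X], I[X]) is nice; concretely: for all relative unimodular rows (a, a_2, …, a_{d+1}), (b, a_2, …, a_{d+1}) ∈ Um_{d+1}(R[X], I[X]) and every p ∈ R[X] with p − 1 ∈ I[X] and a·p ≡ 1 modulo the ideal (a_2, …, a_{d+1}), there exists ε ∈ E_{d+1}(R[X], I[X]) such that (a(b+p) − 1, a_2(b+p), a_3, …, a_{d+1})·ε = (ab, a_2, …, a_{d+1}). -/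

import Mathlib

open Matrix Polynomial

/-- The set of unimodular rows of length `n` over `R`. -/
def Um (n : ℕ) (R : Type*) [CommRing R] : Set (Fin n → R) :=
  {v | ∃ w : Fin n → R, ∑ i, v i * w i = 1}

/-- The set of unimodular rows of length `n` relative to the ideal `I`:
unimodular rows congruent to `(1, 0, …, 0)` modulo `I`. -/
def UmRel (n : ℕ) (R : Type*) [CommRing R] (I : Ideal R) : Set (Fin n → R) :=
  {v | v ∈ Um n R ∧ ∀ i : Fin n, if i.val = 0 then v i - 1 ∈ I else v i ∈ I}

/-- The elementary subgroup `E_n(R)` of `GL_n(R)`, generated by the elementary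
matrices `E_{ij}(c) = 1 + c·e_{ij}`, `i ≠ j` (i.e. transvections). -/
def Elem (n : ℕ) (R : Type*) [CommRing R] : Subgroup (GL (Fin n) R) :=
  Subgroup.closure {g | ∃ i j : Fin n, i ≠ j ∧ ∃ c : R,
    (g : Matrix (Fin n) (Fin n) R) = Matrix.transvection i j c}

/-- The relative elementary subgroup `E_n(R, I)`: the smallest normal subgroup of
`E_n(R)` containing the matrices `E_{21}(x)`, `x ∈ I`; realized as the subgroup
generated by all `E_n(R)`-conjugates of such matrices. -/
def ElemRel (n : ℕ) (R : Type*) [CommRing R] (I : Ideal R) : Subgroup (GL (Fin n) R) :=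
  Subgroup.closure {g | ∃ e ∈ Elem n R, ∃ h : GL (Fin n) R, ∃ i j : Fin n,
    i.val = 1 ∧ j.val = 0 ∧
    (∃ x ∈ I, (h : Matrix (Fin n) (Fin n) R) = Matrix.transvection i j x) ∧
    g = e * h * e⁻¹}

/-! ### Elementary equivalence of rows -/

/-- Two rows are elementarily equivalent if one is obtained from the other by successively adding
multiples of entries to other entries. -/
inductive RowEquiv {ι A : Type*} [DecidableEq ι] [CommRing A] : (ι → A) → (ι → A) → Prop
  | refl (v : ι → A) : RowEquiv v v
  | step {v w : ι → A} (i j : ι) (hij : i ≠ j) (c : A) (h : RowEquiv v w) :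
      RowEquiv v (Function.update w j (w j + c * w i))

namespace RowEquiv

variable {ι A : Type*} [DecidableEq ι] [CommRing A] {u v w : ι → A}

theorem of_eq (h : v = w) : RowEquiv v w := h ▸ RowEquiv.refl v

theorem trans (h₁ : RowEquiv u v) (h₂ : RowEquiv v w) : RowEquiv u w := by
  induction h₂ with
  | refl => exact h₁
  | step i j hij c _ ih => exact ih.step i j hij c

theorem single (v : ι → A) {i j : ι} (hij : i ≠ j) (c : A) :
    RowEquiv v (Function.update v j (v j + c * v i)) :=
  (RowEquiv.refl v).step i j hij c

theorem symm (h : RowEquiv v w) : RowEquiv w v := by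
  induction h with
  | refl => exact RowEquiv.refl _
  | @step w i j hij c _ ih =>
    refine RowEquiv.trans ?_ ih
    convert single (Function.update w j (w j + c * w i)) hij (-c) using 1
    ext l
    by_cases hl : l = j
    · subst hl; simp [hij]
    · simp [hl]

theorem update_add (v : ι → A) (j : ι) {x : A} (hx : x ∈ Ideal.span (v '' {j}ᶜ)) (y : A) :
    RowEquiv (Function.update v j y) (Function.update v j (y + x)) := by
  suffices H : ∀ c y, RowEquiv (Function.update v j y) (Function.update v j (y + c * x)) by
    simpa using H 1 y
  induction hx using Submodule.span_induction with
  | mem x hx =>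
    obtain ⟨i, hi, rfl⟩ := hx
    intro c y
    have hi' : i ≠ j := hi
    simpa [hi'] using single (Function.update v j y) hi' c
  | zero => intro c y; simpa using RowEquiv.refl _
  | add a b _ _ ha hb =>
    intro c y
    rw [mul_add, ← add_assoc]
    exact (ha c y).trans (hb c _)
  | smul a x _ hx =>
    intro c y
    simpa [mul_assoc] using hx (c * a) y

/-- Rows that agree away from `j` are equivalent if their `j`-th entries are congruent modulo the
remaining entries. -/
theorem of_sub_mem (j : ι) (h : ∀ i, i ≠ j → v i = w i)
    (hj : w j - v j ∈ Ideal.span (v '' {j}ᶜ)) : RowEquiv v w := by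
  have := update_add v j hj (v j)
  rw [Function.update_eq_self] at this
  convert this using 1
  ext l
  by_cases hl : l = j
  · subst hl; simp
  · simp [hl, h l hl]

theorem span_range_le (h : RowEquiv v w) : Ideal.span (Set.range w) ≤ Ideal.span (Set.range v) := by
  induction h with
  | refl => exact le_rfl
  | @step w i j hij c _ ih =>
    refine le_trans ?_ ih
    rw [Ideal.span_le]
    rintro _ ⟨l, rfl⟩
    by_cases hl : l = j
    · subst hl
      simpa using add_mem (Ideal.subset_span (Set.mem_range_self l))
        (Ideal.mul_mem_left _ c (Ideal.subset_span (Set.mem_range_self i)))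
    · simpa [hl] using Ideal.subset_span (Set.mem_range_self l)

theorem span_range_eq (h : RowEquiv v w) :
    Ideal.span (Set.range w) = Ideal.span (Set.range v) :=
  le_antisymm h.span_range_le h.symm.span_range_le

end RowEquiv

section Moves

variable {ι A : Type*} [DecidableEq ι]

/-- The row `v` with its entries at `i` and `j` replaced by `x` and `y`. -/
def rowPair (v : ι → A) (i j : ι) (x y : A) : ι → A :=
  Function.update (Function.update v i x) j y

theorem rowPair_self (v : ι → A) (i j : ι) : rowPair v i j (v i) (v j) = v := by
  ext l; simp [rowPair, Function.update_apply]; aesop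

theorem image_rowPair_compl (v : ι → A) (i j : ι) (x y : A) :
    rowPair v i j x y '' {i, j}ᶜ = v '' {i, j}ᶜ := by
  apply Set.image_congr
  intro l hl
  simp only [Set.mem_compl_iff, Set.mem_insert_iff, Set.mem_singleton_iff, not_or] at hl
  simp [rowPair, hl.1, hl.2]

theorem rowPair_comm (v : ι → A) {i j : ι} (hij : i ≠ j) (x y : A) :
    rowPair v i j x y = rowPair v j i y x :=
  Function.update_comm hij _ _ _

variable [CommRing A]

theorem rowPair_add_right (v : ι → A) {i j : ι} (hij : i ≠ j) (x y c : A) :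
    RowEquiv (rowPair v i j x y) (rowPair v i j x (y + c * x)) := by
  simpa [rowPair, hij, hij.symm] using RowEquiv.single (rowPair v i j x y) hij c

theorem rowPair_add_left (v : ι → A) {i j : ι} (hij : i ≠ j) (x y c : A) :
    RowEquiv (rowPair v i j x y) (rowPair v i j (x + c * y) y) := by
  rw [rowPair_comm v hij, rowPair_comm v hij]
  exact rowPair_add_right v hij.symm y x c

theorem rowPair_congr_right (v : ι → A) {i j : ι} (x : A) {y y' : A}
    (h : y' - y ∈ Ideal.span (v '' {i, j}ᶜ)) :
    RowEquiv (rowPair v i j x y) (rowPair v i j x y') := by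
  refine RowEquiv.of_sub_mem j (fun l hl => by simp [rowPair, hl]) ?_
  have : rowPair v i j x y '' {i, j}ᶜ ⊆ rowPair v i j x y '' {j}ᶜ :=
    Set.image_mono (by simp)
  rw [image_rowPair_compl] at this
  simpa [rowPair] using Ideal.span_mono this h

theorem rowPair_congr (v : ι → A) {i j : ι} (hij : i ≠ j) {x x' y y' : A}
    (hx : Ideal.Quotient.mk (Ideal.span (v '' {i, j}ᶜ)) x' = Ideal.Quotient.mk _ x)
    (hy : Ideal.Quotient.mk (Ideal.span (v '' {i, j}ᶜ)) y' = Ideal.Quotient.mk _ y) :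
    RowEquiv (rowPair v i j x y) (rowPair v i j x' y') := by
  rw [Ideal.Quotient.eq] at hx hy
  refine (rowPair_congr_right v x hy).trans ?_
  rw [rowPair_comm v hij, rowPair_comm v hij]
  exact rowPair_congr_right v y' (by rwa [Set.pair_comm])

theorem mk_eq_one {A : Type*} [CommRing A] {I : Ideal A} {u u' : A} (h : u * u' - 1 ∈ I) :
    Ideal.Quotient.mk I u * Ideal.Quotient.mk I u' = 1 := by
  rw [← map_mul, ← map_one (Ideal.Quotient.mk I), Ideal.Quotient.eq]; exact h

/-- The Weyl element attached to a unit modulo the other entries. -/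
theorem rowPair_weyl (v : ι → A) {i j : ι} (hij : i ≠ j) {u u' : A}
    (hu : u * u' - 1 ∈ Ideal.span (v '' {i, j}ᶜ)) (x y : A) :
    RowEquiv (rowPair v i j x y) (rowPair v i j (-u' * y) (u * x)) := by
  have h := mk_eq_one hu
  refine (rowPair_add_right v hij x y u).trans ((rowPair_add_left v hij _ _ (-u')).trans
    ((rowPair_congr v hij (x' := -u' * y) (y' := y + u * x) ?_ rfl).trans
    ((rowPair_add_right v hij _ _ u).trans (rowPair_congr v hij rfl ?_))))
  · simp only [map_mul, map_add, map_neg]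
    linear_combination (Ideal.Quotient.mk _ x) * h
  · simp only [map_mul, map_add, map_neg]
    linear_combination (Ideal.Quotient.mk _ y) * h

/-- Whitehead's lemma for two entries. -/
theorem rowPair_whitehead (v : ι → A) {i j : ι} (hij : i ≠ j) {u u' : A}
    (hu : u * u' - 1 ∈ Ideal.span (v '' {i, j}ᶜ)) (x y : A) :
    RowEquiv (rowPair v i j x y) (rowPair v i j (u * x) (u' * y)) := by
  refine (rowPair_weyl v hij (u := 1) (u' := 1) (by simp) x y).trans
    ((rowPair_weyl v hij (u := -u') (u' := -u) (by simpa [mul_comm] using hu) _ _).trans ?_)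
  refine rowPair_congr v hij ?_ ?_ <;> simp

/-- Cohn transvections are elementary. -/
theorem rowPair_cohn (v : ι → A) {i j k : ι} (hij : i ≠ j) (hki : k ≠ i) (hkj : k ≠ j)
    (x y s t e f l : A) (h : e * s + f * t = 0) :
    RowEquiv (rowPair v i j x y)
      (rowPair v i j (x + l * (x * s + y * t) * e) (y + l * (x * s + y * t) * f)) := by
  set z := x * s + y * t with hz
  have aux : ∀ a x y c d, RowEquiv (rowPair (Function.update v k a) i j x y)
      (rowPair (Function.update v k a) i j (x + c * a) (y + d * a)) := by
    intro a x y c d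
    refine rowPair_congr _ hij ?_ ?_
    all_goals
      rw [Ideal.Quotient.eq, add_sub_cancel_left]
      exact Ideal.mul_mem_left _ _ (Ideal.subset_span ⟨k, by simp [hki, hkj], by simp⟩)
  have auk : ∀ a x y, RowEquiv (rowPair (Function.update v k a) i j x y)
      (rowPair (Function.update v k (a + (x * s + y * t))) i j x y) := by
    intro a x y
    refine RowEquiv.of_sub_mem k (fun l hl => by simp [rowPair, Function.update_apply, hl]) ?_
    simp only [rowPair, Function.update_of_ne hki, Function.update_of_ne hkj, Function.update_self,
      add_sub_cancel_left]
    refine add_mem (Ideal.mul_mem_right _ _ (Ideal.subset_span (show _ from ⟨i, hki.symm, ?_⟩)))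
      (Ideal.mul_mem_right _ _ (Ideal.subset_span (show _ from ⟨j, hkj.symm, ?_⟩)))
    · simp [hij]
    · simp
  have hv : ∀ x y, rowPair v i j x y = rowPair (Function.update v k (v k)) i j x y := by simp
  rw [hv, hv]
  refine (auk _ _ _).trans ((aux _ _ _ (l * e) (l * f)).trans ?_)
  have h₁ := auk (v k) (x + l * e * (v k + z)) (y + l * f * (v k + z))
  have h₂ := aux (v k) (x + l * e * (v k + z)) (y + l * f * (v k + z)) (-(l * e)) (-(l * f))
  rw [show (x + l * e * (v k + z)) * s + (y + l * f * (v k + z)) * t = x * s + y * t by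
    linear_combination l * (v k + z) * h] at h₁
  refine h₁.symm.trans ?_
  convert h₂ using 2 <;> ring

theorem span_pair_compl_le (v : ι → A) {i j : ι} :
    Ideal.span (Set.range v) ≤ Ideal.span {v i, v j} ⊔ Ideal.span (v '' {i, j}ᶜ) := by
  rw [Ideal.span_le]
  rintro _ ⟨l, rfl⟩
  by_cases hl : l ∈ ({i, j} : Set ι)
  · refine Ideal.mem_sup_left (Ideal.subset_span ?_)
    rcases hl with rfl | hl
    · simp
    · rw [Set.mem_singleton_iff] at hl; simp [hl]
  · exact Ideal.mem_sup_right (Ideal.subset_span ⟨l, hl, rfl⟩)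

/-- An entry of a unimodular row may be multiplied by the square of a unit modulo all but two of
the entries. -/
theorem RowEquiv.sq_mul {v : ι → A} {i j k : ι} (hij : i ≠ j) (hki : k ≠ i) (hkj : k ≠ j)
    (hv : Ideal.span (Set.range v) = ⊤) {u u' : A}
    (hu : u * u' - 1 ∈ Ideal.span (v '' {i, j}ᶜ)) :
    RowEquiv v (Function.update v i (u ^ 2 * v i)) := by
  have h1 : (1 : A) ∈ Ideal.span {v i, v j} ⊔ Ideal.span (v '' {i, j}ᶜ) :=
    span_pair_compl_le v (hv ▸ Submodule.mem_top)
  obtain ⟨z, hz, b, hb, hzb⟩ := Submodule.mem_sup.1 h1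
  obtain ⟨s, t, rfl⟩ := Ideal.mem_span_pair.1 hz
  set Q := Ideal.span (v '' {i, j}ᶜ) with hQ
  have hst : Ideal.Quotient.mk Q (v i) * Ideal.Quotient.mk Q s +
      Ideal.Quotient.mk Q (v j) * Ideal.Quotient.mk Q t = 1 := by
    have := congrArg (Ideal.Quotient.mk Q) hzb
    rw [map_add, Ideal.Quotient.eq_zero_iff_mem.2 hb] at this
    simp only [map_add, map_mul, map_one, add_zero] at this
    linear_combination this
  have huu := mk_eq_one hu
  set x := v i with hx
  set y := v j with hy
  have e1 : RowEquiv (rowPair v i j x y) (rowPair v i j (x - t) (y + s)) := by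
    refine (rowPair_cohn v hij hki hkj x y s t (-t) s 1 (by ring)).trans
      (rowPair_congr v hij ?_ ?_) <;> simp only [map_sub, map_add, map_mul, map_neg, map_one]
    · linear_combination (Ideal.Quotient.mk Q t) * hst
    · linear_combination -(Ideal.Quotient.mk Q s) * hst
  have e2 : RowEquiv (rowPair v i j (x - t) (y + s)) (rowPair v i j (u * x - t) (u * y + s)) := by
    refine (rowPair_cohn v hij hki hkj _ _ (-y) x x y (u - 1) (by ring)).trans
      (rowPair_congr v hij ?_ ?_) <;> simp only [map_sub, map_add, map_mul, map_neg, map_one]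
    · linear_combination -(Ideal.Quotient.mk Q x) * (Ideal.Quotient.mk Q u - 1) * hst
    · linear_combination -(Ideal.Quotient.mk Q y) * (Ideal.Quotient.mk Q u - 1) * hst
  have e3 : RowEquiv (rowPair v i j (u * x - t) (u * y + s)) (rowPair v i j (u * x) (u * y)) := by
    refine (rowPair_cohn v hij hki hkj _ _ s t (-t) s (-u') (by ring)).trans
      (rowPair_congr v hij ?_ ?_) <;> simp only [map_sub, map_add, map_mul, map_neg]
    · linear_combination -(Ideal.Quotient.mk Q t) * huu -
        (Ideal.Quotient.mk Q t) * Ideal.Quotient.mk Q u' * Ideal.Quotient.mk Q u * hst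
    · linear_combination (Ideal.Quotient.mk Q s) * huu +
        (Ideal.Quotient.mk Q s) * Ideal.Quotient.mk Q u' * Ideal.Quotient.mk Q u * hst
  have e4 : RowEquiv (rowPair v i j (u * x) (u * y)) (rowPair v i j (u ^ 2 * x) y) := by
    refine (rowPair_whitehead v hij hu _ _).trans
      (rowPair_congr v hij ?_ ?_) <;> simp only [map_mul, map_pow]
    · ring
    · linear_combination -(Ideal.Quotient.mk Q y) * huu
  have := e1.trans (e2.trans (e3.trans e4))
  rw [rowPair_self] at this
  convert this using 1
  rw [rowPair_comm v hij, rowPair, hy, Function.update_eq_self]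

theorem span_range_update_sq {v : ι → A} (hv : Ideal.span (Set.range v) = ⊤) (k : ι) (c : A)
    (h : v k ∈ Ideal.radical (Ideal.span {c} ⊔ Ideal.span (v '' {k}ᶜ))) :
    Ideal.span (Set.range (Function.update v k c)) = ⊤ := by
  rw [← Ideal.radical_eq_top, eq_top_iff, ← hv, Ideal.span_le]
  have hle : Ideal.span {c} ⊔ Ideal.span (v '' {k}ᶜ) ≤
      Ideal.span (Set.range (Function.update v k c)) := by
    refine sup_le ?_ ?_
    · rw [Ideal.span_singleton_le_iff_mem]
      exact Ideal.subset_span ⟨k, by simp⟩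
    · rw [Ideal.span_le]
      rintro _ ⟨l, hl, rfl⟩
      exact Ideal.subset_span ⟨l, by simp [show l ≠ k from hl]⟩
  rintro _ ⟨l, rfl⟩
  by_cases hl : l = k
  · subst hl
    exact Ideal.radical_mono hle h
  · exact Ideal.le_radical (Ideal.subset_span ⟨l, by simp [hl]⟩)

/-- If `2` is invertible, squaring a fixed entry is compatible with elementary equivalence of
unimodular rows of length at least three. -/
theorem RowEquiv.update_sq (h2 : IsUnit (2 : A)) (h3 : ∀ i j : ι, ∃ k, k ≠ i ∧ k ≠ j) {v w : ι → A}
    (h : RowEquiv v w) (hv : Ideal.span (Set.range v) = ⊤) (k : ι) :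
    RowEquiv (Function.update v k (v k ^ 2)) (Function.update w k (w k ^ 2)) := by
  induction h with
  | refl => exact RowEquiv.refl _
  | @step w i j hij c h ih =>
    refine ih.trans ?_
    have hw : Ideal.span (Set.range w) = ⊤ := h.span_range_eq.trans hv
    by_cases hjk : j = k
    · subst hjk
      refine RowEquiv.of_sub_mem j (fun l hl => by simp [hl]) ?_
      simp only [Function.update_self]
      rw [show (w j + c * w i) ^ 2 - w j ^ 2 = (c * (2 * w j + c * w i)) * w i by ring]
      exact Ideal.mul_mem_left _ _ (Ideal.subset_span ⟨i, hij, by simp [hij]⟩)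
    by_cases hik : i = k
    swap
    · refine RowEquiv.of_sub_mem j (fun l hl => by
        by_cases hl' : l = k <;> simp [hl, hl', Ne.symm hjk]) ?_
      simp only [Function.update_self, Function.update_of_ne hjk,
        Function.update_of_ne (Ne.symm hjk),
        add_sub_cancel_left]
      exact Ideal.mul_mem_left _ _ (Ideal.subset_span ⟨i, hij, by simp [hik]⟩)
    subst hik
    obtain ⟨o, hoi, hoj⟩ := h3 i j
    obtain ⟨t, ht⟩ := h2.exists_right_inv
    set V := Function.update w i (w i ^ 2) with hV
    have hVi : V i = w i ^ 2 := by simp [hV]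
    have hVj : V j = w j := by simp [hV, hjk]
    have hVu : Ideal.span (Set.range V) = ⊤ :=
      span_range_update_sq hw i _
        ⟨2, Ideal.mem_sup_left (Ideal.mem_span_singleton_self _)⟩
    obtain ⟨a, ha, b, hb, hab⟩ := Submodule.mem_sup.1
      ((span_pair_compl_le w (i := i) (j := j) (hw ▸ Submodule.mem_top)) : (1 : A) ∈ _)
    obtain ⟨x, y, rfl⟩ := Ideal.mem_span_pair.1 ha
    have hsq : w i ^ 2 ∈ Ideal.span (V '' {j, o}ᶜ) :=
      Ideal.subset_span ⟨i, by simp [hij, hoi.symm], hVi⟩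
    have hS := RowEquiv.sq_mul (v := V) (i := j) (j := o) (k := i) hoj.symm hij hoi.symm hVu
      (u := 1 + c * w i * y * t) (u' := 1 - c * w i * y * t) (by
        rw [show (1 + c * w i * y * t) * (1 - c * w i * y * t) - 1 = -(c * y * t) ^ 2 * w i ^ 2 by
          ring]
        exact Ideal.mul_mem_left _ _ hsq)
    refine hS.trans (RowEquiv.of_sub_mem j (fun l hl => ?_) ?_)
    · by_cases hl' : l = i
      · subst hl'; simp [hij, hVi]
      · simp [hV, hl, hl']
    · simp only [Function.update_self, Function.update_of_ne hjk, hVj]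
      rw [show Function.update V j ((1 + c * w i * y * t) ^ 2 * w j) '' {j}ᶜ = V '' {j}ᶜ from
        Set.image_congr fun l hl => by simp [show l ≠ j from hl]]
      have hsq' : w i ^ 2 ∈ Ideal.span (V '' {j}ᶜ) := Ideal.subset_span ⟨i, hij, hVi⟩
      have hb' : b ∈ Ideal.span (V '' {j}ᶜ) := by
        refine Ideal.span_mono ?_ hb
        rintro _ ⟨l, hl, rfl⟩
        simp only [Set.mem_compl_iff, Set.mem_insert_iff, Set.mem_singleton_iff, not_or] at hl
        exact ⟨l, hl.2, by simp [hV, hl.1]⟩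
      have key : w j + c * w i - (1 + c * w i * y * t) ^ 2 * w j =
          (c * x - (c * y * t) ^ 2 * w j) * w i ^ 2 + (c * w i) * b := by
        linear_combination -(c * w i) * hab - (c * w i * y * w j) * ht
      have := add_mem (Ideal.mul_mem_left _ (c * x - (c * y * t) ^ 2 * w j) hsq')
        (Ideal.mul_mem_left _ (c * w i) hb')
      rw [← key] at this
      simpa [hjk, Ne.symm hjk] using this

theorem RowEquiv.mul_unit_sq (h2 : IsUnit (2 : A)) (h3 : ∀ i j : ι, ∃ k, k ≠ i ∧ k ≠ j)
    {v : ι → A} (hv : Ideal.span (Set.range v) = ⊤) {i k : ι} (hki : k ≠ i) {u u' : A}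
    (hu : u * u' - 1 ∈ Ideal.span {v k}) :
    RowEquiv (Function.update v i (u * v i ^ 2)) (Function.update v i (v i ^ 2)) := by
  obtain ⟨j, hji, hjk⟩ := h3 i k
  have hq : u * u' - 1 ∈ Ideal.span (v '' {i, j}ᶜ) := by
    refine Ideal.span_mono ?_ hu
    rintro _ rfl
    exact ⟨k, by simp [hki, hjk.symm], rfl⟩
  have hq' : u' * u - 1 ∈ Ideal.span (v '' {i, j}ᶜ) := by rwa [mul_comm]
  have huu := mk_eq_one hq
  have hupd : ∀ x, Function.update v i x = rowPair v i j x (v j) := fun x => by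
    rw [rowPair_comm v hji.symm, rowPair, Function.update_eq_self]
  have hrw := rowPair_self v i j
  -- the row with entries `v i` and `u * v j`
  have hE : RowEquiv (rowPair v i j (v i) (u * v j)) (rowPair v i j (u * v i) (v j)) := by
    refine (rowPair_whitehead v hji.symm hq _ _).trans (rowPair_congr v hji.symm rfl ?_)
    simp only [map_mul]
    linear_combination -(Ideal.Quotient.mk _ (v j)) * huu
  have hEu : Ideal.span (Set.range (rowPair v i j (v i) (u * v j))) = ⊤ := by
    rw [rowPair, Function.update_eq_self]
    refine span_range_update_sq hv j _ (Ideal.le_radical ?_)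
    have h1 : v j = u' * (u * v j) - v j * (u * u' - 1) := by ring
    have hm : v k ∈ Ideal.span (v '' {j}ᶜ) := Ideal.subset_span ⟨k, hjk.symm, rfl⟩
    have hu' := (Ideal.span_singleton_le_iff_mem _).2 hm hu
    have := sub_mem (Ideal.mul_mem_left _ u' (Ideal.mem_sup_left
      (Ideal.mem_span_singleton_self (u * v j))))
      (Ideal.mul_mem_left _ (v j) (Ideal.mem_sup_right hu'))
    rwa [← h1] at this
  have hsq := hE.update_sq h2 h3 hEu i
  have hup : ∀ x y z, Function.update (rowPair v i j x y) i z = rowPair v i j z y := fun x y z => by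
    rw [rowPair_comm v hji.symm, rowPair, Function.update_idem, ← rowPair, rowPair_comm v hji]
  have hi : ∀ x y, rowPair v i j x y i = x := fun x y => by simp [rowPair, hji.symm]
  rw [hup, hup, hi, hi] at hsq
  rw [hupd, hupd]
  have hW : RowEquiv (rowPair v i j (u * v i ^ 2) (v j))
      (rowPair v i j (v i ^ 2) (u * v j)) := by
    refine (rowPair_whitehead v hji.symm hq' _ _).trans (rowPair_congr v hji.symm ?_ rfl)
    simp only [map_mul, map_pow]
    linear_combination -(Ideal.Quotient.mk _ (v i)) ^ 2 * huu
  refine hW.trans (hsq.trans ?_)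
  have hVu : Ideal.span (Set.range (Function.update v i (v i ^ 2))) = ⊤ :=
    span_range_update_sq hv i _ ⟨2, Ideal.mem_sup_left (Ideal.mem_span_singleton_self _)⟩
  have hS := RowEquiv.sq_mul (i := i) (j := j) (k := k) hji.symm hki hjk.symm hVu (u := u)
    (u' := u') (by
      rw [hupd, image_rowPair_compl]; exact hq)
  rw [← hupd, ← hupd]
  simpa [mul_pow] using hS.symm

/-- If the entry at `i` is, modulo the other entries, a square up to a unit modulo the entry at
`k`, it may be multiplied by any unit modulo the entry at `k`. -/
theorem RowEquiv.mul_unit_of_sq (h2 : IsUnit (2 : A)) (h3 : ∀ i j : ι, ∃ k, k ≠ i ∧ k ≠ j)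
    {v : ι → A} (hv : Ideal.span (Set.range v) = ⊤) {i k : ι} (hki : k ≠ i) {r r' c c' z : A}
    (hr : r * r' - 1 ∈ Ideal.span {v k}) (hc : c * c' - 1 ∈ Ideal.span {v k})
    (hz : v i - c * z ^ 2 ∈ Ideal.span (v '' {i}ᶜ)) :
    RowEquiv (Function.update v i (r * v i)) v := by
  have hV : Ideal.span (Set.range (Function.update v i z)) = ⊤ := by
    refine span_range_update_sq hv i _ (Ideal.le_radical ?_)
    rw [show v i = (c * z) * z + (v i - c * z ^ 2) by ring]
    exact add_mem (Ideal.mul_mem_left _ _ (Ideal.mem_sup_left (Ideal.mem_span_singleton_self _)))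
      (Ideal.mem_sup_right hz)
  have hcr : (r * c) * (r' * c') - 1 ∈ Ideal.span {v k} := by
    rw [show (r * c) * (r' * c') - 1 = c * c' * (r * r' - 1) + (c * c' - 1) by ring]
    exact add_mem (Ideal.mul_mem_left _ _ hr) hc
  have h₁ := RowEquiv.mul_unit_sq h2 h3 hV hki (u := c) (u' := c') (by simpa [hki] using hc)
  have h₂ := RowEquiv.mul_unit_sq h2 h3 hV hki (u := r * c) (u' := r' * c')
    (by simpa [hki] using hcr)
  simp only [Function.update_self, Function.update_idem] at h₁ h₂
  have h₃ := RowEquiv.update_add v i (neg_mem hz) (v i)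
  have h₄ := RowEquiv.update_add v i (Ideal.mul_mem_left _ (-r) hz) (r * v i)
  rw [Function.update_eq_self, show v i + -(v i - c * z ^ 2) = c * z ^ 2 by ring] at h₃
  rw [show r * v i + -r * (v i - c * z ^ 2) = r * c * z ^ 2 by ring] at h₄
  exact h₄.trans (h₂.trans (h₁.symm.trans h₃.symm))

end Moves

/-! ### Nice rows -/

section Nice

variable {A : Type*} [CommRing A] {m : ℕ}

/-- A row with first entry `a * r - 1` is nice if its second entry may be multiplied by `r`. -/
def NiceRow (a r : A) (v : Fin (m + 3) → A) : Prop :=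
  Ideal.span (Set.range v) = ⊤ → v 0 = a * r - 1 → RowEquiv (Function.update v 1 (r * v 1)) v

theorem fin_exists_ne_ne (i j : Fin (m + 3)) : ∃ k, k ≠ i ∧ k ≠ j :=
  Fin.exists_ne_and_ne_of_two_lt i j (by omega)

theorem zero_ne_one_fin : (0 : Fin (m + 3)) ≠ 1 := by simp

/-- If the entry at `j` is nice up to a unit modulo `v k`, spans of the other entries agree. -/
theorem span_image_update_mul_ge {v : Fin (m + 3) → A} {a r : A} (h0 : v 0 = a * r - 1)
    {j : Fin (m + 3)} (hj : j ≠ 0) :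
    Ideal.span (v '' {j}ᶜ) ≤ Ideal.span (Function.update v 1 (r * v 1) '' {j}ᶜ) := by
  rw [Ideal.span_le]
  rintro _ ⟨l, hl, rfl⟩
  by_cases hl1 : l = 1
  · subst hl1
    have h1 : v 1 = a * (r * v 1) - v 1 * v 0 := by rw [h0]; ring
    have := sub_mem (Ideal.mul_mem_left (Ideal.span (Function.update v 1 (r * v 1) '' {j}ᶜ)) a
      (Ideal.subset_span ⟨1, hl, Function.update_self _ _ _⟩))
      (Ideal.mul_mem_left _ (v 1) (Ideal.subset_span ⟨0, hj.symm,
        Function.update_of_ne zero_ne_one_fin _ _⟩))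
    rwa [← h1] at this
  · exact Ideal.subset_span ⟨l, hl, by simp [hl1]⟩

namespace NiceRow

theorem of_rowEquiv {a r a' r' : A} {v v' : Fin (m + 3) → A} (h : NiceRow a' r' v')
    (h0 : v 0 = a * r - 1 → v' 0 = a' * r' - 1) (h₁ : v 0 = a * r - 1 → RowEquiv v v')
    (h₂ : v 0 = a * r - 1 → RowEquiv (Function.update v 1 (r * v 1))
      (Function.update v' 1 (r' * v' 1))) : NiceRow a r v := fun hu hv =>
  (h₂ hv).trans ((h ((h₁ hv).span_range_eq.trans hu) (h0 hv)).trans (h₁ hv).symm)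

/-- Changing `a` modulo the entries other than the first one. -/
theorem add_left {a r l : A} {v : Fin (m + 3) → A} (hl : l ∈ Ideal.span (v '' {0}ᶜ))
    (h : NiceRow (a + l) r (Function.update v 0 (v 0 + r * l))) : NiceRow a r v := by
  refine h.of_rowEquiv (fun h0 => by simp [h0]; ring) (fun _ => ?_) (fun _ => ?_)
  · simpa using RowEquiv.update_add v 0 (Ideal.mul_mem_left _ r hl) (v 0)
  · refine RowEquiv.of_sub_mem 0 (fun i hi => ?_) ?_
    · by_cases hi1 : i = 1
      · subst hi1; simp
      · simp [hi, hi1]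
    · simp only [Function.update_self, Function.update_of_ne zero_ne_one_fin, add_sub_cancel_left]
      have : Ideal.span (v '' {0}ᶜ) ≤ Submodule.comap (LinearMap.mulLeft A r)
          (Ideal.span (Function.update v 1 (r * v 1) '' {0}ᶜ)) := by
        refine Submodule.span_le.2 ?_
        rintro _ ⟨l, hl, rfl⟩
        change r * v l ∈ Ideal.span _
        by_cases hl1 : l = 1
        · subst hl1; exact Ideal.subset_span ⟨1, hl, by simp⟩
        · exact Ideal.mul_mem_left _ _ (Ideal.subset_span ⟨l, hl, by simp [hl1]⟩)
      exact this hl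

theorem isUnit_mod {a r : A} {v : Fin (m + 3) → A} (h0 : v 0 = a * r - 1) {S : Set (Fin (m + 3))}
    (hS : 0 ∈ S) : r * a - 1 ∈ Ideal.span (v '' S) :=
  Ideal.subset_span ⟨0, hS, by rw [h0]; ring⟩

/-- The roles of `a` and `r` may be exchanged. -/
theorem swap {a r : A} {v : Fin (m + 3) → A} (h : NiceRow r a v) : NiceRow a r v := by
  intro hu h0
  have h0' : v 0 = r * a - 1 := by rw [h0]; ring
  have h₁ := h hu h0'
  set V := Function.update v 1 (a * v 1) with hV
  have hVu : Ideal.span (Set.range V) = ⊤ := h₁.span_range_eq.symm.trans hu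
  obtain ⟨o, ho0, ho1⟩ := fin_exists_ne_ne (m := m) 0 1
  have hV0 : V 0 = a * r - 1 := by simp [hV, h0]
  have hS := RowEquiv.sq_mul (v := V) (i := 1) (j := o) (k := 0) ho1.symm zero_ne_one_fin ho0.symm
    hVu (isUnit_mod hV0 (by simp [ho0.symm]))
  refine RowEquiv.trans ?_ (hS.symm.trans h₁)
  refine RowEquiv.of_sub_mem 1 (fun i hi => by simp [hi, hV]) ?_
  simp only [Function.update_self, hV]
  rw [show r ^ 2 * (a * v 1) - r * v 1 = r * v 1 * v 0 by rw [h0]; ring]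
  exact Ideal.mul_mem_left _ _ (Ideal.subset_span ⟨0, by simp, by simp⟩)

/-- Changing `r` modulo the entries other than the first one. -/
theorem add_right {a r l : A} {v : Fin (m + 3) → A} (hl : l ∈ Ideal.span (v '' {0}ᶜ))
    (h : NiceRow a (r + l) (Function.update v 0 (v 0 + a * l))) : NiceRow a r v :=
  (add_left hl h.swap).swap

/-- Changing an entry other than the first one modulo the remaining ones. -/
theorem add_entry {a r x : A} {v : Fin (m + 3) → A} {j : Fin (m + 3)} (hj : j ≠ 0)
    (hx : x ∈ Ideal.span (v '' {j}ᶜ)) (h : NiceRow a r (Function.update v j (v j + x))) :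
    NiceRow a r v := by
  refine h.of_rowEquiv (fun h0 => by simp [h0, hj.symm]) (fun _ => ?_) (fun h0 => ?_)
  · simpa using RowEquiv.update_add v j hx (v j)
  · refine RowEquiv.of_sub_mem j (fun i hi => ?_) ?_
    · by_cases hi1 : i = 1
      · subst hi1; simp [hi]
      · simp [hi, hi1]
    · have hx' := span_image_update_mul_ge h0 hj hx
      by_cases hj1 : j = 1
      · subst hj1
        simp only [Function.update_self, mul_add, add_sub_cancel_left]
        exact Ideal.mul_mem_left _ _ hx'
      · simpa [hj1] using hx'

/-- Multiplying an entry by the square of a unit modulo the first one. -/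
theorem sq_mul_entry {a r s s' : A} {v : Fin (m + 3) → A} {j : Fin (m + 3)} (hj : j ≠ 0)
    (hs : s * s' - 1 ∈ Ideal.span {v 0})
    (h : NiceRow a r (Function.update v j (s ^ 2 * v j))) : NiceRow a r v := by
  intro hu h0
  obtain ⟨o, ho0, hoj⟩ := fin_exists_ne_ne (m := m) 0 j
  have hS : ∀ V : Fin (m + 3) → A, V 0 = v 0 → Ideal.span (Set.range V) = ⊤ →
      RowEquiv V (Function.update V j (s ^ 2 * V j)) := fun V h0 hV =>
    RowEquiv.sq_mul (v := V) (i := j) (j := o) (k := 0) hoj.symm hj.symm ho0.symm hV (u' := s')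
      (Ideal.span_mono (by rintro _ rfl; exact ⟨0, by simp [hj.symm, ho0.symm], h0⟩) hs)
  refine h.of_rowEquiv (fun h0 => by simp [h0, hj.symm]) (fun _ => hS v rfl hu) (fun h0 => ?_) hu h0
  refine (hS (Function.update v 1 (r * v 1)) (by simp) ?_).trans ?_
  · refine span_range_update_sq hu 1 _ (Ideal.le_radical ?_)
    have hm : v 0 ∈ Ideal.span (v '' {1}ᶜ) := Ideal.subset_span ⟨0, by simp, rfl⟩
    have := sub_mem (Ideal.mul_mem_left _ a (Ideal.mem_sup_left
      (Ideal.mem_span_singleton_self (r * v 1)))) (Ideal.mul_mem_left _ (v 1)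
        (Ideal.mem_sup_right hm))
    rw [h0] at this
    convert this using 1
    ring
  · apply RowEquiv.of_eq
    ext l
    by_cases hlj : l = j <;> by_cases hl1 : l = 1
    · subst hlj; subst hl1; simp; ring
    · subst hlj; simp [hl1]
    · subst hl1; simp [hlj, Ne.symm hlj]
    · simp [hlj, hl1]

/-- Exchanging the distinguished entry with another one, up to sign. -/
theorem swap_entry {a r : A} {v : Fin (m + 3) → A} {j : Fin (m + 3)} (hj : j ≠ 0) (hj1 : j ≠ 1)
    (h : NiceRow a r (rowPair v 1 j (-v j) (v 1))) : NiceRow a r v := by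
  refine h.of_rowEquiv (fun h0 => by simp [h0, hj.symm, rowPair]) (fun _ => ?_) (fun h0 => ?_)
  · simpa [rowPair_self] using rowPair_weyl v hj1.symm (u := 1) (u' := 1) (by simp) (v 1) (v j)
  · have hq := isUnit_mod (S := {1, j}ᶜ) h0 (by simp [hj.symm])
    have h1 := rowPair_weyl v hj1.symm (u := 1) (u' := 1) (by simp) (r * v 1) (v j)
    have h2 := rowPair_whitehead v hj1.symm hq (-1 * v j) (1 * (r * v 1))
    refine RowEquiv.trans ?_ (h1.trans (h2.trans ((rowPair_congr v hj1.symm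
      (x' := r * (-v j)) (y' := v 1) ?_ ?_).trans ?_)))
    · apply RowEquiv.of_eq
      rw [rowPair_comm v hj1.symm, rowPair, Function.update_eq_self]
    · simp
    · have := mk_eq_one hq
      simp only [map_mul, map_one]
      linear_combination -(Ideal.Quotient.mk _ (v 1)) * this
    · apply RowEquiv.of_eq
      rw [rowPair_comm v hj1.symm, rowPair_comm v hj1.symm]
      simp [rowPair]

/-- Moving a square factor from `a` to `r`. -/
theorem move_sq {a r s : A} {v : Fin (m + 3) → A} (h : NiceRow (s ^ 2 * a) r v) :
    NiceRow a (s ^ 2 * r) v := by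
  intro hu h0
  have h0' : v 0 = s ^ 2 * a * r - 1 := by rw [h0]; ring
  have h₁ := h hu h0'
  refine RowEquiv.trans ?_ h₁
  obtain ⟨o, ho0, ho1⟩ := fin_exists_ne_ne (m := m) 0 1
  have hS := RowEquiv.sq_mul (v := Function.update v 1 (r * v 1)) (i := 1) (j := o) (k := 0)
    ho1.symm zero_ne_one_fin ho0.symm (h₁.span_range_eq.symm.trans hu) (u := s) (u' := s * a * r)
    (Ideal.subset_span ⟨0, by simp [ho0.symm], by
      rw [Function.update_of_ne zero_ne_one_fin, h0]; ring⟩)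
  convert hS.symm using 1
  simp [mul_assoc]

end NiceRow

end Nice

/-! ### Avoiding primes -/

section Avoidance

/-- An avoidance lemma: a translate of the image of a linear map that individually leaves finitely
many submodules, each attached to a prime, leaves all of them simultaneously. -/
theorem exists_add_map_notMem {S M N : Type*} [CommRing S] [AddCommGroup M] [Module S M]
    [AddCommGroup N] [Module S N] (s : Finset (Ideal S)) (hs : ∀ P ∈ s, P.IsPrime)
    (f : M →ₗ[S] N) (t : N) (K : Ideal S → Submodule S N)
    (h₁ : ∀ P ∈ s, ∀ e ∉ P, ∀ z, e • z ∈ K P → z ∈ K P)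
    (h₂ : ∀ P ∈ s, ∀ e ∈ P, ∀ z, e • z ∈ K P) (h₃ : ∀ P ∈ s, ∃ z, f z ∉ K P) :
    ∃ y, ∀ P ∈ s, t + f y ∉ K P := by
  classical
  induction hn : s.card generalizing s with
  | zero => rw [Finset.card_eq_zero] at hn; subst hn; exact ⟨0, by simp⟩
  | succ n ih =>
    obtain ⟨P, hP⟩ := s.exists_minimal (Finset.card_pos.1 (by omega))
    have hPs : P ∈ s := hP.1
    obtain ⟨y, hy⟩ := ih (s.erase P) (fun Q hQ => hs Q (Finset.mem_of_mem_erase hQ))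
      (fun Q hQ => h₁ Q (Finset.mem_of_mem_erase hQ))
      (fun Q hQ => h₂ Q (Finset.mem_of_mem_erase hQ))
      (fun Q hQ => h₃ Q (Finset.mem_of_mem_erase hQ))
      (by rw [Finset.card_erase_of_mem hPs, hn]; rfl)
    by_cases hyP : t + f y ∈ K P
    swap
    · refine ⟨y, fun Q hQ => ?_⟩
      by_cases h : Q = P
      · rwa [h]
      · exact hy Q (Finset.mem_erase.2 ⟨h, hQ⟩)
    have hnle : ¬ (s.erase P).inf id ≤ P := by
      rw [(hs P hPs).inf_le']
      rintro ⟨Q, hQ, hQP⟩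
      exact (Finset.mem_erase.1 hQ).1 (le_antisymm hQP (hP.2 (Finset.mem_of_mem_erase hQ) hQP))
    obtain ⟨e, he, heP⟩ := Set.not_subset.1 hnle
    obtain ⟨z, hz⟩ := h₃ P hPs
    refine ⟨y + e • z, fun Q hQ => ?_⟩
    rw [map_add, map_smul, ← add_assoc]
    by_cases h : Q = P
    · subst h
      rw [Submodule.add_mem_iff_right _ hyP]
      exact fun h => hz (h₁ Q hPs e heP _ h)
    · have hQ' := Finset.mem_erase.2 ⟨h, hQ⟩
      rw [Submodule.add_mem_iff_left _ (h₂ Q hQ e (Finset.inf_le (f := id) hQ' he) _)]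
      exact hy Q hQ'

theorem exists_notMem_forall_minimalPrimes {R : Type*} [CommRing R] [IsNoetherianRing R]
    {P : Ideal R} (hP : P ∈ minimalPrimes R) :
    ∃ e ∉ P, ∀ Q ∈ minimalPrimes R, Q ≠ P → e ∈ Q := by
  classical
  have hfin : (minimalPrimes R).Finite := Ideal.finite_minimalPrimes_of_isNoetherianRing R ⊥
  have hnle : ¬ (hfin.toFinset.erase P).inf id ≤ P := by
    rw [(show P.IsPrime from hP.1.1).inf_le']
    rintro ⟨Q, hQ, hQP⟩
    rw [Finset.mem_erase, Set.Finite.mem_toFinset] at hQ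
    exact hQ.1 (le_antisymm hQP (hP.2 hQ.2.1 hQP))
  obtain ⟨e, he, heP⟩ := Set.not_subset.1 hnle
  exact ⟨e, heP, fun Q hQ hQP => Finset.inf_le (f := id)
    (Finset.mem_erase.2 ⟨hQP, hfin.mem_toFinset.2 hQ⟩) he⟩

/-- An ideal contained in no minimal prime contains an element outside all minimal primes. -/
theorem exists_mem_forall_notMem_minimalPrimes {R : Type*} [CommRing R] [IsNoetherianRing R]
    {J : Ideal R} (hJ : ∀ P ∈ minimalPrimes R, ¬ J ≤ P) :
    ∃ x ∈ J, ∀ P ∈ minimalPrimes R, x ∉ P := by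
  have hfin : (minimalPrimes R).Finite := Ideal.finite_minimalPrimes_of_isNoetherianRing R ⊥
  by_contra! h
  have hsub : (J : Set R) ⊆ ⋃ P ∈ (hfin.toFinset : Set (Ideal R)), P := by
    intro x hx
    obtain ⟨P, hP, hxP⟩ := h x hx
    exact Set.mem_biUnion (by simpa using hP) hxP
  rw [Ideal.subset_union_prime (f := fun P => P) ⊤ ⊤ (fun P hP _ _ =>
    (hfin.mem_toFinset.1 hP).1.1)] at hsub
  obtain ⟨P, hP, hle⟩ := hsub
  exact hJ P (hfin.mem_toFinset.1 hP) hle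

/-- A polynomial nonzero modulo every minimal prime has a multiple whose leading coefficient avoids
all minimal primes. -/
theorem exists_dvd_leadingCoeff_notMem {R : Type*} [CommRing R] [IsNoetherianRing R] {q : R[X]}
    (hq : ∀ P ∈ minimalPrimes R, q ∉ P.map C) :
    ∃ g, q ∣ g ∧ ∀ P ∈ minimalPrimes R, g.leadingCoeff ∉ P := by
  suffices H : ∀ P ∈ minimalPrimes R, ¬ (Ideal.span {q}).leadingCoeff ≤ P by
    obtain ⟨x, hx, hxP⟩ := exists_mem_forall_notMem_minimalPrimes H
    obtain ⟨g, hg, rfl⟩ := Ideal.mem_leadingCoeff _ _ |>.1 hx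
    exact ⟨g, Ideal.mem_span_singleton.1 hg, hxP⟩
  intro P hP hle
  have hPp : P.IsPrime := hP.1.1
  obtain ⟨e, heP, he⟩ := exists_notMem_forall_minimalPrimes hP
  -- the part of `q` up to its degree modulo `P`
  obtain ⟨k, hk, hk'⟩ : ∃ k, q.coeff k ∉ P ∧ ∀ l, k < l → q.coeff l ∈ P := by
    have hne : (q.map (Ideal.Quotient.mk P)) ≠ 0 := by
      intro h0
      refine hq P hP (Ideal.mem_map_C_iff.2 fun n => ?_)
      have := congrArg (fun p => coeff p n) h0
      simpa [Ideal.Quotient.eq_zero_iff_mem] using this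
    refine ⟨(q.map (Ideal.Quotient.mk P)).natDegree, ?_, fun l hl => ?_⟩
    · have := leadingCoeff_ne_zero.2 hne
      rwa [leadingCoeff, coeff_map, Ne, Ideal.Quotient.eq_zero_iff_mem] at this
    · have := coeff_eq_zero_of_natDegree_lt hl
      rwa [coeff_map, Ideal.Quotient.eq_zero_iff_mem] at this
  set g₀ : R[X] := ∑ i ∈ Finset.range (k + 1), monomial i (q.coeff i) with hg₀
  have hg₀c : ∀ l, g₀.coeff l = if l ≤ k then q.coeff l else 0 := by
    intro l
    simp [hg₀, coeff_monomial]
  have hg₀d : g₀.natDegree ≤ k := natDegree_le_iff_coeff_eq_zero.2 fun l hl => by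
    rw [hg₀c, if_neg (by omega)]
  have hnil : IsNilpotent (C e * (q - g₀)) := by
    rw [Polynomial.isNilpotent_iff]
    intro l
    rw [coeff_C_mul, coeff_sub, hg₀c, ← mem_nilradical, nilradical_eq_sInf, Submodule.mem_sInf]
    intro (Q : Ideal R) hQ
    have hQp : Q.IsPrime := hQ
    obtain ⟨Q', hQ', hle⟩ := Ideal.exists_minimalPrimes_le (bot_le : ⊥ ≤ Q)
    refine hle ?_
    by_cases hQP : Q' = P
    · subst hQP
      refine Ideal.mul_mem_left _ _ ?_
      split_ifs with hl
      · simp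
      · simpa using hk' l (by omega)
    · exact Ideal.mul_mem_right _ _ (he Q' hQ' hQP)
  obtain ⟨K, hK⟩ := hnil
  have hmem : C (e ^ K) * g₀ ^ K ∈ Ideal.span {q} := by
    rw [Ideal.mem_span_singleton]
    have h1 : C e * q ∣ (C e * g₀) ^ K - (-(C e * (q - g₀))) ^ K := by
      refine dvd_trans (dvd_of_eq ?_) (sub_dvd_pow_sub_pow _ _ K)
      ring
    rw [neg_pow, hK, mul_zero, sub_zero, mul_pow, ← C_pow] at h1
    exact (Dvd.intro_left _ rfl).trans h1
  have hcoef : (C (e ^ K) * g₀ ^ K).coeff (K * k) ∉ P := by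
    rw [coeff_C_mul, coeff_pow_of_natDegree_le hg₀d, hg₀c, if_pos le_rfl, ← mul_pow]
    exact fun h => (hPp.mem_or_mem (hPp.mem_of_pow_mem _ h)).elim heP hk
  have hdeg : (C (e ^ K) * g₀ ^ K).natDegree = K * k := by
    refine le_antisymm ?_ (le_natDegree_of_ne_zero fun h => hcoef (by rw [h]; exact zero_mem _))
    exact (natDegree_C_mul_le _ _).trans (natDegree_pow_le_of_le K hg₀d)
  exact hcoef (hdeg ▸ hle ((Ideal.mem_leadingCoeff _ _).2 ⟨_, hmem, rfl⟩))

/-- Adding multiples of `q` to the entries of a row raises the heights of the primes containing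
the entries but not `q`. -/
theorem exists_forall_height_le {A : Type*} [CommRing A] [IsNoetherianRing A] {ι : Type*}
    [DecidableEq ι] (T : Finset (Ideal A)) (h : Ideal A → ℕ∞)
    (hT : ∀ b ∈ T, ∀ Q : Ideal A, Q.IsPrime → b ≤ Q → h b ≤ Q.height) (q : A) (t : ι → A)
    (s : Finset ι) :
    ∃ l : ι → A, ∀ b ∈ T, ∀ Q : Ideal A, Q.IsPrime → b ≤ Q → (∀ i ∈ s, t i + q * l i ∈ Q) →
      q ∉ Q → h b + s.card ≤ Q.height := by
  classical
  induction s using Finset.induction_on with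
  | empty => exact ⟨0, by simpa using fun b hb Q hQ hbQ _ => hT b hb Q hQ hbQ⟩
  | insert i s his ih =>
    obtain ⟨l, hl⟩ := ih
    let c : Ideal A → Ideal A := fun b => b ⊔ Ideal.span ((fun i => t i + q * l i) '' s)
    have hfin : ∀ b, (c b).minimalPrimes.Finite := fun b =>
      Ideal.finite_minimalPrimes_of_isNoetherianRing A _
    obtain ⟨y, hy⟩ := exists_add_map_notMem
      ((T.biUnion fun b => (hfin b).toFinset).filter fun Q => q ∉ Q)
      (fun Q hQ => by
        simp only [Finset.mem_filter, Finset.mem_biUnion, Set.Finite.mem_toFinset] at hQ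
        obtain ⟨⟨b, -, hQ⟩, -⟩ := hQ
        exact hQ.1.1) (LinearMap.mulLeft A q) (t i) (fun Q => Q)
      (fun Q hQ e he z hz => by
        simp only [Finset.mem_filter, Finset.mem_biUnion, Set.Finite.mem_toFinset] at hQ
        obtain ⟨⟨b, -, hQ⟩, -⟩ := hQ
        exact (hQ.1.1.mem_or_mem hz).resolve_left he)
      (fun Q hQ e he z => Ideal.mul_mem_right _ _ he)
      (fun Q hQ => ⟨1, by simpa using (Finset.mem_filter.1 hQ).2⟩)
    refine ⟨Function.update l i y, fun b hb Q hQ hbQ hsQ hqQ => ?_⟩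
    have hl' : ∀ j ∈ s, t j + q * l j ∈ Q := fun j hj => by
      have := hsQ j (Finset.mem_insert_of_mem hj)
      rwa [Function.update_of_ne (by rintro rfl; exact his hj)] at this
    have hcQ : c b ≤ Q := sup_le hbQ (Ideal.span_le.2 (by rintro _ ⟨j, hj, rfl⟩; exact hl' j hj))
    obtain ⟨Q', hQ', hle⟩ := Ideal.exists_minimalPrimes_le hcQ
    have hQ'p : Q'.IsPrime := hQ'.1.1
    have hne : Q' ≠ Q := by
      rintro rfl
      refine hy Q' (Finset.mem_filter.2 ⟨Finset.mem_biUnion.2 ⟨b, hb,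
        (hfin b).mem_toFinset.2 hQ'⟩, hqQ⟩) ?_
      simpa using hsQ i (Finset.mem_insert_self _ _)
    have := hl b hb Q' hQ'p (le_sup_left.trans hQ'.1.2) (fun j hj => hQ'.1.2
      (Ideal.mem_sup_right (Ideal.subset_span ⟨j, hj, rfl⟩))) (fun h => hqQ (hle h))
    rw [Finset.card_insert_of_notMem his, Nat.cast_add, Nat.cast_one, ← add_assoc]
    exact (add_le_add_left this 1).trans
      (Ideal.height_add_one_le_of_lt_of_isPrime (lt_of_le_of_ne hle hne))

theorem mem_minimalPrimes_of_comap_C {R : Type*} [CommRing R] {Q : Ideal R[X]}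
    (hQ : Q ∈ minimalPrimes R[X]) : Q.comap C ∈ minimalPrimes R := by
  have hQp : Q.IsPrime := hQ.1.1
  refine ⟨⟨inferInstance, bot_le⟩, fun P hP hle => ?_⟩
  have hPp : P.IsPrime := hP.1
  have hPX : (P.map (C : R →+* R[X])).IsPrime := Ideal.isPrime_map_C_of_isPrime
  have h1 := hQ.2 ⟨hPX, bot_le⟩ (Ideal.map_le_iff_le_comap.2 hle)
  exact (Ideal.comap_mono h1).trans (fun x hx => by simpa using Ideal.mem_map_C_iff.1 hx 0)

theorem height_le_of_ne_maximalIdeal {R : Type*} [CommRing R] [IsLocalRing R]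
    {n : ℕ} (hdim : ringKrullDim R ≤ (n + 1 : ℕ)) {P : Ideal R} (hP : P.IsPrime)
    (hne : P ≠ IsLocalRing.maximalIdeal R) : P.height ≤ n := by
  have h1 := Ideal.height_add_one_le_of_lt_of_isPrime
    (lt_of_le_of_ne (IsLocalRing.le_maximalIdeal hP.ne_top) hne)
  have h2 : (IsLocalRing.maximalIdeal R).height ≤ (n + 1 : ℕ) := by
    have := (IsLocalRing.maximalIdeal_height_eq_ringKrullDim (R := R)).le.trans hdim
    exact_mod_cast this
  have h3 := h1.trans h2
  push_cast at h3
  exact (ENat.add_le_add_iff_right (by simp)).1 h3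

/-- Over a local ring of dimension at most `n + 2`, the tail of a unimodular row over the polynomial
ring of length `n + 3` may be made comaximal with a given constant outside the minimal primes. -/
theorem exists_span_tail_sup_eq_top {R : Type*} [CommRing R] [IsNoetherianRing R] [IsLocalRing R]
    {n : ℕ} (hdim : ringKrullDim R ≤ (n + 2 : ℕ)) {x : R} (hx : ∀ P ∈ minimalPrimes R, x ∉ P)
    {ι : Type*} [DecidableEq ι] (s : Finset ι) (hs : s.card = n + 2) (q : R[X]) (t : ι → R[X])
    (ht : Ideal.span {q} ⊔ Ideal.span (t '' s) = ⊤) :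
    ∃ l : ι → R[X],
      Ideal.span ((fun i => t i + q * l i) '' s) ⊔ Ideal.span {C x} = ⊤ := by
  classical
  set M := (IsLocalRing.maximalIdeal R).map (C : R →+* R[X])
  have hMp : M.IsPrime := Ideal.isPrime_map_C_of_isPrime
  have hMh : M.height = (IsLocalRing.maximalIdeal R).height := height_map_C _
  obtain ⟨l, hl⟩ := exists_forall_height_le {Ideal.span {C x}, M}
    (fun b => if b = M then M.height else 1) (by
      intro b hb Q hQ hbQ
      simp only [Finset.mem_insert, Finset.mem_singleton] at hb
      split_ifs with h
      · subst h; exact Ideal.height_mono hbQ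
      · rw [hb.resolve_right h, Ideal.span_singleton_le_iff_mem] at hbQ
        rw [Order.one_le_iff_ne_zero]
        intro h0
        rw [Ideal.height_eq_zero_iff] at h0
        exact hx _ (mem_minimalPrimes_of_comap_C h0) hbQ) q t s
  refine ⟨l, ?_⟩
  by_contra hne
  obtain ⟨Q, hQ, hle⟩ := Ideal.exists_le_maximal _ hne
  have htQ : ∀ i ∈ s, t i + q * l i ∈ Q := fun i hi =>
    hle (Ideal.mem_sup_left (Ideal.subset_span ⟨i, hi, rfl⟩))
  have hqQ : q ∉ Q := by
    intro hq
    refine hQ.ne_top (top_le_iff.1 (ht ▸ sup_le ?_ ?_))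
    · rwa [Ideal.span_singleton_le_iff_mem]
    · rw [Ideal.span_le]
      rintro _ ⟨i, hi, rfl⟩
      exact (Submodule.add_mem_iff_left _ (Ideal.mul_mem_right _ _ hq)).1 (htQ i hi)
  set P := Q.comap (C : R →+* R[X])
  have hPp : P.IsPrime := inferInstance
  have hQP : Q.LiesOver P := ⟨rfl⟩
  have hQh : Q.height = P.height + 1 := height_eq_height_add_one P Q
  by_cases hPm : P = IsLocalRing.maximalIdeal R
  · have h1 := hl M (by simp) Q hQ.isPrime
      (Ideal.map_le_iff_le_comap.2 hPm.ge) htQ hqQ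
    rw [if_pos rfl, hs, hMh, hQh, hPm] at h1
    have h2 : (IsLocalRing.maximalIdeal R).height ≠ ⊤ := by
      have := (IsLocalRing.maximalIdeal_height_eq_ringKrullDim (R := R)).le.trans hdim
      have : (IsLocalRing.maximalIdeal R).height ≤ ((n + 2 : ℕ) : ℕ∞) := WithBot.coe_le_coe.1 this
      exact ne_top_of_le_ne_top (ENat.natCast_ne_top _) this
    rw [ENat.add_le_add_iff_left h2] at h1
    norm_cast at h1
  · have h1 := hl (Ideal.span {C x}) (by simp) Q hQ.isPrime (le_sup_right.trans hle) htQ hqQ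
    have h2 : P.height ≤ (n + 1 : ℕ) := height_le_of_ne_maximalIdeal hdim hPp hPm
    have h3 : Ideal.span {C x} ≠ M := by
      intro h
      refine hPm (le_antisymm (IsLocalRing.le_maximalIdeal hPp.ne_top) ?_)
      rw [← Ideal.map_le_iff_le_comap]
      exact h.symm.le.trans (le_sup_right.trans hle)
    rw [if_neg h3, hs, hQh] at h1
    have h4 := h1.trans (add_le_add_left h2 1)
    norm_cast at h4
    omega

end Avoidance

/-! ### Pseudo-division and vanishing modulo primes -/

section Vanishing

variable {R : Type*} [CommRing R]

theorem exists_pseudo_div {x : R} {f : R[X]} {K : ℕ} (hf : f.leadingCoeff ∣ x ^ K)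
    (hpos : 0 < f.natDegree) (g : R[X]) :
    ∃ (N : ℕ) (h r : R[X]), C (x ^ N) * g = f * h + r ∧ r.natDegree < f.natDegree := by
  obtain ⟨c, hc⟩ := hf
  induction hn : g.natDegree using Nat.strong_induction_on generalizing g with
  | _ n ih =>
    by_cases hlt : g.natDegree < f.natDegree
    · exact ⟨0, 0, g, by simp, hlt⟩
    rw [not_lt] at hlt
    set g' := C (x ^ K) * g - C (c * g.leadingCoeff) * X ^ (g.natDegree - f.natDegree) * f with hg'
    have hdeg : g'.natDegree < n := by
      rw [← hn]
      have h1 : g'.natDegree ≤ g.natDegree := by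
        refine (natDegree_sub_le _ _).trans (max_le (natDegree_C_mul_le _ _) ?_)
        refine natDegree_mul_le.trans ?_
        refine (Nat.add_le_add_right (natDegree_C_mul_X_pow_le _ _) _).trans ?_
        omega
      refine lt_of_le_of_ne h1 fun he => ?_
      have h0 : g'.coeff g.natDegree = 0 := by
        rw [hg', coeff_sub, coeff_C_mul, mul_assoc, coeff_C_mul, coeff_X_pow_mul',
          if_pos (Nat.sub_le _ _), Nat.sub_sub_self hlt, hc]
        simp only [leadingCoeff]
        ring
      rw [← he, coeff_natDegree, leadingCoeff_eq_zero] at h0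
      rw [h0, natDegree_zero] at he
      omega
    obtain ⟨N, h, r, hr, hrd⟩ := ih _ hdeg g' rfl
    refine ⟨N + K, h + C (x ^ N) * (C (c * g.leadingCoeff) * X ^ (g.natDegree - f.natDegree)), r,
      ?_, hrd⟩
    rw [pow_add, C_mul]
    linear_combination hr + C (x ^ N) * hg'

/-- The polynomials which, after inverting `x`, are divisible by `f` modulo `P`. -/
def vanishIdeal (x : R) (f : R[X]) (P : Ideal R) : Ideal R[X] where
  carrier := {g | ∃ N, C (x ^ N) * g ∈ Ideal.span {f} ⊔ P.map C}
  zero_mem' := ⟨0, by simp⟩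
  add_mem' := by
    rintro a b ⟨M, hM⟩ ⟨N, hN⟩
    refine ⟨M + N, ?_⟩
    have := add_mem (Ideal.mul_mem_left _ (C (x ^ N)) hM) (Ideal.mul_mem_left _ (C (x ^ M)) hN)
    convert this using 1
    rw [pow_add, C_mul]; ring
  smul_mem' := by
    rintro c a ⟨N, hN⟩
    refine ⟨N, ?_⟩
    rw [smul_eq_mul, mul_left_comm]
    exact Ideal.mul_mem_left _ _ hN

theorem self_mem_vanishIdeal (x : R) (f : R[X]) (P : Ideal R) : f ∈ vanishIdeal x f P :=
  ⟨0, by simpa using Ideal.mem_sup_left (Ideal.mem_span_singleton_self f)⟩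

theorem map_le_vanishIdeal (x : R) (f : R[X]) (P : Ideal R) : P.map C ≤ vanishIdeal x f P :=
  fun g hg => ⟨0, by simpa using Ideal.mem_sup_right hg⟩

theorem map_eq_zero_iff_mem_map_C {P : Ideal R} {g : R[X]} :
    g.map (Ideal.Quotient.mk P) = 0 ↔ g ∈ P.map C := by
  rw [Ideal.mem_map_C_iff, Polynomial.ext_iff]
  simp [Ideal.Quotient.eq_zero_iff_mem]

section

variable {x : R} {f : R[X]} {K : ℕ} {P : Ideal R}

theorem natDegree_map_mk (hf : f.leadingCoeff ∣ x ^ K) (hP : P.IsPrime) (hx : x ∉ P) :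
    (f.map (Ideal.Quotient.mk P)).natDegree = f.natDegree := by
  refine natDegree_map_of_leadingCoeff_ne_zero _ fun h => ?_
  rw [Ideal.Quotient.eq_zero_iff_mem] at h
  obtain ⟨c, hc⟩ := hf
  exact hx (hP.mem_of_pow_mem K (hc ▸ Ideal.mul_mem_right c P h))

theorem map_mk_eq_zero_of_eq_mul (hf : f.leadingCoeff ∣ x ^ K) (hP : P.IsPrime) (hx : x ∉ P)
    {r h : (R ⧸ P)[X]} (hr : r.natDegree < f.natDegree)
    (he : r = f.map (Ideal.Quotient.mk P) * h) : h = 0 := by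
  by_contra hh
  have := natDegree_map_mk hf hP hx
  rw [he, natDegree_mul (fun h0 => by rw [h0, natDegree_zero] at this; omega) hh] at hr
  omega

theorem mem_map_of_mem_vanishIdeal (hf : f.leadingCoeff ∣ x ^ K) (hP : P.IsPrime) (hx : x ∉ P)
    {r : R[X]} (hr : r.natDegree < f.natDegree) (hv : r ∈ vanishIdeal x f P) : r ∈ P.map C := by
  obtain ⟨N, hN⟩ := hv
  obtain ⟨g, hg, s, hs, hgs⟩ := Submodule.mem_sup.1 hN
  obtain ⟨h, rfl⟩ := Ideal.mem_span_singleton.1 hg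
  rw [← map_eq_zero_iff_mem_map_C] at hs ⊢
  have h1 := congrArg (Polynomial.map (Ideal.Quotient.mk P)) hgs
  rw [Polynomial.map_add, hs, add_zero, Polynomial.map_mul, Polynomial.map_mul, map_C] at h1
  have h2 := map_mk_eq_zero_of_eq_mul hf hP hx (r := C (Ideal.Quotient.mk P (x ^ N)) *
    r.map (Ideal.Quotient.mk P)) (((natDegree_C_mul_le _ _).trans natDegree_map_le).trans_lt hr)
    h1.symm
  rw [h2, mul_zero, eq_comm, mul_eq_zero, C_eq_zero, Ideal.Quotient.eq_zero_iff_mem] at h1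
  exact h1.resolve_left fun h => hx (hP.mem_of_pow_mem _ h)

theorem mem_vanishIdeal_iff_of_eq {N : ℕ} {g h r : R[X]} (he : C (x ^ N) * g = f * h + r) :
    g ∈ vanishIdeal x f P ↔ r ∈ vanishIdeal x f P := by
  have hf' := Ideal.mul_mem_right h _ (self_mem_vanishIdeal x f P)
  have key : r ∈ vanishIdeal x f P ↔ f * h + r ∈ vanishIdeal x f P :=
    (Submodule.add_mem_iff_right _ hf').symm
  rw [key, ← he]
  refine ⟨fun hg => Ideal.mul_mem_left _ _ hg, ?_⟩
  rintro ⟨M, hM⟩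
  exact ⟨M + N, by rwa [pow_add, C_mul, mul_assoc]⟩

theorem mem_vanishIdeal_iff (hf : f.leadingCoeff ∣ x ^ K) (hP : P.IsPrime) (hx : x ∉ P)
    {N : ℕ} {g h r : R[X]} (he : C (x ^ N) * g = f * h + r) (hr : r.natDegree < f.natDegree) :
    g ∈ vanishIdeal x f P ↔ ∀ i, r.coeff i ∈ P := by
  rw [mem_vanishIdeal_iff_of_eq he, ← Ideal.mem_map_C_iff]
  exact ⟨mem_map_of_mem_vanishIdeal hf hP hx hr, fun h => map_le_vanishIdeal _ _ _ h⟩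

theorem mem_vanishIdeal_of_C_mul_mem (hf : f.leadingCoeff ∣ x ^ K) (hpos : 0 < f.natDegree)
    (hP : P.IsPrime) (hx : x ∉ P) {e : R} (he : e ∉ P) {g : R[X]}
    (h : C e * g ∈ vanishIdeal x f P) : g ∈ vanishIdeal x f P := by
  obtain ⟨N, k, r, hr, hrd⟩ := exists_pseudo_div hf hpos g
  rw [mem_vanishIdeal_iff hf hP hx hr hrd]
  rw [mem_vanishIdeal_iff hf hP hx (N := N) (h := C e * k) (r := C e * r)
    (by linear_combination C e * hr) ((natDegree_C_mul_le _ _).trans_lt hrd)] at h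
  intro i
  have := h i
  rw [coeff_C_mul] at this
  exact (hP.mem_or_mem this).resolve_left he

theorem one_notMem_vanishIdeal (hf : f.leadingCoeff ∣ x ^ K) (hpos : 0 < f.natDegree)
    (hP : P.IsPrime) (hx : x ∉ P) : (1 : R[X]) ∉ vanishIdeal x f P := by
  rw [mem_vanishIdeal_iff hf hP hx (N := 0) (h := 0) (r := 1) (by simp) (by simpa using hpos)]
  intro h
  exact hP.ne_top ((Ideal.eq_top_iff_one _).2 (by simpa using h 0))

/-- The polynomials proportional to `p` modulo `vanishIdeal x f P`. -/
def vanishLine (x : R) (f p : R[X]) (P : Ideal R) : Submodule R R[X] where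
  carrier := {z | ∃ s ∈ Submonoid.closure (Pᶜ : Set R), ∃ c : R,
    C s * z - C c * p ∈ vanishIdeal x f P}
  zero_mem' := ⟨1, one_mem _, 0, by simp⟩
  add_mem' := by
    rintro a b ⟨s, hs, c, h⟩ ⟨s', hs', c', h'⟩
    refine ⟨s * s', mul_mem hs hs', s' * c + s * c', ?_⟩
    have := add_mem (Ideal.mul_mem_left _ (C s') h) (Ideal.mul_mem_left _ (C s) h')
    convert this using 1
    simp only [C_mul, C_add]; ring
  smul_mem' := by
    rintro e a ⟨s, hs, c, h⟩
    refine ⟨s, hs, e * c, ?_⟩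
    convert Ideal.mul_mem_left _ (C e) h using 1
    rw [smul_eq_C_mul, C_mul]; ring

theorem mem_vanishLine (hP : P.IsPrime) {p z : R[X]} :
    z ∈ vanishLine x f p P ↔ ∃ s ∉ P, ∃ c : R, C s * z - C c * p ∈ vanishIdeal x f P := by
  change (∃ s ∈ Submonoid.closure ((P.primeCompl : Submonoid R) : Set R), _) ↔ _
  rw [Submonoid.closure_eq]
  rfl

theorem vanishIdeal_le_vanishLine (hP : P.IsPrime) {p z : R[X]} (h : z ∈ vanishIdeal x f P) :
    z ∈ vanishLine x f p P :=
  (mem_vanishLine hP).2 ⟨1, fun h1 => hP.ne_top ((Ideal.eq_top_iff_one _).2 h1), 0, by simpa⟩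

end

end Vanishing

section Content

variable {R : Type*} [CommRing R] {x : R} {f : R[X]} {K : ℕ}

theorem vanishIdeal_mono {P Q : Ideal R} (h : P ≤ Q) : vanishIdeal x f P ≤ vanishIdeal x f Q :=
  fun _ ⟨N, hN⟩ => ⟨N, sup_le_sup_left (α := Ideal R[X]) (Ideal.map_mono h) (Ideal.span {f}) hN⟩

theorem exists_le_iff_mem_vanishIdeal (hf : f.leadingCoeff ∣ x ^ K) (hpos : 0 < f.natDegree)
    (g : R[X]) :
    ∃ c : Ideal R, ∀ P : Ideal R, P.IsPrime → x ∉ P → (c ≤ P ↔ g ∈ vanishIdeal x f P) := by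
  obtain ⟨N, h, r, hr, hd⟩ := exists_pseudo_div hf hpos g
  refine ⟨Ideal.span (Set.range r.coeff), fun P hP hx => ?_⟩
  rw [mem_vanishIdeal_iff hf hP hx hr hd, Ideal.span_le, Set.range_subset_iff]
  rfl

/-- The ideal of minors of the remainders of two polynomials. -/
theorem exists_minor_ideal (hf : f.leadingCoeff ∣ x ^ K) (hpos : 0 < f.natDegree) (p z : R[X]) :
    ∃ n : Ideal R, ∀ P : Ideal R, P.IsPrime → x ∉ P →
      (n ≤ P → p ∉ vanishIdeal x f P → z ∈ vanishLine x f p P) ∧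
      (∀ g : R, p + C g * z ∈ vanishIdeal x f P → n ≤ P) := by
  obtain ⟨N, h, r, hr, hd⟩ := exists_pseudo_div hf hpos p
  obtain ⟨N', h', r', hr', hd'⟩ := exists_pseudo_div hf hpos z
  refine ⟨Ideal.span {e | ∃ i j, e = r.coeff i * r'.coeff j - r.coeff j * r'.coeff i},
    fun P hP hx => ⟨fun hle hp => ?_, fun g hg => ?_⟩⟩
  · rw [mem_vanishIdeal_iff hf hP hx hr hd] at hp
    push Not at hp
    obtain ⟨j, hj⟩ := hp
    refine (mem_vanishLine hP).2 ⟨r.coeff j * x ^ N', fun hmem => ?_, r'.coeff j * x ^ N, ?_⟩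
    · exact (hP.mem_or_mem hmem).elim hj fun h => hx (hP.mem_of_pow_mem _ h)
    · rw [mem_vanishIdeal_iff_of_eq (N := 0) (h := C (r.coeff j) * h' - C (r'.coeff j) * h)
        (r := C (r.coeff j) * r' - C (r'.coeff j) * r)
        (by simp only [C_mul, pow_zero, C_1]
            linear_combination C (r.coeff j) * hr' - C (r'.coeff j) * hr)]
      refine map_le_vanishIdeal _ _ _ (Ideal.mem_map_C_iff.2 fun i => ?_)
      refine hle (Ideal.subset_span ⟨j, i, ?_⟩)
      rw [coeff_sub, coeff_C_mul, coeff_C_mul]; ring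
  · rw [mem_vanishIdeal_iff hf hP hx (N := N + N') (h := C (x ^ N') * h + C (g * x ^ N) * h')
      (r := C (x ^ N') * r + C (g * x ^ N) * r')
      (by simp only [C_mul, pow_add]
          linear_combination C (x ^ N') * hr + C g * C (x ^ N) * hr')
      ((natDegree_add_le _ _).trans_lt (max_lt ((natDegree_C_mul_le _ _).trans_lt hd)
        ((natDegree_C_mul_le _ _).trans_lt hd')))] at hg
    rw [Ideal.span_le]
    rintro _ ⟨i, j, rfl⟩
    have hi := hg i
    have hj := hg j
    simp only [coeff_add, coeff_C_mul] at hi hj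
    refine (hP.mem_or_mem (x := x ^ N') ?_).resolve_left fun h => hx (hP.mem_of_pow_mem _ h)
    have := sub_mem (P.mul_mem_right (r'.coeff j) hi) (P.mul_mem_right (r'.coeff i) hj)
    convert this using 1
    ring

theorem exists_card_le_height [IsNoetherianRing R] (hf : f.leadingCoeff ∣ x ^ K)
    (hpos : 0 < f.natDegree) (ω : R[X]) {ι : Type*} [DecidableEq ι] (t : ι → R[X])
    (s : Finset ι) :
    ∃ y : ι → R[X], ∀ P : Ideal R, P.IsPrime → x ∉ P → ω ∉ vanishIdeal x f P →
      (∀ i ∈ s, t i + ω * y i ∈ vanishIdeal x f P) → (s.card : ℕ∞) ≤ P.height := by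
  classical
  choose c hc using exists_le_iff_mem_vanishIdeal hf hpos
  induction s using Finset.induction_on with
  | empty => exact ⟨0, by simp⟩
  | insert i s his ih =>
    obtain ⟨y, hy⟩ := ih
    set 𝔵 : Ideal R := ⨆ i ∈ s, c (t i + ω * y i)
    have hfin : 𝔵.minimalPrimes.Finite := Ideal.finite_minimalPrimes_of_isNoetherianRing R _
    obtain ⟨z, hz⟩ := exists_add_map_notMem
      (hfin.toFinset.filter fun P => x ∉ P ∧ ω ∉ vanishIdeal x f P)
      (fun P hP => ((hfin.mem_toFinset.1 (Finset.mem_filter.1 hP).1)).1.1)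
      ((LinearMap.mulLeft R[X] ω).restrictScalars R) (t i)
      (fun P => (vanishIdeal x f P).restrictScalars R)
      (fun P hP e he z hz => by
        have hPp := ((hfin.mem_toFinset.1 (Finset.mem_filter.1 hP).1)).1.1
        refine mem_vanishIdeal_of_C_mul_mem hf hpos hPp (Finset.mem_filter.1 hP).2.1 he ?_
        rwa [← smul_eq_C_mul])
      (fun P hP e he z => by
        rw [smul_eq_C_mul]
        exact map_le_vanishIdeal _ _ _ (Ideal.mul_mem_right _ _ (Ideal.mem_map_of_mem _ he)))
      (fun P hP => ⟨1, by simpa using (Finset.mem_filter.1 hP).2.2⟩)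
    refine ⟨Function.update y i z, fun P hP hx hω hv => ?_⟩
    have hv' : ∀ j ∈ s, t j + ω * y j ∈ vanishIdeal x f P := fun j hj => by
      have := hv j (Finset.mem_insert_of_mem hj)
      rwa [Function.update_of_ne (by rintro rfl; exact his hj)] at this
    have hle : 𝔵 ≤ P := iSup₂_le fun j hj => (hc _ P hP hx).2 (hv' j hj)
    obtain ⟨Q, hQ, hQP⟩ := Ideal.exists_minimalPrimes_le hle
    have hQp : Q.IsPrime := hQ.1.1
    have hxQ : x ∉ Q := fun h => hx (hQP h)
    have hωQ : ω ∉ vanishIdeal x f Q := fun h => hω (vanishIdeal_mono hQP h)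
    have hne : Q ≠ P := by
      rintro rfl
      refine hz Q (Finset.mem_filter.2 ⟨hfin.mem_toFinset.2 hQ, hxQ, hωQ⟩) ?_
      simpa using hv i (Finset.mem_insert_self _ _)
    have := hy Q hQp hxQ hωQ fun j hj => (hc _ Q hQp hxQ).1 ((le_iSup₂ j hj).trans hQ.1.2)
    rw [Finset.card_insert_of_notMem his, Nat.cast_add, Nat.cast_one]
    exact (add_le_add_left this 1).trans
      (Ideal.height_add_one_le_of_lt_of_isPrime (lt_of_le_of_ne hQP hne))

theorem exists_mul_notMem_vanishLine (hf : f.leadingCoeff ∣ x ^ K) (hdeg : 1 < f.natDegree)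
    {P : Ideal R} (hP : P.IsPrime) (hx : x ∉ P) {p ω : R[X]} (hω : ω ∉ vanishIdeal x f P)
    (hone : p ∈ vanishIdeal x f P ∨ Ideal.span {p} ⊔ Ideal.span {ω} ⊔ vanishIdeal x f P = ⊤) :
    ∃ z, ω * z ∉ vanishLine x f p P := by
  have hpos : 0 < f.natDegree := by omega
  by_contra! H
  obtain ⟨s, hs, c, h1⟩ := (mem_vanishLine hP).1 (H 1)
  obtain ⟨s', hs', c', h2⟩ := (mem_vanishLine hP).1 (H X)
  rw [mul_one] at h1
  have hmem : ∀ {e g}, C e * g ∈ vanishIdeal x f P → e ∈ P ∨ g ∈ vanishIdeal x f P :=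
    fun {e g} h => or_iff_not_imp_left.2 fun he => mem_vanishIdeal_of_C_mul_mem hf hpos hP hx he h
  have hC : ∀ {e} g, e ∈ P → C e * g ∈ vanishIdeal x f P := fun g he =>
    map_le_vanishIdeal _ _ _ (Ideal.mul_mem_right _ _ (Ideal.mem_map_of_mem _ he))
  have hcp : C c * p ∉ vanishIdeal x f P := fun h =>
    (hmem ((Submodule.sub_mem_iff_left _ h).1 h1)).elim hs hω
  have hc : c ∉ P := fun h => hcp (hC _ h)
  have hone' := hone.resolve_left fun h => hcp (Ideal.mul_mem_left _ _ h)
  obtain ⟨g, hg, v, hv, hgv⟩ := Submodule.mem_sup.1 ((Ideal.eq_top_iff_one _).1 hone')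
  obtain ⟨a, b, rfl⟩ := Ideal.mem_span_pair.1 (by rwa [← Ideal.span_insert] at hg)
  have h3 : C c * (C (c * s') * X - C (c' * s)) ∈ vanishIdeal x f P := by
    have h4 : ω * (C (c * s') * X - C (c' * s)) ∈ vanishIdeal x f P := by
      convert sub_mem (Ideal.mul_mem_left _ (C c) h2) (Ideal.mul_mem_left _ (C c') h1) using 1
      simp only [C_mul]; ring
    have h5 := add_mem (Ideal.mul_mem_left _ (a * C s + C c * b) h4) (sub_mem
      (Ideal.mul_mem_left _ (C c * (C (c * s') * X - C (c' * s))) hv)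
      (Ideal.mul_mem_left _ (a * (C (c * s') * X - C (c' * s))) h1))
    convert h5 using 1
    linear_combination (-(C c * (C (c * s') * X - C (c' * s)))) * hgv
  have h6 := ((hmem h3).resolve_left hc)
  rw [mem_vanishIdeal_iff hf hP hx (N := 0) (h := 0) (r := C (c * s') * X - C (c' * s))
    (by simp) ?_] at h6
  · have := h6 1
    simp only [coeff_sub, coeff_C_mul, coeff_X_one, mul_one, coeff_C_succ, sub_zero] at this
    exact (hP.mem_or_mem this).elim hc hs'
  · refine lt_of_le_of_lt ?_ hdeg
    refine (natDegree_sub_le _ _).trans (max_le ((natDegree_C_mul_le _ _).trans natDegree_X_le) ?_)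
    rw [natDegree_C]
    exact zero_le_one

/-- Over a local ring of dimension at most `m + 2`, a general combination of the entries of a
unimodular row of length `m + 3` vanishes modulo `f` at no prime avoiding `x`. -/
theorem exists_not_forall_mem_vanishIdeal [IsNoetherianRing R] [IsLocalRing R]
    (hf : f.leadingCoeff ∣ x ^ K) (hdeg : 1 < f.natDegree)
    {ι : Type*} [DecidableEq ι] (s : Finset ι) (hdim : ringKrullDim R ≤ (s.card + 2 : ℕ))
    (hxm : x ∈ IsLocalRing.maximalIdeal R) (q ω : R[X]) (t : ι → R[X])
    (hone : Ideal.span {q} ⊔ Ideal.span {ω} ⊔ (Ideal.span {f} ⊔ Ideal.span (t '' s)) = ⊤) :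
    ∃ (y₀ : R[X]) (y : ι → R[X]), ∀ P : Ideal R, P.IsPrime → x ∉ P →
      ¬ (q + ω * y₀ ∈ vanishIdeal x f P ∧ ∀ i ∈ s, t i + ω * y i ∈ vanishIdeal x f P) := by
  classical
  have hpos : 0 < f.natDegree := by omega
  choose c hc using exists_le_iff_mem_vanishIdeal hf hpos
  obtain ⟨y, hy⟩ := exists_card_le_height hf hpos ω t s
  set 𝔵 : Ideal R := ⨆ i ∈ s, c (t i + ω * y i)
  have h𝔵 : ∀ P : Ideal R, P.IsPrime → x ∉ P →
      (𝔵 ≤ P ↔ ∀ i ∈ s, t i + ω * y i ∈ vanishIdeal x f P) := fun P hP hx => by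
    rw [iSup₂_le_iff]
    exact forall₂_congr fun i _ => hc _ P hP hx
  have hfin : ∀ J : Ideal R, J.minimalPrimes.Finite := fun J =>
    Ideal.finite_minimalPrimes_of_isNoetherianRing R _
  let T : Ideal R → Finset (Ideal R) := fun J =>
    (hfin J).toFinset.filter fun P => x ∉ P ∧ ω ∉ vanishIdeal x f P
  have hT : ∀ {J P}, P ∈ T J ↔ P ∈ J.minimalPrimes ∧ x ∉ P ∧ ω ∉ vanishIdeal x f P := by
    intro J P; simp [T]
  have hTle : ∀ {J P : Ideal R}, J ≤ P → P.IsPrime → x ∉ P → ω ∉ vanishIdeal x f P →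
      ∃ Q ∈ T J, Q ≤ P := fun {J P} hJ hP hx hω => by
    obtain ⟨Q, hQ, hQP⟩ := Ideal.exists_minimalPrimes_le hJ
    exact ⟨Q, hT.2 ⟨hQ, fun h => hx (hQP h), fun h => hω (vanishIdeal_mono hQP h)⟩, hQP⟩
  -- the avoidance data common to both choices
  have hK₁ : ∀ P : Ideal R, P.IsPrime → x ∉ P → ∀ e ∉ P, ∀ z, e • z ∈ vanishIdeal x f P →
      z ∈ vanishIdeal x f P := fun P hP hx e he z hz =>
    mem_vanishIdeal_of_C_mul_mem hf hpos hP hx he (by rwa [← smul_eq_C_mul])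
  have hK₂ : ∀ P : Ideal R, ∀ e ∈ P, ∀ z, e • z ∈ vanishIdeal x f P := fun P e he z => by
    rw [smul_eq_C_mul]
    exact map_le_vanishIdeal _ _ _ (Ideal.mul_mem_right _ _ (Ideal.mem_map_of_mem _ he))
  obtain ⟨y₁, hy₁⟩ := exists_add_map_notMem (T 𝔵) (fun P hP => (hT.1 hP).1.1.1)
    ((LinearMap.mulLeft R[X] ω).restrictScalars R) q
    (fun P => (vanishIdeal x f P).restrictScalars R)
    (fun P hP => hK₁ P (hT.1 hP).1.1.1 (hT.1 hP).2.1) (fun P _ => hK₂ P)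
    (fun P hP => ⟨1, by simpa using (hT.1 hP).2.2⟩)
  set q₁ := q + ω * y₁ with hq₁
  have hy₁' : ∀ P ∈ T 𝔵, q₁ ∉ vanishIdeal x f P := hy₁
  have hmod : ∀ P : Ideal R, P.IsPrime → x ∉ P → 𝔵 ≤ P →
      Ideal.span {q₁} ⊔ Ideal.span {ω} ⊔ vanishIdeal x f P = ⊤ := by
    intro P hP hx hle
    rw [eq_top_iff, ← hone]
    have hωmem : ω ∈ Ideal.span {q₁} ⊔ Ideal.span {ω} ⊔ vanishIdeal x f P :=
      Ideal.mem_sup_left (Ideal.mem_sup_right (Ideal.mem_span_singleton_self _))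
    have hqmem : q₁ ∈ Ideal.span {q₁} ⊔ Ideal.span {ω} ⊔ vanishIdeal x f P :=
      Ideal.mem_sup_left (Ideal.mem_sup_left (Ideal.mem_span_singleton_self _))
    refine sup_le (sup_le ?_ ?_) (sup_le ?_ ?_) <;> rw [Ideal.span_le]
    · rw [Set.singleton_subset_iff]
      exact (Submodule.add_mem_iff_left _ (Ideal.mul_mem_right y₁ _ hωmem)).1 hqmem
    · rwa [Set.singleton_subset_iff]
    · rw [Set.singleton_subset_iff]
      exact Ideal.mem_sup_right (self_mem_vanishIdeal _ _ _)
    · rintro _ ⟨i, hi, rfl⟩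
      exact (Submodule.add_mem_iff_left _ (Ideal.mul_mem_right (y i) _ hωmem)).1
        (Ideal.mem_sup_right ((h𝔵 P hP hx).1 hle i hi))
  set T₁ := T (𝔵 ⊔ c q₁)
  obtain ⟨y₂, hy₂⟩ := exists_add_map_notMem (T 𝔵 ∪ T₁)
    (fun P hP => (Finset.mem_union.1 hP).elim (fun h => (hT.1 h).1.1.1) fun h => (hT.1 h).1.1.1)
    ((LinearMap.mulLeft R[X] ω).restrictScalars R) 0 (fun P => vanishLine x f q₁ P)
    (fun P hP e he z hz => by
      have hPp : P.IsPrime :=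
        (Finset.mem_union.1 hP).elim (fun h => (hT.1 h).1.1.1) fun h => (hT.1 h).1.1.1
      obtain ⟨s, hs, c, h⟩ := (mem_vanishLine hPp).1 hz
      refine (mem_vanishLine hPp).2 ⟨s * e, fun h => (hPp.mem_or_mem h).elim hs he, c, ?_⟩
      rwa [C_mul, mul_assoc, ← smul_eq_C_mul (a := e)])
    (fun P hP e he z => by
      have hPp : P.IsPrime :=
        (Finset.mem_union.1 hP).elim (fun h => (hT.1 h).1.1.1) fun h => (hT.1 h).1.1.1
      exact vanishIdeal_le_vanishLine hPp (hK₂ P e he z))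
    (fun P hP => by
      rcases Finset.mem_union.1 hP with h | h
      · exact exists_mul_notMem_vanishLine hf hdeg (hT.1 h).1.1.1 (hT.1 h).2.1 (hT.1 h).2.2
          (Or.inr (hmod P (hT.1 h).1.1.1 (hT.1 h).2.1 (hT.1 h).1.1.2))
      · exact exists_mul_notMem_vanishLine hf hdeg (hT.1 h).1.1.1 (hT.1 h).2.1 (hT.1 h).2.2
          (Or.inl ((hc _ P (hT.1 h).1.1.1 (hT.1 h).2.1).1 (le_sup_right.trans (hT.1 h).1.1.2))))
  have hy₂' : ∀ P ∈ T 𝔵 ∪ T₁, ω * y₂ ∉ vanishLine x f q₁ P := fun P hP => by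
    simpa using hy₂ P hP
  obtain ⟨𝔫, h𝔫⟩ := exists_minor_ideal hf hpos q₁ (ω * y₂)
  set T₂ := T (𝔵 ⊔ 𝔫)
  have hht : ∀ J : Ideal R, (∀ P ∈ T 𝔵, ¬ J ≤ P) → ∀ P ∈ T (𝔵 ⊔ J),
      (s.card : ℕ∞) + 1 ≤ P.height := by
    intro J hJ P hP
    have hPp : P.IsPrime := (hT.1 hP).1.1.1
    obtain ⟨Q, hQ, hQP⟩ := hTle (le_sup_left.trans (hT.1 hP).1.1.2) hPp (hT.1 hP).2.1 (hT.1 hP).2.2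
    have hQp : Q.IsPrime := (hT.1 hQ).1.1.1
    have hne : Q ≠ P := by
      rintro rfl
      exact hJ Q hQ (le_sup_right.trans (hT.1 hP).1.1.2)
    exact (add_le_add_left (hy Q hQp (hT.1 hQ).2.1 (hT.1 hQ).2.2
      ((h𝔵 Q hQp (hT.1 hQ).2.1).1 (hT.1 hQ).1.1.2)) 1).trans
      (Ideal.height_add_one_le_of_lt_of_isPrime (lt_of_le_of_ne hQP hne))
  have hT₁ : ∀ P ∈ T₁, (s.card : ℕ∞) + 1 ≤ P.height := hht _ fun P hP h =>
    hy₁' P hP ((hc _ P (hT.1 hP).1.1.1 (hT.1 hP).2.1).1 h)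
  have hT₂ : ∀ P ∈ T₂, (s.card : ℕ∞) + 1 ≤ P.height := hht _ fun P hP h =>
    hy₂' P (Finset.mem_union_left _ hP)
      ((h𝔫 P (hT.1 hP).1.1.1 (hT.1 hP).2.1).1 h (hy₁' P hP))
  have heq : ∀ {P Q : Ideal R}, P.IsPrime → Q.IsPrime → x ∉ P → (s.card : ℕ∞) + 1 ≤ Q.height →
      Q ≤ P → Q = P := by
    intro P Q hP hQ hx hh hle
    by_contra hne
    have h1 := Ideal.height_add_one_le_of_lt_of_isPrime (lt_of_le_of_ne hle hne)
    have h2 : P.height ≤ (s.card + 1 : ℕ) :=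
      height_le_of_ne_maximalIdeal (by exact_mod_cast hdim) hP (by rintro rfl; exact hx hxm)
    have h3 := ((add_le_add_left hh 1).trans h1).trans h2
    norm_cast at h3
    omega
  obtain ⟨g, hg, hg₁⟩ : ∃ g ∈ (T₂ \ T₁).inf id, ∀ P ∈ T₁, g ∉ P := by
    by_contra! h
    have hsub : (((T₂ \ T₁).inf id : Ideal R) : Set R) ⊆ ⋃ P ∈ (T₁ : Set (Ideal R)), P := by
      intro x hx
      obtain ⟨P, hP, hxP⟩ := h x hx
      exact Set.mem_biUnion (by simpa using hP) hxP
    rw [Ideal.subset_union_prime (f := fun P => P) ⊤ ⊤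
      (fun P hP _ _ => (hT.1 hP).1.1.1)] at hsub
    obtain ⟨P, hP, hle⟩ := hsub
    have hPp : P.IsPrime := (hT.1 hP).1.1.1
    rw [hPp.inf_le'] at hle
    obtain ⟨Q, hQ, hQP⟩ := hle
    have hQ' := Finset.mem_sdiff.1 hQ
    have := heq hPp (hT.1 hQ'.1).1.1.1 (hT.1 hP).2.1 (hT₂ Q hQ'.1) hQP
    exact hQ'.2 (this ▸ hP)
  refine ⟨y₁ + C g * y₂, y, fun P hP hx ⟨hv₀, hv⟩ => ?_⟩
  have hsum : q + ω * (y₁ + C g * y₂) = q₁ + C g * (ω * y₂) := by rw [hq₁]; ring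
  have hω : ω ∉ vanishIdeal x f P := by
    intro hω
    refine one_notMem_vanishIdeal hf hpos hP hx ((Ideal.eq_top_iff_one _).1 ?_)
    rw [eq_top_iff, ← hone]
    refine sup_le (sup_le ?_ ?_) (sup_le ?_ ?_) <;> rw [Ideal.span_le]
    · rw [Set.singleton_subset_iff]
      exact (Submodule.add_mem_iff_left _ (Ideal.mul_mem_right _ _ hω)).1 hv₀
    · rwa [Set.singleton_subset_iff]
    · rw [Set.singleton_subset_iff]
      exact self_mem_vanishIdeal _ _ _
    · rintro _ ⟨i, hi, rfl⟩
      exact (Submodule.add_mem_iff_left _ (Ideal.mul_mem_right (y i) _ hω)).1 (hv i hi)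
  rw [hsum] at hv₀
  have h𝔵P : 𝔵 ≤ P := (h𝔵 P hP hx).2 hv
  obtain ⟨Q, hQ, hQP⟩ := hTle (sup_le h𝔵P ((h𝔫 P hP hx).2 g hv₀)) hP hx hω
  obtain rfl := heq hP (hT.1 hQ).1.1.1 hx (hT₂ Q hQ) hQP
  by_cases hQ₁ : Q ∈ T₁
  · have hq₁Q := (hc _ Q hP hx).1 (le_sup_right.trans (hT.1 hQ₁).1.1.2)
    have := (Submodule.add_mem_iff_right _ hq₁Q).1 hv₀
    exact hy₂' Q (Finset.mem_union_right _ hQ₁) (vanishIdeal_le_vanishLine hP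
      (mem_vanishIdeal_of_C_mul_mem hf hpos hP hx (hg₁ Q hQ₁) this))
  · have hgQ : g ∈ Q := Finset.inf_le (f := id) (Finset.mem_sdiff.2 ⟨hQ, hQ₁⟩) hg
    have h1 := hK₂ Q g hgQ (ω * y₂)
    rw [smul_eq_C_mul] at h1
    have hq₁Q := (Submodule.add_mem_iff_left _ h1).1 hv₀
    obtain ⟨Q', hQ', hle⟩ := hTle (sup_le h𝔵P ((hc _ Q hP hx).2 hq₁Q)) hP hx hω
    obtain rfl := heq hP (hT.1 hQ').1.1.1 hx (hT₁ Q' hQ') hle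
    exact hQ₁ hQ'

end Content

section Descent

variable {R : Type*} [CommRing R] {x : R}

theorem exists_mem_coeff_eq_pow {f : R[X]} {K : ℕ} (hf : f.leadingCoeff ∣ x ^ K)
    (hpos : 0 < f.natDegree) {H : Ideal R[X]} (hfH : f ∈ H)
    (hH : ∀ P : Ideal R, P.IsPrime → x ∉ P → ¬ H ≤ vanishIdeal x f P) :
    ∃ (n : ℕ) (h : R[X]), h ∈ H ∧ h.natDegree < f.natDegree ∧
      h.coeff (f.natDegree - 1) = x ^ n := by
  set L : Ideal R :=
    (H.restrictScalars R ⊓ degreeLT R f.natDegree).map (lcoeff R (f.natDegree - 1)) with hL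
  have hmemL : ∀ {r : R[X]}, r ∈ H → r.natDegree < f.natDegree →
      r.coeff (f.natDegree - 1) ∈ L := by
    intro r hr hd
    refine ⟨r, ⟨hr, ?_⟩, rfl⟩
    simp only [SetLike.mem_coe, mem_degreeLT]
    exact degree_le_natDegree.trans_lt (by exact_mod_cast hd)
  suffices hx : x ∈ L.radical by
    obtain ⟨n, h, ⟨hh, hd⟩, hc⟩ := hx
    refine ⟨n, h, hh, ?_, hc⟩
    simp only [SetLike.mem_coe, mem_degreeLT] at hd
    rcases eq_or_ne h 0 with rfl | hne
    · simpa using hpos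
    · exact (natDegree_lt_iff_degree_lt hne).2 hd
  rw [Ideal.radical_eq_sInf, Submodule.mem_sInf]
  rintro P ⟨hLP, hP⟩
  by_contra hx
  obtain ⟨g, hg, hgP⟩ := Set.not_subset.1 (hH P hP hx)
  obtain ⟨N, k, r, hr, hrd⟩ := exists_pseudo_div hf hpos g
  have hrem : ∀ {N g k r}, C (x ^ N) * g = f * k + r → g ∈ H → r ∈ H := by
    intro N g k r he hg
    have := sub_mem (H.mul_mem_left (C (x ^ N)) hg) (H.mul_mem_right k hfH)
    rwa [he, add_sub_cancel_left] at this
  have hrH := hrem hr hg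
  have hr0 : r.map (Ideal.Quotient.mk P) ≠ 0 := by
    intro h0
    refine hgP ((mem_vanishIdeal_iff hf hP hx hr hrd).2 fun i => ?_)
    exact Ideal.mem_map_C_iff.1 (map_eq_zero_iff_mem_map_C.1 h0) i
  set i := (r.map (Ideal.Quotient.mk P)).natDegree with hi
  have hid : i < f.natDegree := natDegree_map_le.trans_lt hrd
  obtain ⟨N', k', r', hr', hrd'⟩ := exists_pseudo_div hf hpos (X ^ (f.natDegree - 1 - i) * r)
  have hr'L := hLP (hmemL (hrem hr' (H.mul_mem_left _ hrH)) hrd')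
  have h1 := congrArg (Polynomial.map (Ideal.Quotient.mk P)) hr'
  simp only [Polynomial.map_mul, Polynomial.map_add, map_C, Polynomial.map_pow, map_X] at h1
  have h2 : k'.map (Ideal.Quotient.mk P) = 0 := by
    refine map_mk_eq_zero_of_eq_mul hf hP hx (r := C (Ideal.Quotient.mk P (x ^ N')) *
      (X ^ (f.natDegree - 1 - i) * r.map (Ideal.Quotient.mk P)) - r'.map (Ideal.Quotient.mk P))
      ?_ (by rw [h1]; ring)
    refine (natDegree_sub_le _ _).trans_lt (max_lt ?_ (natDegree_map_le.trans_lt hrd'))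
    refine (natDegree_C_mul_le _ _).trans_lt (natDegree_mul_le.trans_lt ?_)
    have := natDegree_X_pow_le (R := R ⧸ P) (f.natDegree - 1 - i)
    omega
  rw [h2, mul_zero, zero_add] at h1
  have h3 := congrArg (fun p => coeff p (f.natDegree - 1)) h1
  simp only [coeff_C_mul, coeff_map, coeff_X_pow_mul',
    if_pos (Nat.sub_le (f.natDegree - 1) i)] at h3
  rw [Nat.sub_sub_self (by omega), Ideal.Quotient.eq_zero_iff_mem.2 hr'L, ← map_mul,
    Ideal.Quotient.eq_zero_iff_mem] at h3
  rcases hP.mem_or_mem h3 with h | h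
  · exact hx (hP.mem_of_pow_mem _ h)
  · refine leadingCoeff_ne_zero.2 hr0 ?_
    rw [leadingCoeff, coeff_map, Ideal.Quotient.eq_zero_iff_mem]
    exact h

end Descent

namespace NiceRow

section

variable {A : Type*} [CommRing A] {m : ℕ} {a r : A} {v : Fin (m + 3) → A}

theorem of_span_eq_top
    (h : Ideal.span (Set.range v) = ⊤ → v 0 = a * r - 1 → NiceRow a r v) : NiceRow a r v :=
  fun h₁ h₂ => h h₁ h₂ h₁ h₂

/-- Changing several entries other than the first one modulo the remaining ones. -/
theorem add_entries (s : Finset (Fin (m + 3))) (hs : 0 ∉ s) (l : Fin (m + 3) → A)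
    (hl : ∀ i ∈ s, l i ∈ Ideal.span (v '' (s : Set (Fin (m + 3)))ᶜ))
    (h : NiceRow a r fun i => if i ∈ s then v i + l i else v i) : NiceRow a r v := by
  classical
  induction s using Finset.induction_on generalizing v with
  | empty => simpa using h
  | insert i s his ih =>
    have hi0 : i ≠ 0 := fun h => hs (by simp [h])
    refine add_entry (j := i) hi0 (x := l i) ?_ (ih (fun h => hs (by simp [h])) ?_ ?_)
    · refine Ideal.span_mono (Set.image_mono ?_) (hl i (by simp))
      rw [Set.compl_subset_compl]
      simp
    · intro j hj
      have : v '' (((insert i s : Finset _) : Set (Fin (m + 3))))ᶜ ⊆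
          Function.update v i (v i + l i) '' (s : Set (Fin (m + 3)))ᶜ := by
        rintro _ ⟨k, hk, rfl⟩
        simp only [Finset.coe_insert, Set.mem_compl_iff, Set.mem_insert_iff, not_or] at hk
        exact ⟨k, hk.2, by simp [hk.1]⟩
      exact Ideal.span_mono this (hl j (Finset.mem_insert_of_mem hj))
    · convert h using 2 with j
      by_cases hj : j = i
      · subst hj; simp [his]
      · simp [hj]

end

variable {R : Type*} [CommRing R] {x : R} {m : ℕ}

theorem of_slot_eq {a r : R[X]} {v : Fin (m + 3) → R[X]} {N n : ℕ} {h ρ w : R[X]}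
    (hr : C x ∣ r)
    (hw : C (x ^ N) * v 1 = v (Fin.last _) * h + ρ)
    (hmem : w - C (x ^ (N + 2 * n)) * ρ ∈ Ideal.span (v '' {1}ᶜ))
    (hnice : NiceRow a r (rowPair v 1 (Fin.last _) (-v (Fin.last _)) w)) : NiceRow a r v := by
  have hl0 : Fin.last (m + 2) ≠ 0 := by simp [Fin.ext_iff]
  have hl1 : Fin.last (m + 2) ≠ 1 := by simp [Fin.ext_iff]
  have h10 : (1 : Fin (m + 3)) ≠ 0 := zero_ne_one_fin.symm
  refine of_span_eq_top fun _ h0 => ?_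
  obtain ⟨r₀, rfl⟩ := hr
  refine sq_mul_entry (j := 1) h10 (s := C (x ^ (N + n))) (s' := (a * r₀) ^ (N + n)) ?_ ?_
  · rw [Ideal.mem_span_singleton, h0, C_pow, ← mul_pow]
    convert sub_one_dvd_pow_sub_one (C x * (a * r₀)) (N + n) using 1
    ring
  set v' := Function.update v 1 (C (x ^ (N + n)) ^ 2 * v 1) with hv'
  have himg : v' '' {1}ᶜ = v '' {1}ᶜ := by
    refine Set.image_congr fun i hi => ?_
    simp [hv', show i ≠ 1 from hi]
  refine add_entry (j := 1) h10 (x := w - v' 1) ?_ ?_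
  · rw [himg]
    have h1 : v' 1 = C (x ^ (N + 2 * n)) * (v (Fin.last _) * h + ρ) := by
      rw [← hw, hv', Function.update_self, ← C_pow, ← mul_assoc, ← C_mul]
      ring_nf
    rw [h1]
    have h2 : v (Fin.last _) ∈ Ideal.span (v '' {1}ᶜ) :=
      Ideal.subset_span ⟨Fin.last _, hl1, rfl⟩
    convert sub_mem hmem (Ideal.mul_mem_left _ (C (x ^ (N + 2 * n)) * h) h2) using 1
    ring
  · rw [add_sub_cancel]
    refine swap_entry hl0 hl1 ?_
    convert hnice using 1
    ext i
    by_cases hi : i = 1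
    · subst hi; simp [rowPair, hv', hl1, hl1.symm]
    · simp [rowPair, hv', hl1]

/-- Reduction of the degree of the last entry to one. -/
theorem of_natDegree_one [IsNoetherianRing R] [IsLocalRing R] (hdim : ringKrullDim R ≤ (m + 2 : ℕ))
    (hxm : x ∈ IsLocalRing.maximalIdeal R) (hxn : ¬ IsNilpotent x)
    (base : ∀ (a r : R[X]) (v : Fin (m + 3) → R[X]), C x ∣ r → (v (Fin.last _)).natDegree = 1 →
      (∃ K : ℕ, (v (Fin.last _)).leadingCoeff ∣ x ^ K) → NiceRow a r v)
    (a r : R[X]) (v : Fin (m + 3) → R[X]) (hr : C x ∣ r)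
    (hd : 0 < (v (Fin.last _)).natDegree)
    (hlc : ∃ K : ℕ, (v (Fin.last _)).leadingCoeff ∣ x ^ K) : NiceRow a r v := by
  classical
  obtain ⟨M, hM⟩ : ∃ M, (v (Fin.last _)).natDegree = M + 1 := ⟨_, (Nat.sub_add_cancel hd).symm⟩
  induction M generalizing a v with
  | zero => exact base a r v hr hM hlc
  | succ M ih =>
  have hl0 : Fin.last (m + 2) ≠ 0 := by simp [Fin.ext_iff]
  have hl1 : Fin.last (m + 2) ≠ 1 := by simp [Fin.ext_iff]
  have h10 : (1 : Fin (m + 3)) ≠ 0 := zero_ne_one_fin.symm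
  refine of_span_eq_top fun hone h0 => ?_
  obtain ⟨K, hK⟩ := hlc
  set f := v (Fin.last _) with hf
  set s : Finset (Fin (m + 3)) := {0, 1, Fin.last _}ᶜ with hs
  have hscard : s.card = m := by
    rw [hs, Finset.card_compl, Fintype.card_fin, Finset.card_eq_three.2
      ⟨0, 1, Fin.last _, h10.symm, hl0.symm, hl1.symm, rfl⟩]
    rfl
  have hsmem : ∀ i, i ∈ s ↔ i ≠ 0 ∧ i ≠ 1 ∧ i ≠ Fin.last _ := fun i => by simp [hs]
  obtain ⟨y₀, y, hy⟩ := exists_not_forall_mem_vanishIdeal hK (by omega) s (hscard.symm ▸ hdim) hxm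
    (v 0) (r * v 1) v (by
      rw [eq_top_iff, ← hone, Ideal.span_le]
      rintro _ ⟨i, rfl⟩
      by_cases hi0 : i = 0
      · subst hi0
        exact Ideal.mem_sup_left (Ideal.mem_sup_left (Ideal.mem_span_singleton_self _))
      by_cases hi1 : i = 1
      · subst hi1
        refine Ideal.mem_sup_left ?_
        rw [← Ideal.span_insert]
        exact Ideal.mem_span_pair.2 ⟨-v 1, a, by rw [h0]; ring⟩
      by_cases hil : i = Fin.last _
      · subst hil
        exact Ideal.mem_sup_right (Ideal.mem_sup_left (Ideal.mem_span_singleton_self _))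
      · exact Ideal.mem_sup_right (Ideal.mem_sup_right (Ideal.subset_span
          ⟨i, (hsmem i).2 ⟨hi0, hi1, hil⟩, rfl⟩)))
  refine add_left (l := v 1 * y₀) (Ideal.mul_mem_right _ _ (Ideal.subset_span ⟨1, h10, rfl⟩)) ?_
  set v₁ := Function.update v 0 (v 0 + r * (v 1 * y₀)) with hv₁
  refine add_entries s (by simp [hs]) (fun i => r * v 1 * y i) (fun i _ => ?_) ?_
  · refine Ideal.mul_mem_right _ _ (Ideal.mul_mem_left _ _ (Ideal.subset_span ⟨1, ?_, ?_⟩))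
    · simp [hs]
    · simp [hv₁]
  set v₂ : Fin (m + 3) → R[X] := fun i => if i ∈ s then v₁ i + r * v 1 * y i else v₁ i with hv₂
  have hv₂l : v₂ (Fin.last _) = f := by simp [hv₂, hs, hv₁, hf]
  obtain ⟨N, h, ρ, hρ, hρd⟩ := exists_pseudo_div hK hd (v₂ 1)
  obtain ⟨n, g, hg, hgd, hgc⟩ := exists_mem_coeff_eq_pow hK hd
    (H := Ideal.span (v₂ '' {1}ᶜ)) (Ideal.subset_span ⟨_, hl1, hv₂l⟩) (by
      intro P hP hx hle
      refine hy P hP hx ⟨?_, fun i hi => ?_⟩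
      · convert hle (Ideal.subset_span ⟨0, h10.symm, rfl⟩) using 1
        simp [hv₂, hs, hv₁, mul_assoc]
      · have hi' := (hsmem i).1 hi
        convert hle (Ideal.subset_span ⟨i, hi'.2.1, rfl⟩) using 1
        simp [hv₂, hi, hv₁, hi'.1])
  have hMf : f.natDegree - 1 = M + 1 := by omega
  rw [hMf] at hgc
  set w := C (x ^ (N + 2 * n)) * ρ + C (1 - x ^ (N + n) * ρ.coeff (M + 1)) * g with hw
  have hwc : w.coeff (M + 1) = x ^ n := by
    rw [hw, coeff_add, coeff_C_mul, coeff_C_mul, hgc]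
    ring
  have hwd : w.natDegree = M + 1 := by
    refine le_antisymm ?_ (le_natDegree_of_ne_zero ?_)
    · refine (natDegree_add_le _ _).trans (max_le ((natDegree_C_mul_le _ _).trans ?_)
        ((natDegree_C_mul_le _ _).trans ?_)) <;> omega
    · rw [hwc]; exact fun h => hxn ⟨n, h⟩
  refine of_slot_eq (N := N) (n := n) (h := h) (ρ := ρ) (w := w) hr (by rw [hv₂l]; exact hρ) ?_ ?_
  · rw [hw, add_sub_cancel_left]
    exact Ideal.mul_mem_left _ _ hg
  · refine ih _ _ ?_ ?_ ?_
    · simp [rowPair, hwd]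
    · refine ⟨n, ?_⟩
      simp [rowPair, leadingCoeff, hwd, hwc]
    · simp [rowPair, hwd]

end NiceRow

section Linear

theorem mem_radical_of_one_mem_vanishIdeal {R : Type*} [CommRing R] {x : R} {f : R[X]} {K : ℕ}
    (hf : f.leadingCoeff ∣ x ^ K) (hpos : 0 < f.natDegree) {J : Ideal R}
    (h : (1 : R[X]) ∈ vanishIdeal x f J) : x ∈ J.radical := by
  rw [Ideal.radical_eq_sInf, Submodule.mem_sInf]
  rintro P ⟨hJP, hP⟩
  by_contra hx
  exact one_notMem_vanishIdeal hf hpos hP hx (vanishIdeal_mono hJP h)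

/-- Truncations of the inverse square root of `1 + X`. -/
theorem exists_X_pow_dvd_one_sub {R : Type*} [CommRing R] (h2 : IsUnit (2 : R)) (j : ℕ) :
    ∃ p : R[X], X ^ j ∣ 1 - (1 + X) * p ^ 2 := by
  obtain ⟨u, hu⟩ := h2.exists_right_inv
  have hu' : (2 : R[X]) * C u = 1 := by
    rw [← C_1, ← hu, C_mul]; rfl
  induction j with
  | zero => exact ⟨0, by simp⟩
  | succ j ih =>
    rcases j with _ | j
    · refine ⟨1, ?_⟩
      simp
    obtain ⟨p, g, hg⟩ := ih
    refine ⟨p * (1 + C u * X ^ (j + 1) * g), g * X - C (u ^ 2) * X ^ j * g ^ 2 *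
      ((1 + X) * p ^ 2) + g ^ 2 * X ^ j - g * X, ?_⟩
    simp only [C_pow]
    linear_combination (1 + X ^ (j + 1) * g) * hg +
      (-X ^ (j + 1) * g * (1 + X) * p ^ 2) * hu'

variable {D : Type*} [CommRing D]

theorem pow_succ_sup_le (c y : D) (n : ℕ) :
    (Ideal.span {c} ⊔ Ideal.span {y}) ^ (n + 1) ≤
      Ideal.span {c} * (Ideal.span {c} ⊔ Ideal.span {y}) ^ n ⊔ Ideal.span {y ^ (n + 1)} := by
  induction n with
  | zero => simp
  | succ n ih =>
    rw [pow_succ]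
    refine (Ideal.mul_mono_left ih).trans ?_
    rw [Ideal.sup_mul, mul_assoc, ← pow_succ, Ideal.mul_sup,
      Ideal.span_singleton_mul_span_singleton,
      Ideal.span_singleton_mul_span_singleton, ← pow_succ]
    refine sup_le le_sup_left (sup_le ?_ le_sup_right)
    refine le_sup_of_le_left ?_
    rw [Ideal.span_singleton_le_iff_mem, mul_comm (y ^ (n + 1)) c]
    refine Ideal.mul_mem_mul (Ideal.mem_span_singleton_self _) (Ideal.pow_mem_pow ?_ _)
    exact Ideal.mem_sup_right (Ideal.mem_span_singleton_self _)

/-- If `y / c` is integral with nilpotent behaviour, then high powers of `y` are divisible by higher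
powers of `c`. -/
theorem exists_forall_pow_mem_span {c y l : D} {E e : ℕ}
    (hE : y ^ (E + 1) ∈ Ideal.span {l * c} * (Ideal.span {c} ⊔ Ideal.span {y}) ^ E)
    (he : l ^ e ∈ Ideal.span {c}) (L : ℕ) :
    ∃ j, ∀ i, j ≤ i → y ^ i ∈ Ideal.span {c ^ (i + L)} := by
  set 𝔦 := Ideal.span {c} ⊔ Ideal.span {y}
  have h1 : 𝔦 ^ (E + 1) ≤ Ideal.span {c} * 𝔦 ^ E := by
    refine (pow_succ_sup_le c y E).trans (sup_le le_rfl ?_)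
    rw [Ideal.span_singleton_le_iff_mem]
    refine Ideal.mul_mono_left ?_ hE
    rw [Ideal.span_singleton_le_iff_mem]
    exact Ideal.mul_mem_left _ _ (Ideal.mem_span_singleton_self _)
  have h2 : ∀ j, 𝔦 ^ (E + j) ≤ Ideal.span {c ^ j} := by
    have h3 : ∀ j, 𝔦 ^ (E + j) ≤ Ideal.span {c ^ j} * 𝔦 ^ E := by
      intro j
      induction j with
      | zero => simp
      | succ j ih =>
        calc 𝔦 ^ (E + (j + 1)) = 𝔦 ^ (E + j) * 𝔦 := by rw [← add_assoc, pow_succ]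
          _ ≤ Ideal.span {c ^ j} * 𝔦 ^ E * 𝔦 := Ideal.mul_mono_left ih
          _ = Ideal.span {c ^ j} * 𝔦 ^ (E + 1) := by rw [mul_assoc, pow_succ]
          _ ≤ Ideal.span {c ^ j} * (Ideal.span {c} * 𝔦 ^ E) := Ideal.mul_mono_right h1
          _ = _ := by rw [← mul_assoc, Ideal.span_singleton_mul_span_singleton, pow_succ]
    exact fun j => (h3 j).trans Ideal.mul_le_left
  have he' : l ^ (e + 1) ∈ Ideal.span {c} := by
    rw [pow_succ]; exact Ideal.mul_mem_right _ _ he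
  set t := L + E with ht
  set b := (e + 1) * t with hb
  refine ⟨(E + 1) * b + E, fun i hi => ?_⟩
  obtain ⟨k, rfl⟩ := Nat.exists_eq_add_of_le hi
  have h4 : y ^ ((E + 1) * b + E + k) ∈
      Ideal.span {(l * c) ^ b} * 𝔦 ^ (E + (E * b + k)) := by
    have h5 := Ideal.mul_mem_mul (Ideal.pow_mem_pow hE b)
      (Ideal.pow_mem_pow (show y ∈ 𝔦 from
        Ideal.mem_sup_right (Ideal.mem_span_singleton_self _)) (E + k))
    rw [mul_pow, Ideal.span_singleton_pow, ← pow_mul, ← pow_mul, mul_assoc, ← pow_add, ← pow_add]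
      at h5
    rw [show (E + 1) * b + E + k = (E + 1) * b + (E + k) from add_assoc _ _ _,
      show E + (E * b + k) = E * b + (E + k) from add_left_comm _ _ _]
    exact h5
  have h6 : Ideal.span {(l * c) ^ b} ≤ Ideal.span {c ^ (t + b)} := by
    rw [Ideal.span_singleton_le_span_singleton, mul_pow, pow_add]
    rw [hb, pow_mul l]
    exact mul_dvd_mul (pow_dvd_pow_of_dvd (Ideal.mem_span_singleton.1 he') t) dvd_rfl
  have h7 := Ideal.mul_mono h6 (h2 _) h4
  rw [Ideal.span_singleton_mul_span_singleton, ← pow_add] at h7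
  convert h7 using 3
  rw [ht]
  ring

variable {R : Type*} [CommRing R]

theorem exists_sqrt_data (h2 : IsUnit (2 : R)) {y c : R} {𝔠 : Ideal R}
    (hpow : ∀ L : ℕ, ∃ j, ∀ i, j ≤ i → ∃ θ, y ^ i - c ^ (i + L) * θ ∈ 𝔠) (n : ℕ) :
    ∃ g p : R[X], ∀ (S : Type _) [CommRing S] (Φ : R[X] →+* S), (∀ b ∈ 𝔠, Φ (C b) = 0) →
      ∀ z, Φ (C y * X) = z * Φ (C c) → IsUnit (Φ (C c)) →
      1 - Φ (C (y ^ n * c) * g) = (1 + z) * (p.eval₂ (Φ.comp C) z) ^ 2 := by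
  obtain ⟨j, hj⟩ := hpow (n + 1)
  choose θ hθ using fun t => hj (j + t) (Nat.le_add_right _ _)
  obtain ⟨p, h, hp⟩ := exists_X_pow_dvd_one_sub h2 (j + n)
  refine ⟨∑ t ∈ Finset.range (h.natDegree + 1), C (h.coeff t * θ t) * X ^ (j + n + t), p,
    fun S _ Φ hΦ z hz hc => ?_⟩
  have hterm : ∀ t, Φ (C (y ^ n * c) * (C (θ t) * X ^ (j + n + t))) = z ^ (j + n + t) := by
    intro t
    rw [← (hc.pow (j + n + t)).mul_left_inj, ← mul_pow, ← hz]
    have h1 := hΦ _ (hθ t)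
    simp only [map_sub, map_mul, map_pow] at h1 ⊢
    linear_combination (-(Φ (C y)) ^ n * Φ X ^ (j + n + t)) * h1
  have h3 := congrArg (eval₂ (Φ.comp C) z) hp
  simp only [eval₂_sub, eval₂_one, eval₂_mul, eval₂_add, eval₂_X, eval₂_pow] at h3
  rw [sub_eq_iff_eq_add, ← sub_eq_iff_eq_add'] at h3
  rw [← h3, sub_right_inj]
  rw [eval₂_eq_sum_range, Finset.mul_sum, Finset.mul_sum, map_sum]
  refine Finset.sum_congr rfl fun t _ => ?_
  have := hterm t
  simp only [map_mul, RingHom.comp_apply, map_pow] at this ⊢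
  rw [pow_add] at this
  linear_combination Φ (C (h.coeff t)) * this

end Linear

section Homogenization

variable {R : Type*} [CommRing R]

/-- The value at `(c, y)` of the homogenization of degree `M` of a polynomial. -/
def homogEval (c y : R) (M : ℕ) (g : R[X]) : R :=
  ∑ i ∈ Finset.range (M + 1), g.coeff i * c ^ i * y ^ (M - i)

theorem C_pow_mul_sub_homogEval_mem (c y : R) {M : ℕ} {g : R[X]} (hg : g.natDegree ≤ M) :
    C (y ^ M) * g - C (homogEval (-c) y M g) ∈ Ideal.span {C c + C y * X} := by
  have hsum : C (y ^ M) * g =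
      ∑ i ∈ Finset.range (M + 1), C (y ^ M) * (C (g.coeff i) * X ^ i) := by
    rw [← Finset.mul_sum, ← as_sum_range_C_mul_X_pow' g (Nat.lt_succ_of_le hg)]
  rw [hsum, homogEval, map_sum, ← Finset.sum_sub_distrib]
  refine sum_mem fun i hi => ?_
  rw [Finset.mem_range, Nat.lt_succ_iff] at hi
  rw [Ideal.mem_span_singleton]
  have h1 := (sub_dvd_pow_sub_pow (C y * X) (-C c) i).mul_left (C (g.coeff i) * C (y ^ (M - i)))
  rw [sub_neg_eq_add, add_comm] at h1
  convert h1 using 1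
  rw [← Nat.sub_add_cancel hi, Nat.add_sub_cancel, pow_add]
  simp only [C_mul, C_pow, C_neg]
  ring

theorem exists_forall_pow_sub_mem {c y l : R} {F : R[X]} {E : ℕ} {𝔠 : Ideal R}
    (hF0 : IsUnit (F.coeff 0)) (hFl : ∀ i, l ∣ F.coeff (i + 1))
    (hl : l ∈ (Ideal.span {c} ⊔ Ideal.span {y} ⊔ 𝔠).radical)
    (hc : homogEval (-c) y (E + 1) F ∈ 𝔠) (L : ℕ) :
    ∃ j, ∀ i, j ≤ i → ∃ θ, y ^ i - c ^ (i + L) * θ ∈ 𝔠 := by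
  set π := Ideal.Quotient.mk 𝔠 with hπ
  have hyE : π y ^ (E + 1) ∈
      Ideal.span {π l * π c} * (Ideal.span {π c} ⊔ Ideal.span {π y}) ^ E := by
    have h1 := Ideal.Quotient.eq_zero_iff_mem.2 hc
    rw [homogEval, Finset.sum_range_succ'] at h1
    simp only [pow_zero, mul_one, Nat.sub_zero, map_add, map_mul, map_pow, map_sum, map_neg] at h1
    rw [← Ideal.unit_mul_mem_iff_mem _ (hF0.map π), eq_neg_of_add_eq_zero_right h1, neg_mem_iff]
    refine sum_mem fun i hi => ?_
    rw [Finset.mem_range, Nat.lt_succ_iff] at hi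
    obtain ⟨u, hu⟩ := hFl i
    have h2 : π c ^ i * π y ^ (E - i) ∈ (Ideal.span {π c} ⊔ Ideal.span {π y}) ^ E := by
      have h3 := Ideal.mul_mem_mul
        (Ideal.pow_mem_pow (I := Ideal.span {π c} ⊔ Ideal.span {π y})
          (Ideal.mem_sup_left (Ideal.mem_span_singleton_self _)) i)
        (Ideal.pow_mem_pow (I := Ideal.span {π c} ⊔ Ideal.span {π y})
          (Ideal.mem_sup_right (Ideal.mem_span_singleton_self _)) (E - i))
      rwa [← pow_add, Nat.add_sub_cancel' hi] at h3
    have h3 := Ideal.mul_mem_left _ (-π u * (-1) ^ i)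
      (Ideal.mul_mem_mul (Ideal.mem_span_singleton_self (π l * π c)) h2)
    convert h3 using 1
    rw [hu, Nat.add_sub_add_right, neg_pow, map_mul]
    ring
  have hyc : π y ∈ (Ideal.span {π c}).radical := by
    refine ⟨E + 1, Ideal.mul_le_left.trans ?_ hyE⟩
    rw [Ideal.span_singleton_le_iff_mem]
    exact Ideal.mul_mem_left _ _ (Ideal.mem_span_singleton_self _)
  have hlc : π l ∈ (Ideal.span {π c}).radical := by
    have h1 := Ideal.map_radical_le π (Ideal.mem_map_of_mem π hl)
    refine (Ideal.radical_mono ?_).trans (Ideal.radical_idem _).le h1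
    rw [Ideal.map_sup, Ideal.map_sup, Ideal.map_span, Ideal.map_span, Set.image_singleton,
      Set.image_singleton]
    refine sup_le (sup_le Ideal.le_radical ?_) ?_
    · rwa [Ideal.span_singleton_le_iff_mem]
    · rw [Ideal.map_le_iff_le_comap]
      intro b hb
      rw [Ideal.mem_comap, hπ, Ideal.Quotient.eq_zero_iff_mem.2 hb]
      exact zero_mem _
  obtain ⟨e, he⟩ := hlc
  obtain ⟨j, hj⟩ := exists_forall_pow_mem_span hyE he L
  refine ⟨j, fun i hi => ?_⟩
  obtain ⟨t, ht⟩ := Ideal.mem_span_singleton.1 (hj i hi)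
  obtain ⟨θ, rfl⟩ := Ideal.Quotient.mk_surjective t
  refine ⟨θ, ?_⟩
  rw [← Ideal.Quotient.eq_zero_iff_mem, map_sub, map_mul, map_pow, map_pow, ht, sub_self]

theorem exists_one_add_eq_sq {B : Type*} [CommRing B] (h2 : IsUnit (2 : B)) {κ γ e z p : B}
    (hκ : IsUnit κ) (hγκ : IsUnit (γ - κ))
    (h : 4 * κ * (γ - κ) = γ * e * (4 * κ - γ + γ * e)) (he : 1 - e = (1 + z) * p ^ 2) :
    ∃ ζ, 1 + z = ζ ^ 2 := by
  have h4 : IsUnit (4 : B) := by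
    rw [show (4 : B) = 2 * 2 by norm_num]; exact h2.mul h2
  have hγ : IsUnit γ := by
    refine isUnit_of_mul_isUnit_left (y := e * (4 * κ - γ + γ * e)) ?_
    rw [← mul_assoc, ← h]
    exact (h4.mul hκ).mul hγκ
  have hP : IsUnit (1 - e) := by
    refine isUnit_of_mul_isUnit_left (y := γ ^ 2 + 4 * κ * γ - γ ^ 2 * (1 - e)) ?_
    rw [show (1 - e) * (γ ^ 2 + 4 * κ * γ - γ ^ 2 * (1 - e)) = 4 * κ ^ 2 by linear_combination h]
    exact h4.mul (hκ.pow 2)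
  have hp : IsUnit p := by
    rw [he, mul_comm] at hP
    exact (isUnit_pow_iff two_ne_zero).1 (isUnit_of_mul_isUnit_left hP)
  obtain ⟨γ', hγ'⟩ := hγ.exists_right_inv
  obtain ⟨p', hp'⟩ := hp.exists_right_inv
  refine ⟨(2 * κ - γ * (1 - e)) * γ' * p', ?_⟩
  have h5 : (2 * κ - γ * (1 - e)) ^ 2 = γ ^ 2 * (1 - e) := by linear_combination -h
  rw [mul_pow, mul_pow, h5, he]
  have h6 : γ ^ 2 * γ' ^ 2 = 1 := by rw [← mul_pow, hγ', one_pow]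
  have h7 : p ^ 2 * p' ^ 2 = 1 := by rw [← mul_pow, hp', one_pow]
  linear_combination (-(1 + z) * p ^ 2 * p' ^ 2) * h6 - (1 + z) * h7

end Homogenization

theorem mem_vanishIdeal_of_C_pow_mul_mem {R : Type*} [CommRing R] {x : R} {f g : R[X]}
    {P : Ideal R} (n : ℕ) (h : C (x ^ n) * g ∈ vanishIdeal x f P) : g ∈ vanishIdeal x f P := by
  obtain ⟨N, hN⟩ := h
  exact ⟨N + n, by rwa [pow_add, C_mul, mul_assoc]⟩

namespace NiceRow

variable {R : Type*} [CommRing R] {m : ℕ}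

/-- A row with linear second entry, constant third and following entries and first entry
`C α * r - 1`, where `r` becomes constant after multiplication by a power of `y`. -/
theorem of_linear_slot_of_const (h2 : IsUnit (2 : R)) {α β c y l : R} {T : ℕ} {r : R[X]}
    {v : Fin (m + 3) → R[X]} {𝔰 : Ideal R} (hv1 : v 1 = C c + C y * X)
    (hS : Ideal.span (v '' {0, 1, Fin.last _}ᶜ) = 𝔰.map C)
    (hF0 : IsUnit ((v (Fin.last _)).coeff 0)) (hFl : ∀ i, l ∣ (v (Fin.last _)).coeff (i + 1))
    (hl : l ∈ (Ideal.span {c} ⊔ Ideal.span {y} ⊔ 𝔰).radical)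
    (hy : Ideal.span (v '' {0}ᶜ) ⊔ Ideal.span {C y} = ⊤)
    (hc : Ideal.span (v '' {0}ᶜ) ⊔ Ideal.span {C c} = ⊤)
    (hr : C (y ^ T) * r - C β ∈ Ideal.span (v '' {0}ᶜ)) : NiceRow (C α) r v := by
  have hl0 : Fin.last (m + 2) ≠ 0 := by simp [Fin.ext_iff]
  have hl1 : Fin.last (m + 2) ≠ 1 := by simp [Fin.ext_iff]
  have h10 : (1 : Fin (m + 3)) ≠ 0 := zero_ne_one_fin.symm
  refine of_span_eq_top fun hone h0 => ?_
  set F := v (Fin.last _) with hF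
  set J := Ideal.span (v '' {0}ᶜ) with hJ
  set κ := α * β - y ^ T with hκ
  set E := 2 * F.natDegree + 1 with hE
  set c' := homogEval (-c) y (E + 1) F with hc'
  set 𝔠 := 𝔰 ⊔ Ideal.span {c'} with h𝔠
  have hcF : C (y ^ (E + 1)) * F - C c' ∈ Ideal.span {v 1} := by
    rw [hv1]; exact C_pow_mul_sub_homogEval_mem c y (by omega)
  have hJ1 : v 1 ∈ J := Ideal.subset_span ⟨1, h10, rfl⟩
  have hJl : F ∈ J := Ideal.subset_span ⟨_, hl0, rfl⟩
  have h𝔰J : 𝔰.map C ≤ J := by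
    rw [← hS]
    exact Ideal.span_mono (Set.image_mono (by simp))
  have h𝔠J : 𝔠.map C ≤ J := by
    rw [h𝔠, Ideal.map_sup, Ideal.map_span, Set.image_singleton]
    refine sup_le h𝔰J ((Ideal.span_singleton_le_iff_mem _).2 ?_)
    have := sub_mem (J.mul_mem_left (C (y ^ (E + 1))) hJl)
      ((Ideal.span_singleton_le_iff_mem _).2 hJ1 hcF)
    rwa [sub_sub_cancel] at this
  have hyrad : y ∈ (Ideal.span {κ} ⊔ 𝔠).radical := by
    rcases eq_or_ne y 0 with hy0 | hy0
    · rw [hy0]; exact zero_mem _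
    set V := vanishIdeal y (v 1) (Ideal.span {κ} ⊔ 𝔠) with hV
    have hVmap : (Ideal.span {κ} ⊔ 𝔠).map C ≤ V := map_le_vanishIdeal _ _ _
    have hV1 : v 1 ∈ V := self_mem_vanishIdeal _ _ _
    have hVl : F ∈ V := by
      refine mem_vanishIdeal_of_C_pow_mul_mem (E + 1) ?_
      have := add_mem ((Ideal.span_singleton_le_iff_mem _).2 hV1 hcF)
        (hVmap (Ideal.mem_map_of_mem C (Ideal.mem_sup_right (Ideal.mem_sup_right
          (Ideal.mem_span_singleton_self c')))))
      rwa [sub_add_cancel] at this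
    have hVmid : ∀ i, i ≠ 0 → v i ∈ V := by
      intro i hi
      by_cases hi1 : i = 1
      · rwa [hi1]
      by_cases hil : i = Fin.last _
      · rwa [hil]
      refine hVmap (Ideal.map_mono (le_sup_left.trans le_sup_right) ?_)
      rw [← hS]
      exact Ideal.subset_span ⟨i, by simp [hi, hi1, hil], rfl⟩
    have hJV : J ≤ V := Ideal.span_le.2 (by rintro _ ⟨i, hi, rfl⟩; exact hVmid i hi)
    refine mem_radical_of_one_mem_vanishIdeal (f := v 1) (K := 1) ?_ ?_ ?_
    · rw [hv1, add_comm, leadingCoeff_linear hy0, pow_one]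
    · rw [hv1, add_comm, natDegree_linear hy0]; exact one_pos
    · rw [← hV, ← Ideal.eq_top_iff_one, eq_top_iff, ← hone, Ideal.span_le]
      rintro _ ⟨i, rfl⟩
      by_cases hi : i = 0
      · subst hi
        refine mem_vanishIdeal_of_C_pow_mul_mem T ?_
        rw [← hV]
        have := add_mem (V.mul_mem_left (C α) (hJV hr)) (hVmap (Ideal.mem_map_of_mem C
          (Ideal.mem_sup_left (Ideal.mem_span_singleton_self κ))))
        convert this using 1
        rw [h0, hκ, C_sub, C_mul]
        ring
      · exact hVmid i hi
  obtain ⟨k, hk⟩ := hyrad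
  obtain ⟨κ', hκ'⟩ : ∃ κ', y ^ k - κ * κ' ∈ 𝔠 := by
    obtain ⟨s, hs, t, ht, hst⟩ := Submodule.mem_sup.1 hk
    obtain ⟨κ', rfl⟩ := Ideal.mem_span_singleton.1 hs
    exact ⟨κ', by rwa [← hst, add_sub_cancel_left]⟩
  obtain ⟨g, p, hgp⟩ := exists_sqrt_data h2 (exists_forall_pow_sub_mem (E := E) hF0 hFl
    (Ideal.radical_mono (sup_le_sup_left le_sup_left _) hl)
    (Ideal.mem_sup_right (Ideal.mem_span_singleton_self c') : _ ∈ 𝔠)) (k + T + 1)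
  set e := C (y ^ (k + T + 1) * c) * g with he
  obtain ⟨u, hu⟩ : ∃ u : R, 4 * u = 1 := by
    have h4 : IsUnit (4 : R) := by
      rw [show (4 : R) = 2 * 2 by norm_num]; exact h2.mul h2
    exact h4.exists_right_inv
  set r' := C (u * β * κ' * y * c) * g * (4 * C κ - C (α * β) + C (α * β) * e) with hr'
  have hunit : ∀ {b : R}, J ⊔ Ideal.span {C b} = ⊤ → IsUnit (Ideal.Quotient.mk J (C b)) := by
    intro b hb
    obtain ⟨s, hs, t, ht, hst⟩ := Submodule.mem_sup.1 ((Ideal.eq_top_iff_one _).1 hb)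
    obtain ⟨b', rfl⟩ := Ideal.mem_span_singleton.1 ht
    refine IsUnit.of_mul_eq_one (Ideal.Quotient.mk J b') ?_
    rw [← map_mul, ← map_one (Ideal.Quotient.mk J), ← hst, map_add,
      Ideal.Quotient.eq_zero_iff_mem.2 hs, zero_add]
  have hkill : ∀ b ∈ 𝔠, Ideal.Quotient.mk J (C b) = 0 := fun b hb =>
    Ideal.Quotient.eq_zero_iff_mem.2 (h𝔠J (Ideal.mem_map_of_mem C hb))
  have hrr : r' - r ∈ J := by
    have hz : Ideal.Quotient.mk J (C y * X) = -1 * Ideal.Quotient.mk J (C c) := by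
      have := Ideal.Quotient.eq_zero_iff_mem.2 hJ1
      rw [hv1, map_add] at this
      linear_combination this
    have he1 := hgp _ (Ideal.Quotient.mk J) hkill _ hz (hunit hc)
    rw [add_neg_cancel, zero_mul, sub_eq_zero, eq_comm] at he1
    have hk1 := hkill _ hκ'
    have hr1 := Ideal.Quotient.eq_zero_iff_mem.2 hr
    have hu1 := congrArg (fun b => Ideal.Quotient.mk J (C b)) hu
    rw [← Ideal.Quotient.eq_zero_iff_mem, ← ((hunit hy).pow T).mul_right_eq_zero]
    rw [hr', map_sub, map_mul, map_add, map_mul (Ideal.Quotient.mk J) (C (α * β)) e, he1]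
    rw [he] at he1
    simp only [map_sub, map_mul, map_pow, map_one, map_ofNat] at he1 hk1 hr1 hu1 ⊢
    set Y := Ideal.Quotient.mk J (C y)
    set G := Ideal.Quotient.mk J g
    set U := Ideal.Quotient.mk J (C u)
    set B := Ideal.Quotient.mk J (C β)
    set K := Ideal.Quotient.mk J (C κ)
    set K' := Ideal.Quotient.mk J (C κ')
    set c₁ := Ideal.Quotient.mk J (C c)
    linear_combination (B * K * K' * Y ^ (T + 1) * c₁ * G) * hu1 -
      (B * Y ^ (T + 1) * c₁ * G) * hk1 + B * he1 - hr1
  have hr'y : C y ∣ r' := ⟨C (u * β * κ' * c) * g * (4 * C κ - C (α * β) + C (α * β) * e), by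
    rw [hr']; simp only [C_mul]; ring⟩
  have hr'c : C c ∣ r' := ⟨C (u * β * κ' * y) * g * (4 * C κ - C (α * β) + C (α * β) * e), by
    rw [hr']; simp only [C_mul]; ring⟩
  obtain ⟨y', hy'⟩ := hr'y
  refine add_right hrr ?_
  rw [add_sub_cancel]
  have hv0 : v 0 + C α * (r' - r) = C α * r' - 1 := by rw [h0]; ring
  rw [hv0]
  refine sq_mul_entry (j := Fin.last _) (s := C (y ^ (F.natDegree + 1)))
    (s' := (C α * y') ^ (F.natDegree + 1)) hl0 ?_ ?_
  · rw [Ideal.mem_span_singleton, Function.update_self, C_pow, ← mul_pow]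
    convert sub_one_dvd_pow_sub_one (C y * (C α * y')) (F.natDegree + 1) using 1
    rw [hy']; ring
  rw [Function.update_of_ne hl0, ← C_pow, ← pow_mul, ← hF,
    show (F.natDegree + 1) * 2 = E + 1 by omega]
  refine add_entry (j := Fin.last _) (x := C c' - C (y ^ (E + 1)) * F) hl0 ?_ ?_
  · rw [← neg_mem_iff, neg_sub]
    refine Ideal.span_mono ?_ hcF
    rintro _ rfl
    exact ⟨1, by simpa using hl1.symm, by simp [hl1.symm]⟩
  rw [Function.update_self, add_sub_cancel, Function.update_idem]
  set V := Function.update (Function.update v 0 (C α * r' - 1)) (Fin.last _) (C c') with hV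
  have hV1 : V 1 = C c + C y * X := by simp [hV, hl1.symm, hv1]
  have hVl : V (Fin.last _) = C c' := by simp [hV]
  have hV0 : V 0 = C α * r' - 1 := by simp [hV, hl0.symm]
  intro hVone _
  set Q := Ideal.span (V '' {1}ᶜ) with hQ
  have h𝔠Q : 𝔠.map C ≤ Q := by
    rw [h𝔠, Ideal.map_sup, Ideal.map_span, Set.image_singleton, ← hS, ← hVl, ← Ideal.span_union]
    refine Ideal.span_mono ?_
    rintro _ (⟨i, hi, rfl⟩ | rfl)
    · simp only [Set.mem_compl_iff, Set.mem_insert_iff, Set.mem_singleton_iff, not_or] at hi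
      exact ⟨i, hi.2.1, by simp [hV, hi]⟩
    · exact ⟨_, hl1, rfl⟩
  have hkillQ : ∀ b ∈ 𝔠, Ideal.Quotient.mk Q (C b) = 0 := fun b hb =>
    Ideal.Quotient.eq_zero_iff_mem.2 (h𝔠Q (Ideal.mem_map_of_mem C hb))
  have hαr : Ideal.Quotient.mk Q (C α) * Ideal.Quotient.mk Q r' = 1 := by
    rw [← map_mul, ← map_one (Ideal.Quotient.mk Q), Ideal.Quotient.eq, ← hV0]
    exact Ideal.subset_span ⟨0, h10.symm, rfl⟩
  have hr'u : IsUnit (Ideal.Quotient.mk Q r') := IsUnit.of_mul_eq_one_right _ hαr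
  have hYu : IsUnit (Ideal.Quotient.mk Q (C y)) := by
    rw [hy', map_mul] at hr'u; exact isUnit_of_mul_isUnit_left hr'u
  have hcu : IsUnit (Ideal.Quotient.mk Q (C c)) := by
    obtain ⟨d, hd⟩ := hr'c
    rw [hd, map_mul] at hr'u; exact isUnit_of_mul_isUnit_left hr'u
  have hkQ := hkillQ _ hκ'
  rw [C_sub, map_sub, sub_eq_zero, C_mul, C_pow, map_mul, map_pow] at hkQ
  have hκu : IsUnit (Ideal.Quotient.mk Q (C κ)) :=
    isUnit_of_mul_isUnit_left (hkQ ▸ hYu.pow k)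
  obtain ⟨c₂, hc₂⟩ := hcu.exists_right_inv
  have hsqrt := hgp _ (Ideal.Quotient.mk Q) hkillQ (Ideal.Quotient.mk Q (C y * X) * c₂)
    (by rw [mul_assoc, mul_comm c₂, hc₂, mul_one]) hcu
  have hγκ : Ideal.Quotient.mk Q (C α) * Ideal.Quotient.mk Q (C β) - Ideal.Quotient.mk Q (C κ) =
      Ideal.Quotient.mk Q (C y) ^ T := by
    rw [hκ]; simp only [map_sub, map_mul, map_pow]; ring
  have h2A : IsUnit (2 : R[X]) := by
    have := h2.map (C : R →+* R[X])
    rwa [map_ofNat] at this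
  have h2Q : IsUnit (2 : R[X] ⧸ Q) := by
    have := h2.map ((Ideal.Quotient.mk Q).comp C)
    rwa [map_ofNat] at this
  obtain ⟨ζ, hζ⟩ := exists_one_add_eq_sq h2Q hκu (hγκ ▸ hYu.pow T) (by
    rw [hγκ, ← ((hYu.pow k).mul_right_inj)]
    have hu1 := congrArg (fun b => Ideal.Quotient.mk Q (C b)) hu
    rw [hr'] at hαr
    rw [he]
    rw [he] at hαr
    simp only [map_sub, map_add, map_mul, map_pow, map_one, map_ofNat]
      at hαr hu1 hkQ ⊢
    set Y := Ideal.Quotient.mk Q (C y)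
    set G := Ideal.Quotient.mk Q g
    set U := Ideal.Quotient.mk Q (C u)
    set A := Ideal.Quotient.mk Q (C α)
    set B := Ideal.Quotient.mk Q (C β)
    set K := Ideal.Quotient.mk Q (C κ)
    set K' := Ideal.Quotient.mk Q (C κ')
    set c₁ := Ideal.Quotient.mk Q (C c)
    have hE1 : Y ^ (k + T) * (4 * K) = 4 * U * (K * K') * (A * B) * Y ^ (k + T + 1) * c₁ * G *
        (4 * K - A * B + A * B * (Y ^ (k + T + 1) * c₁ * G)) := by
      linear_combination -(Y ^ (k + T) * (4 * K)) * hαr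
    rw [hu1, ← hkQ] at hE1
    linear_combination hE1) hsqrt
  obtain ⟨ζ, rfl⟩ := Ideal.Quotient.mk_surjective ζ
  obtain ⟨d, hd⟩ := hr'c
  refine RowEquiv.mul_unit_of_sq h2A fin_exists_ne_ne hVone (i := 1) (k := 0) h10.symm (r := r')
    (r' := C α) (c := C c) (c' := C α * d) (z := ζ) ?_ ?_ ?_
  · rw [hV0, mul_comm]; exact Ideal.mem_span_singleton_self _
  · rw [hV0, hd, mul_left_comm]; exact Ideal.mem_span_singleton_self _
  · rw [← Ideal.Quotient.eq_zero_iff_mem, hV1, map_sub, map_add, map_mul _ (C c), map_pow, ← hζ]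
    linear_combination -Ideal.Quotient.mk Q (C y * X) * hc₂

theorem image_update_compl {ι A : Type*} [DecidableEq ι] (v : ι → A) {i : ι} {S : Set ι}
    (hi : i ∈ S) (x : A) : Function.update v i x '' Sᶜ = v '' Sᶜ :=
  Set.image_congr fun j hj =>
    Function.update_of_ne (fun h : j = i => hj (h.symm ▸ hi)) _ _

theorem of_linear_slot (h2 : IsUnit (2 : R)) {c y l : R} {a r : R[X]}
    {v : Fin (m + 3) → R[X]} {𝔰 : Ideal R} (hv1 : v 1 = C c + C y * X)
    (hS : Ideal.span (v '' {0, 1, Fin.last _}ᶜ) = 𝔰.map C)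
    (hF0 : IsUnit ((v (Fin.last _)).coeff 0)) (hFl : ∀ i, l ∣ (v (Fin.last _)).coeff (i + 1))
    (hl : l ∈ (Ideal.span {c} ⊔ Ideal.span {y} ⊔ 𝔰).radical)
    (hy : Ideal.span (v '' {0}ᶜ) ⊔ Ideal.span {C y} = ⊤)
    (hc : Ideal.span (v '' {0}ᶜ) ⊔ Ideal.span {C c} = ⊤) : NiceRow a r v := by
  have hl0 : Fin.last (m + 2) ≠ 0 := by simp [Fin.ext_iff]
  have h10 : (1 : Fin (m + 3)) ≠ 0 := zero_ne_one_fin.symm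
  obtain ⟨s, hs, t, ht, hst⟩ := Submodule.mem_sup.1 ((Ideal.eq_top_iff_one _).1 hy)
  obtain ⟨μ, rfl⟩ := Ideal.mem_span_singleton.1 ht
  set J := Ideal.span (v '' {0}ᶜ) with hJ
  have hJ1 : Ideal.span {v 1} ≤ J := Ideal.span_mono (by rintro _ rfl; exact ⟨1, h10, rfl⟩)
  set M := a.natDegree
  set r₁ := μ ^ (2 * M) * r with hr₁
  have hrr : C (y ^ M) ^ 2 * r₁ - r ∈ J := by
    have h1 : C y * μ - 1 ∈ J := by
      rw [← hst, ← neg_mem_iff]; simpa using hs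
    have h3 := J.mul_mem_left r (Ideal.mem_of_dvd J (sub_one_dvd_pow_sub_one (C y * μ) (2 * M)) h1)
    convert h3 using 1
    rw [hr₁, C_pow]
    ring
  refine add_right hrr ?_
  rw [add_sub_cancel]
  refine move_sq ?_
  refine add_left (l := C (homogEval (-c) y (2 * M) a) - C (y ^ M) ^ 2 * a) ?_ ?_
  · rw [image_update_compl v (Set.mem_singleton 0), ← neg_mem_iff, neg_sub, ← C_pow, ← pow_mul,
      mul_comm M, ← hJ]
    refine hJ1 ?_
    rw [hv1]
    exact C_pow_mul_sub_homogEval_mem c y (by omega)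
  rw [add_sub_cancel, Function.update_idem]
  refine of_linear_slot_of_const h2 (c := c) (y := y) (l := l) (𝔰 := 𝔰) (T := r₁.natDegree)
    (β := homogEval (-c) y r₁.natDegree r₁) ?_ ?_ ?_ ?_ hl ?_ ?_ ?_
  · rw [Function.update_of_ne h10, hv1]
  · rw [image_update_compl v (by simp), hS]
  · rwa [Function.update_of_ne hl0]
  · rwa [Function.update_of_ne hl0]
  · rw [image_update_compl v (Set.mem_singleton 0), hy]
  · rw [image_update_compl v (Set.mem_singleton 0), hc]
  · rw [image_update_compl v (Set.mem_singleton 0)]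
    refine hJ1 ?_
    rw [hv1]
    exact C_pow_mul_sub_homogEval_mem c y le_rfl

end NiceRow

namespace NiceRow

variable {R : Type*} [CommRing R] {m : ℕ} {x : R} {a r : R[X]}

theorem of_const_entry {v : Fin (m + 3) → R[X]} (hr : C x ∣ r)
    (hd : (v (Fin.last _)).natDegree = 1) {K : ℕ} (hK : (v (Fin.last _)).leadingCoeff ∣ x ^ K)
    {i : Fin (m + 3)} (hi0 : i ≠ 0) (hil : i ≠ Fin.last _)
    (h : ∀ c, NiceRow a r (Function.update v i (C c))) : NiceRow a r v := by
  refine of_span_eq_top fun _ h0 => ?_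
  obtain ⟨r₀, rfl⟩ := hr
  obtain ⟨N, k, ρ, hρ, hρd⟩ := exists_pseudo_div hK (by omega) (v i)
  rw [hd, Nat.lt_one_iff] at hρd
  rw [eq_C_of_natDegree_eq_zero hρd] at hρ
  refine sq_mul_entry (j := i) hi0 (s := C (x ^ N)) (s' := (a * r₀) ^ N) ?_ ?_
  · rw [Ideal.mem_span_singleton, h0, C_pow, ← mul_pow]
    convert sub_one_dvd_pow_sub_one (C x * (a * r₀)) N using 1
    ring
  refine add_entry (j := i) (x := -(C (x ^ N) * k) * v (Fin.last _)) hi0 ?_ ?_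
  · exact Ideal.mul_mem_left _ _ (Ideal.subset_span ⟨Fin.last _, hil.symm, by simp [hil.symm]⟩)
  rw [Function.update_self, Function.update_idem]
  convert h (x ^ N * ρ.coeff 0) using 2
  rw [sq, mul_assoc, hρ, C_mul]
  ring

theorem of_const_entries {v : Fin (m + 3) → R[X]} (hr : C x ∣ r)
    (hd : (v (Fin.last _)).natDegree = 1) {K : ℕ} (hK : (v (Fin.last _)).leadingCoeff ∣ x ^ K)
    (h : ∀ w : Fin (m + 3) → R[X], w (Fin.last _) = v (Fin.last _) →
      (∀ i, i ≠ 0 → i ≠ Fin.last _ → ∃ c, w i = C c) → NiceRow a r w) : NiceRow a r v := by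
  suffices H : ∀ s : Finset (Fin (m + 3)), (∀ i ∈ s, i ≠ 0 ∧ i ≠ Fin.last _) →
      ∀ w : Fin (m + 3) → R[X], w (Fin.last _) = v (Fin.last _) →
      (∀ i, i ≠ 0 → i ≠ Fin.last _ → i ∉ s → ∃ c, w i = C c) → NiceRow a r w from
    H {0, Fin.last _}ᶜ (by simp) v rfl fun i h0 hl hs => absurd hs (by simp [h0, hl])
  intro s
  induction s using Finset.induction_on with
  | empty => exact fun _ w hw hc => h w hw (by simpa using hc)
  | insert i s his ih =>
    intro hs w hw hc
    obtain ⟨hi0, hil⟩ := hs i (Finset.mem_insert_self _ _)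
    refine of_const_entry (K := K) hr (by rw [hw, hd]) (by rw [hw]; exact hK) hi0 hil fun c => ?_
    refine ih (fun j hj => hs j (Finset.mem_insert_of_mem hj)) _ ?_ ?_
    · rw [Function.update_of_ne hil.symm, hw]
    · intro j hj0 hjl hjs
      by_cases hji : j = i
      · exact ⟨c, by simp [hji]⟩
      · rw [Function.update_of_ne hji]
        exact hc j hj0 hjl (by simp [hji, hjs])

/-- A row whose last entry is linear, with leading coefficient dividing a power of `x`. -/
theorem of_natDegree_eq_one [IsLocalRing R] (h2 : IsUnit (2 : R))
    (hx : x ∈ IsLocalRing.maximalIdeal R) (v : Fin (m + 3) → R[X]) (hr : C x ∣ r)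
    (hd : (v (Fin.last _)).natDegree = 1) (hlc : ∃ K : ℕ, (v (Fin.last _)).leadingCoeff ∣ x ^ K) :
    NiceRow a r v := by
  obtain ⟨K, hK⟩ := hlc
  refine of_const_entries hr hd hK fun w hw hconst => ?_
  rw [← hw] at hd hK
  clear hw v
  have hl0 : Fin.last (m + 2) ≠ 0 := by simp [Fin.ext_iff]
  have hl1 : Fin.last (m + 2) ≠ 1 := by simp [Fin.ext_iff]
  have h10 : (1 : Fin (m + 3)) ≠ 0 := zero_ne_one_fin.symm
  refine of_span_eq_top fun hone h0 => ?_
  set f := w (Fin.last _) with hf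
  obtain ⟨N, u, ρ, hρ, hρd⟩ := exists_pseudo_div hK (by omega) (w 0)
  rw [hd, Nat.lt_one_iff] at hρd
  rw [eq_C_of_natDegree_eq_zero hρd] at hρ
  set y := ρ.coeff 0
  obtain ⟨c, hc⟩ := hconst 1 h10 hl1.symm
  set 𝔰 : Ideal R := Ideal.span ((fun i => (w i).coeff 0) '' {0, 1, Fin.last _}ᶜ) with h𝔰
  have hS : Ideal.span (w '' {0, 1, Fin.last _}ᶜ) = 𝔰.map C := by
    rw [h𝔰, Ideal.map_span, Set.image_image]
    congr 1
    refine Set.image_congr fun i hi => ?_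
    simp only [Set.mem_compl_iff, Set.mem_insert_iff, Set.mem_singleton_iff, not_or] at hi
    obtain ⟨b, hb⟩ := hconst i hi.1 hi.2.2
    rw [hb, coeff_C_zero]
  have hxrad : x ∈ (Ideal.span {c} ⊔ Ideal.span {y} ⊔ 𝔰).radical := by
    refine mem_radical_of_one_mem_vanishIdeal hK (by omega) ?_
    set V := vanishIdeal x f (Ideal.span {c} ⊔ Ideal.span {y} ⊔ 𝔰)
    have hV : (Ideal.span {c} ⊔ Ideal.span {y} ⊔ 𝔰).map C ≤ V := map_le_vanishIdeal _ _ _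
    have hVf : f ∈ V := self_mem_vanishIdeal _ _ _
    rw [← Ideal.eq_top_iff_one, eq_top_iff, ← hone, Ideal.span_le]
    rintro _ ⟨i, rfl⟩
    by_cases hi0 : i = 0
    · subst hi0
      refine mem_vanishIdeal_of_C_pow_mul_mem N ?_
      rw [hρ]
      exact add_mem (V.mul_mem_right _ hVf) (hV (Ideal.mem_map_of_mem C (Ideal.mem_sup_left
        (Ideal.mem_sup_right (Ideal.mem_span_singleton_self y)))))
    by_cases hi1 : i = 1
    · subst hi1
      rw [hc]
      exact hV (Ideal.mem_map_of_mem C (Ideal.mem_sup_left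
        (Ideal.mem_sup_left (Ideal.mem_span_singleton_self c))))
    by_cases hil : i = Fin.last _
    · subst hil; exact hVf
    · refine hV (Ideal.map_mono le_sup_right ?_)
      rw [← hS]
      exact Ideal.subset_span ⟨i, by simp [hi0, hi1, hil], rfl⟩
  refine add_entry (j := Fin.last _) (x := (f - 1) * w 0) hl0
    (Ideal.mul_mem_left _ _ (Ideal.subset_span ⟨0, hl0.symm, rfl⟩)) ?_
  set F := f + (f - 1) * w 0 with hF
  set w₁ := Function.update w (Fin.last _) F with hw₁
  have hwy : C y * X ∈ Ideal.span (w₁ '' {1}ᶜ) := by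
    have hm0 : w 0 ∈ Ideal.span (w₁ '' {1}ᶜ) :=
      Ideal.subset_span ⟨0, h10.symm, by simp [hw₁, hl0.symm]⟩
    have hml : F ∈ Ideal.span (w₁ '' {1}ᶜ) := Ideal.subset_span ⟨Fin.last _, hl1, by simp [hw₁]⟩
    have h1 := sub_mem (Ideal.mul_mem_left _ (X * (C (x ^ N) + u * (f - 1))) hm0)
      (Ideal.mul_mem_left _ (X * u) hml)
    convert h1 using 1
    rw [hF]
    linear_combination (-X) * hρ
  refine add_entry (j := 1) h10 hwy ?_
  have hw1 : w₁ 1 = C c := by rw [hw₁, Function.update_of_ne hl1.symm, hc]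
  rw [hw1]
  set w₂ := Function.update w₁ 1 (C c + C y * X) with hw₂
  have hw₂1 : w₂ 1 = C c + C y * X := by simp [hw₂]
  have hw₂l : w₂ (Fin.last _) = F := by simp [hw₂, hl1, hw₁]
  have hS₂ : Ideal.span (w₂ '' {0, 1, Fin.last _}ᶜ) = 𝔰.map C := by
    rw [hw₂, image_update_compl _ (by simp), hw₁, image_update_compl _ (by simp), hS]
  obtain ⟨r₀, hr₀⟩ := hr
  have hFx : F = 1 + C x * ((f - 1) * a * r₀) := by rw [hF, h0, hr₀]; ring
  have hF0 : IsUnit (F.coeff 0) := by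
    rw [hFx, coeff_add, coeff_one_zero, coeff_C_mul, add_comm]
    by_contra hu
    have h1 := (IsLocalRing.mem_maximalIdeal _).2 hu
    have h3 := sub_mem h1 (Ideal.mul_mem_right (((f - 1) * a * r₀).coeff 0) _ hx)
    rw [add_sub_cancel_left] at h3
    exact (Ideal.ne_top_iff_one _).1 (IsLocalRing.maximalIdeal.isMaximal R).ne_top h3
  set J := Ideal.span (w₂ '' {0}ᶜ) with hJ
  have hJ1 : C c + C y * X ∈ J := hw₂1 ▸ Ideal.subset_span ⟨1, h10, rfl⟩
  have hJF : F ∈ J := hw₂l ▸ Ideal.subset_span ⟨Fin.last _, hl0, rfl⟩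
  have hJ𝔰 : 𝔰.map C ≤ J := by
    rw [← hS₂]
    exact Ideal.span_mono (Set.image_mono (by simp))
  have hmax : ∀ M : Ideal R[X], M.IsMaximal → J ≤ M → C y ∉ M := by
    intro M hM hJM hy
    have hcM : C c ∈ M := by
      have := sub_mem (hJM hJ1) (M.mul_mem_right X hy)
      rwa [add_sub_cancel_right] at this
    have hxM : C x ∈ M := by
      obtain ⟨k, hk⟩ := hxrad
      refine hM.isPrime.mem_of_pow_mem k ?_
      rw [← C_pow]
      refine (?_ : Ideal.map C _ ≤ M) (Ideal.mem_map_of_mem C hk)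
      rw [Ideal.map_sup, Ideal.map_sup, Ideal.map_span, Ideal.map_span, Set.image_singleton,
        Set.image_singleton]
      exact sup_le (sup_le ((Ideal.span_singleton_le_iff_mem _).2 hcM)
        ((Ideal.span_singleton_le_iff_mem _).2 hy)) (hJ𝔰.trans hJM)
    refine (Ideal.ne_top_iff_one _).1 hM.ne_top ?_
    have := sub_mem (hJM hJF) (M.mul_mem_right ((f - 1) * a * r₀) hxM)
    rwa [hFx, add_sub_cancel_right] at this
  refine of_linear_slot h2 hw₂1 hS₂ (by rwa [hw₂l]) (l := x) ?_ hxrad ?_ ?_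
  · intro i
    rw [hw₂l, hFx, coeff_add, coeff_one, if_neg (Nat.succ_ne_zero i), zero_add, coeff_C_mul]
    exact dvd_mul_right _ _
  · by_contra htop
    obtain ⟨M, hM, hle⟩ := Ideal.exists_le_maximal _ htop
    exact hmax M hM (le_sup_left.trans hle)
      (hle (Ideal.mem_sup_right (Ideal.mem_span_singleton_self _)))
  · by_contra htop
    obtain ⟨M, hM, hle⟩ := Ideal.exists_le_maximal _ htop
    have hJM : J ≤ M := le_sup_left.trans hle
    have hcM : C c ∈ M := hle (Ideal.mem_sup_right (Ideal.mem_span_singleton_self _))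
    have hyX := sub_mem (hJM hJ1) hcM
    rw [add_sub_cancel_left] at hyX
    rcases hM.isPrime.mem_or_mem hyX with h | h
    · exact hmax M hM hJM h
    · refine hM.ne_top (Ideal.eq_top_of_isUnit_mem M (x := C (F.coeff 0)) ?_ (isUnit_C.2 hF0))
      have := sub_mem (hJM hJF) (M.mul_mem_left F.divX h)
      rwa [sub_eq_of_eq_add' F.divX_mul_X_add.symm] at this

end NiceRow

namespace NiceRow

variable {R : Type*} [CommRing R] [IsNoetherianRing R] {m : ℕ}

theorem exists_add_notMem_minimalPrimes {a r : R[X]} {v : Fin (m + 3) → R[X]}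
    (hone : Ideal.span (Set.range v) = ⊤) (h0 : v 0 = a * r - 1) :
    ∃ l ∈ Ideal.span (v '' {0}ᶜ), ∀ P ∈ minimalPrimes R, v 0 + r * l ∉ P.map C := by
  classical
  have hfin : (minimalPrimes R).Finite := Ideal.finite_minimalPrimes_of_isNoetherianRing R ⊥
  set J := Ideal.span (v '' {0}ᶜ) with hJ
  set s := hfin.toFinset.filter fun P : Ideal R => ∃ l ∈ J, r * l ∉ P.map (C : R →+* R[X]) with hs
  have hprime : ∀ P ∈ s, P.IsPrime := fun P hP =>
    (hfin.mem_toFinset.1 (Finset.mem_filter.1 hP).1).1.1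
  obtain ⟨l, hl⟩ := exists_add_map_notMem s hprime
    ((LinearMap.mulLeft R r).comp (J.restrictScalars R).subtype) (v 0)
    (fun P => (P.map (C : R →+* R[X])).restrictScalars R) (by
      intro P hP e he z hz
      have hPm : (P.map (C : R →+* R[X])).IsPrime :=
        have := hprime P hP
        Ideal.isPrime_map_C_of_isPrime
      rw [Submodule.restrictScalars_mem, smul_eq_C_mul] at hz
      refine (hPm.mem_or_mem hz).resolve_left fun h => he ?_
      simpa using Ideal.mem_map_C_iff.1 h 0) (by
      intro P _ e he z
      rw [Submodule.restrictScalars_mem, smul_eq_C_mul]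
      exact Ideal.mul_mem_right _ _ (Ideal.mem_map_of_mem C he)) (by
      intro P hP
      obtain ⟨l, hl, hlP⟩ := (Finset.mem_filter.1 hP).2
      exact ⟨⟨l, hl⟩, hlP⟩)
  refine ⟨l, l.2, fun P hP hmem => ?_⟩
  have hPp : P.IsPrime := hP.1.1
  have hPm : (P.map (C : R →+* R[X])).IsPrime := Ideal.isPrime_map_C_of_isPrime
  by_cases hPs : P ∈ s
  · exact hl P hPs hmem
  have hall : ∀ j ∈ J, r * j ∈ P.map (C : R →+* R[X]) := by
    intro j hj
    by_contra hjP
    exact hPs (Finset.mem_filter.2 ⟨hfin.mem_toFinset.2 hP, j, hj, hjP⟩)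
  have hv0 : v 0 ∈ P.map (C : R →+* R[X]) := by
    have := sub_mem hmem (hall l l.2)
    rwa [add_sub_cancel_right] at this
  have hr : r ∉ P.map (C : R →+* R[X]) := fun hr => by
    refine (Ideal.ne_top_iff_one _).1 hPm.ne_top ?_
    have := sub_mem (Ideal.mul_mem_left _ a hr) hv0
    rwa [h0, sub_sub_cancel] at this
  refine hPm.ne_top (eq_top_iff.2 (hone ▸ Ideal.span_le.2 ?_))
  rintro _ ⟨i, rfl⟩
  by_cases hi : i = 0
  · rwa [hi]
  · exact (hPm.mem_or_mem (hall _ (Ideal.subset_span ⟨i, hi, rfl⟩))).resolve_left hr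

variable [IsLocalRing R]

theorem of_forall_notMem_minimalPrimes (hdim : ringKrullDim R ≤ (m + 2 : ℕ)) (h2 : IsUnit (2 : R))
    (hmin : IsLocalRing.maximalIdeal R ∉ minimalPrimes R) {a r : R[X]} {v : Fin (m + 3) → R[X]}
    (hq : ∀ P ∈ minimalPrimes R, v 0 ∉ P.map C) : NiceRow a r v := by
  have hl0 : Fin.last (m + 2) ≠ 0 := by simp [Fin.ext_iff]
  refine of_span_eq_top fun hone h0 => ?_
  obtain ⟨g, hqg, hg⟩ := exists_dvd_leadingCoeff_notMem hq
  obtain ⟨x, hx, hxP⟩ := exists_mem_forall_notMem_minimalPrimes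
    (J := IsLocalRing.maximalIdeal R) fun P hP hle => hmin (by
      have hPp : P.IsPrime := hP.1.1
      rwa [le_antisymm hle (IsLocalRing.le_maximalIdeal hPp.ne_top)])
  set ℓ := x * g.leadingCoeff with hℓ
  have hℓm : ℓ ∈ IsLocalRing.maximalIdeal R := Ideal.mul_mem_right _ _ hx
  have hℓP : ∀ P ∈ minimalPrimes R, ℓ ∉ P := fun P hP h =>
    (hP.1.1.mem_or_mem h).elim (hxP P hP) (hg P hP)
  obtain ⟨P₀, hP₀⟩ : ∃ P, P ∈ minimalPrimes R := by
    obtain ⟨P, hP, -⟩ := Ideal.exists_minimalPrimes_le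
      (I := (⊥ : Ideal R)) (J := IsLocalRing.maximalIdeal R) bot_le
    exact ⟨P, hP⟩
  have hP₀p : P₀.IsPrime := hP₀.1.1
  have hℓg : ℓ * g.leadingCoeff ≠ 0 := fun h =>
    (hP₀p.mem_or_mem (h ▸ zero_mem P₀)).elim (hℓP P₀ hP₀) (hg P₀ hP₀)
  set s : Finset (Fin (m + 3)) := {0}ᶜ with hs
  have hscoe : (s : Set (Fin (m + 3))) = {0}ᶜ := by simp [hs]
  obtain ⟨l, hl⟩ := exists_span_tail_sup_eq_top hdim hℓP s
    (by rw [hs, Finset.card_compl, Fintype.card_fin, Finset.card_singleton]; rfl) (v 0) v (by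
      rw [eq_top_iff, ← hone, Ideal.span_le, hscoe]
      rintro _ ⟨i, rfl⟩
      by_cases hi : i = 0
      · subst hi; exact Ideal.mem_sup_left (Ideal.mem_span_singleton_self _)
      · exact Ideal.mem_sup_right (Ideal.subset_span ⟨i, hi, rfl⟩))
  refine add_entries s (by simp [hs]) (fun i => v 0 * l i)
    (fun i _ => Ideal.mul_mem_right _ _ (Ideal.subset_span ⟨0, by simp [hs], rfl⟩)) ?_
  set v₁ : Fin (m + 3) → R[X] := fun i => if i ∈ s then v i + v 0 * l i else v i with hv₁
  have hv₁0 : v₁ 0 = v 0 := by simp [hv₁, hs]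
  have htop : Ideal.span (v₁ '' {0}ᶜ) ⊔ Ideal.span {C ℓ} = ⊤ := by
    rw [← hl, hscoe]
    congr 2
    refine Set.image_congr fun i hi => ?_
    have : i ≠ 0 := hi
    simp [hv₁, hs, this]
  set N := (v₁ (Fin.last _)).natDegree + 1 with hN
  refine add_entry (j := Fin.last _) (x := C ℓ * (g * X ^ N)) hl0 ?_ ?_
  · obtain ⟨k, rfl⟩ := hqg
    have : v 0 ∈ Ideal.span (v₁ '' {Fin.last _}ᶜ) := Ideal.subset_span ⟨0, hl0.symm, hv₁0⟩
    convert Ideal.mul_mem_left _ (C ℓ * (k * X ^ N)) this using 1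
    ring
  set f := v₁ (Fin.last _) + C ℓ * (g * X ^ N) with hf
  set v₂ := Function.update v₁ (Fin.last _) f with hv₂
  have hv₂l : v₂ (Fin.last _) = f := by simp [hv₂]
  have hfc : f.coeff (g.natDegree + N) = ℓ * g.leadingCoeff := by
    rw [hf, coeff_add, coeff_C_mul, coeff_mul_X_pow, coeff_natDegree,
      coeff_eq_zero_of_natDegree_lt (by omega), zero_add]
  have hfd : f.natDegree = g.natDegree + N := by
    refine le_antisymm ((natDegree_add_le _ _).trans (max_le (by omega)
      ((natDegree_C_mul_le _ _).trans (natDegree_mul_le.trans ?_))))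
      (le_natDegree_of_ne_zero (by rwa [hfc]))
    exact Nat.add_le_add_left (natDegree_X_pow_le _) _
  have htop₂ : Ideal.span (v₂ '' {0}ᶜ) ⊔ Ideal.span {C ℓ} = ⊤ := by
    rw [eq_top_iff, ← htop]
    refine sup_le (Ideal.span_le.2 ?_) le_sup_right
    rintro _ ⟨i, hi, rfl⟩
    by_cases hil : i = Fin.last _
    · subst hil
      have hfm : f ∈ Ideal.span (v₂ '' {0}ᶜ) := Ideal.subset_span ⟨Fin.last _, hi, hv₂l⟩
      have h1 := sub_mem (Ideal.mem_sup_left hfm)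
        (Ideal.mem_sup_right (S := Ideal.span (v₂ '' {0}ᶜ))
        (Ideal.mul_mem_right (g * X ^ N) _ (Ideal.mem_span_singleton_self (C ℓ))))
      rwa [hf, add_sub_cancel_right] at h1
    · exact Ideal.mem_sup_left (Ideal.subset_span ⟨i, hi, by simp [hv₂, hil]⟩)
  obtain ⟨j, hj, t, ht, hjt⟩ := Submodule.mem_sup.1 ((Ideal.eq_top_iff_one _).1 htop₂)
  obtain ⟨μ, rfl⟩ := Ideal.mem_span_singleton.1 ht
  refine add_right (l := -r * j) (Ideal.mul_mem_left _ _ hj) ?_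
  refine of_natDegree_one hdim hℓm (fun ⟨n, hn⟩ =>
    hℓP P₀ hP₀ (hP₀p.mem_of_pow_mem n (hn ▸ zero_mem P₀)))
    (fun a r v hr hd hlc => of_natDegree_eq_one h2 hℓm v hr hd hlc) _ _ _ ?_ ?_ ?_
  · exact ⟨r * μ, by linear_combination -r * hjt⟩
  · rw [Function.update_of_ne hl0, hv₂l, hfd]; omega
  · rw [Function.update_of_ne hl0, hv₂l, leadingCoeff, hfd, hfc]
    exact ⟨2, x, by rw [hℓ]; ring⟩

/-- Over a polynomial ring over a noetherian local ring of dimension at most `m + 2` and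
positive dimension, all rows of length `m + 3` are nice. -/
theorem of_isLocalRing (hdim : ringKrullDim R ≤ (m + 2 : ℕ)) (h2 : IsUnit (2 : R))
    (hmin : IsLocalRing.maximalIdeal R ∉ minimalPrimes R) (a r : R[X]) (v : Fin (m + 3) → R[X]) :
    NiceRow a r v := by
  refine of_span_eq_top fun hone h0 => ?_
  obtain ⟨l, hl, hlP⟩ := exists_add_notMem_minimalPrimes hone h0
  exact add_left hl (of_forall_notMem_minimalPrimes hdim h2 hmin (by simpa using hlP))

end NiceRow

section ElementaryMatrices

variable {A : Type*} [CommRing A]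

/-- The elementary matrix `E_{ij}(c)` as an invertible matrix. -/
def transvectionGL {ι : Type*} [Fintype ι] [DecidableEq ι] (i j : ι) (hij : i ≠ j) (c : A) :
    GL ι A where
  val := transvection i j c
  inv := transvection i j (-c)
  val_inv := by rw [transvection_mul_transvection_same i j hij]; simp
  inv_val := by rw [transvection_mul_transvection_same i j hij]; simp

section

variable {ι : Type*} [Fintype ι] [DecidableEq ι] {i j k : ι}

theorem transvectionGL_inv (hij : i ≠ j) (c : A) :
    (transvectionGL i j hij c)⁻¹ = transvectionGL i j hij (-c) := by
  ext1; rfl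

theorem transvectionGL_mul (hij : i ≠ j) (c d : A) :
    transvectionGL i j hij c * transvectionGL i j hij d = transvectionGL i j hij (c + d) := by
  ext1; exact transvection_mul_transvection_same i j hij c d

theorem transvectionGL_commutator (hij : i ≠ j) (hik : i ≠ k) (hkj : k ≠ j) (x y : A) :
    transvectionGL i k hik x * transvectionGL k j hkj y * (transvectionGL i k hik x)⁻¹ *
      (transvectionGL k j hkj y)⁻¹ = transvectionGL i j hij (x * y) := by
  rw [mul_inv_eq_iff_eq_mul, mul_inv_eq_iff_eq_mul]
  apply Units.ext
  simp [transvectionGL, transvection, mul_add, add_mul, hij.symm, hkj.symm]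
  abel

theorem vecMul_transvectionGL (v : ι → A) (hij : i ≠ j) (c : A) :
    v ᵥ* (transvectionGL i j hij c : Matrix ι ι A) =
      Function.update v j (v j + c * v i) := by
  ext l
  simp only [transvectionGL, transvection, Matrix.vecMul_add, Matrix.vecMul_one, Pi.add_apply]
  by_cases hl : l = j
  · subst hl
    simp [Matrix.vecMul, dotProduct, Matrix.single_apply, mul_comm]
  · simp [Matrix.vecMul, dotProduct, hl, Ne.symm hl]

theorem vecMul_mul_inv_eq {u v : ι → A} {g : GL ι A} (h : u ᵥ* (g : Matrix ι ι A) = v) :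
    v ᵥ* ((g⁻¹ : GL ι A) : Matrix ι ι A) = u := by
  rw [← h, Matrix.vecMul_vecMul, ← Units.val_mul, mul_inv_cancel]
  simp

theorem map_transvectionGL {S : Type*} [CommRing S] (f : S →+* A) (hij : i ≠ j) (c : S) :
    Matrix.GeneralLinearGroup.map f (transvectionGL i j hij c) = transvectionGL i j hij (f c) := by
  apply Units.ext
  ext a b
  simp [transvectionGL, transvection, Matrix.single_apply, Matrix.one_apply, apply_ite f]

end

variable {n : ℕ}

theorem transvectionGL_mem_Elem {i j : Fin n} (hij : i ≠ j) (c : A) :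
    transvectionGL i j hij c ∈ Elem n A :=
  Subgroup.subset_closure ⟨i, j, hij, c, rfl⟩

theorem Elem_induction {P : ∀ g : GL (Fin n) A, g ∈ Elem n A → Prop}
    (one : P 1 (one_mem _))
    (mul : ∀ (i j : Fin n) (hij : i ≠ j) (c : A) (g : GL (Fin n) A) (hg : g ∈ Elem n A), P g hg →
      P (transvectionGL i j hij c * g) (mul_mem (transvectionGL_mem_Elem hij c) hg))
    {g : GL (Fin n) A} (hg : g ∈ Elem n A) : P g hg := by
  induction hg using Subgroup.closure_induction_left with
  | one => exact one
  | mul_left x hx y hy ih =>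
    obtain ⟨i, j, hij, c, h⟩ := hx
    obtain rfl : x = transvectionGL i j hij c := Units.ext h
    exact mul i j hij c y hy ih
  | inv_mul_cancel x hx y hy ih =>
    obtain ⟨i, j, hij, c, h⟩ := hx
    obtain rfl : x = transvectionGL i j hij c := Units.ext h
    simp only [transvectionGL_inv]
    exact mul i j hij (-c) y hy ih

theorem RowEquiv.exists_mem_Elem {v w : Fin n → A} (h : RowEquiv v w) :
    ∃ ε ∈ Elem n A, v ᵥ* (ε : Matrix (Fin n) (Fin n) A) = w := by
  induction h with
  | refl => exact ⟨1, one_mem _, by simp⟩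
  | step i j hij c _ ih =>
    obtain ⟨ε, hε, h⟩ := ih
    refine ⟨ε * transvectionGL i j hij c, mul_mem hε (transvectionGL_mem_Elem hij c), ?_⟩
    rw [Units.val_mul, ← Matrix.vecMul_vecMul, h, vecMul_transvectionGL]

theorem conj_mem_ElemRel {I : Ideal A} {e g : GL (Fin n) A} (he : e ∈ Elem n A)
    (hg : g ∈ ElemRel n A I) : e * g * e⁻¹ ∈ ElemRel n A I := by
  induction hg using Subgroup.closure_induction with
  | mem x hx =>
    obtain ⟨e', he', h, i, j, hi, hj, hx, rfl⟩ := hx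
    exact Subgroup.subset_closure ⟨e * e', mul_mem he he', h, i, j, hi, hj, hx, by group⟩
  | one => simp
  | mul x y _ _ hx hy => simpa [mul_assoc] using mul_mem hx hy
  | inv x _ hx => simpa [mul_assoc] using inv_mem hx

theorem transvectionGL_mem_ElemRel {m : ℕ} {I : Ideal A} {i j : Fin (m + 3)} (hij : i ≠ j) {x : A}
    (hx : x ∈ I) : transvectionGL i j hij x ∈ ElemRel (m + 3) A I := by
  have right {i k j : Fin (m + 3)} (hik : i ≠ k) (hij : i ≠ j) (hkj : k ≠ j)
      (h : ∀ x ∈ I, transvectionGL i k hik x ∈ ElemRel (m + 3) A I) :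
      ∀ x ∈ I, transvectionGL i j hij x ∈ ElemRel (m + 3) A I := by
    intro x hx
    rw [← mul_one x, ← transvectionGL_commutator hij hik hkj, mul_assoc, mul_assoc]
    refine mul_mem (h x hx) ?_
    rw [← mul_assoc]
    exact conj_mem_ElemRel (transvectionGL_mem_Elem hkj 1) (inv_mem (h x hx))
  have left {i k j : Fin (m + 3)} (hkj : k ≠ j) (hij : i ≠ j) (hik : i ≠ k)
      (h : ∀ x ∈ I, transvectionGL k j hkj x ∈ ElemRel (m + 3) A I) :
      ∀ x ∈ I, transvectionGL i j hij x ∈ ElemRel (m + 3) A I := by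
    intro x hx
    rw [← one_mul x, ← transvectionGL_commutator hij hik hkj]
    exact mul_mem (conj_mem_ElemRel (transvectionGL_mem_Elem hik 1) (h x hx)) (inv_mem (h x hx))
  have h10 : ∀ x ∈ I, transvectionGL (1 : Fin (m + 3)) 0 (by simp) x ∈ ElemRel (m + 3) A I := by
    intro x hx
    exact Subgroup.subset_closure
      ⟨1, one_mem _, transvectionGL 1 0 (by simp) x, 1, 0, by simp, by simp, ⟨x, hx, rfl⟩, by simp⟩
  have h1 : ∀ j (hj : (1 : Fin (m + 3)) ≠ j), ∀ x ∈ I,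
      transvectionGL 1 j hj x ∈ ElemRel (m + 3) A I := by
    intro j hj
    rcases eq_or_ne j 0 with rfl | hj0
    · exact h10
    · exact right (by simp) hj hj0.symm h10
  have hne : ∀ i j (hij : i ≠ j) (_ : j ≠ 1), ∀ x ∈ I,
      transvectionGL i j hij x ∈ ElemRel (m + 3) A I := by
    intro i j hij hj
    rcases eq_or_ne i 1 with rfl | hi
    · exact h1 j hij
    · exact left hj.symm hij hi (h1 j hj.symm)
  rcases eq_or_ne j 1 with rfl | hj
  · obtain ⟨k, hki, hk1⟩ := fin_exists_ne_ne i 1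
    exact right hki.symm hij hk1 (hne i k hki.symm hk1) x hx
  · exact hne i j hij hj x hx

/-- The difference of the images of an elementary matrix under two ring homomorphisms that agree
modulo an ideal is a relative elementary matrix. -/
theorem map_mul_map_inv_mem_ElemRel {m : ℕ} {S : Type*} [CommRing S] {I : Ideal A} (f g : S →+* A)
    (hfg : ∀ s, g s - f s ∈ I) {ε : GL (Fin (m + 3)) S} (hε : ε ∈ Elem (m + 3) S) :
    Matrix.GeneralLinearGroup.map f ε ∈ Elem (m + 3) A ∧
      Matrix.GeneralLinearGroup.map g ε * (Matrix.GeneralLinearGroup.map f ε)⁻¹ ∈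
        ElemRel (m + 3) A I := by
  induction hε using Elem_induction with
  | one => simp [one_mem]
  | mul i j hij c ε _ ih =>
    have hf := transvectionGL_mem_Elem hij (f c)
    simp only [map_mul, map_transvectionGL]
    refine ⟨mul_mem hf ih.1, ?_⟩
    have h := mul_mem (transvectionGL_mem_ElemRel hij (hfg c)) (conj_mem_ElemRel hf ih.2)
    convert h using 1
    have : transvectionGL i j hij (g c - f c) * transvectionGL i j hij (f c) =
        transvectionGL i j hij (g c) := by rw [transvectionGL_mul, sub_add_cancel]
    rw [← this]
    group

end ElementaryMatrices

section RelativeEquivalence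

variable {A : Type*} [CommRing A] {n : ℕ} {I : Ideal A}

/-- Two rows are equivalent relative to `I` if they are in the same orbit of the relative
elementary group. -/
def RelEquiv (I : Ideal A) (u w : Fin n → A) : Prop :=
  ∃ ε ∈ ElemRel n A I, u ᵥ* (ε : Matrix (Fin n) (Fin n) A) = w

namespace RelEquiv

variable {u v w : Fin n → A}

theorem refl (u : Fin n → A) : RelEquiv I u u := ⟨1, one_mem _, by simp⟩

theorem trans (h₁ : RelEquiv I u v) (h₂ : RelEquiv I v w) : RelEquiv I u w := by
  obtain ⟨ε, hε, rfl⟩ := h₁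
  obtain ⟨δ, hδ, rfl⟩ := h₂
  exact ⟨ε * δ, mul_mem hε hδ, by rw [Units.val_mul, Matrix.vecMul_vecMul]⟩

theorem vecMul (h : RelEquiv I u w) {e : GL (Fin n) A} (he : e ∈ Elem n A) :
    RelEquiv I (u ᵥ* (e : Matrix (Fin n) (Fin n) A)) (w ᵥ* (e : Matrix (Fin n) (Fin n) A)) := by
  obtain ⟨ε, hε, rfl⟩ := h
  refine ⟨e⁻¹ * ε * e, by simpa using conj_mem_ElemRel (inv_mem he) hε, ?_⟩
  rw [Matrix.vecMul_vecMul, Matrix.vecMul_vecMul, ← Units.val_mul, ← Units.val_mul]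
  congr 2
  group

theorem of_vecMul {e : GL (Fin n) A} (he : e ∈ Elem n A)
    (h : RelEquiv I (u ᵥ* (e : Matrix (Fin n) (Fin n) A))
      (w ᵥ* (e : Matrix (Fin n) (Fin n) A))) : RelEquiv I u w := by
  have := h.vecMul (inv_mem he)
  rwa [vecMul_mul_inv_eq rfl, vecMul_mul_inv_eq rfl] at this

variable {m : ℕ}

theorem single (u : Fin (m + 3) → A) {i j : Fin (m + 3)} (hij : i ≠ j) {x : A} (hx : x ∈ I) :
    RelEquiv I u (Function.update u j (u j + x * u i)) :=
  ⟨_, transvectionGL_mem_ElemRel hij hx, vecMul_transvectionGL u hij x⟩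

theorem update_add_mul_of_ne_zero (u : Fin (m + 3) → A) (h0 : u 0 - 1 ∈ I) {i j : Fin (m + 3)}
    (hij : i ≠ j) (hj : j ≠ 0) (hui : u i ∈ I) (c : A) :
    RelEquiv I u (Function.update u j (u j + c * u i)) := by
  refine (single u hj.symm (I.mul_mem_left c hui)).trans ?_
  convert single (Function.update u j (u j + c * u i * u 0)) hij
    (neg_mem (I.mul_mem_left c h0)) using 1
  ext l
  by_cases hl : l = j
  · subst hl
    simp only [Function.update_self, Function.update_of_ne hij]
    ring
  · simp [hl]

theorem update_zero_add_mul (u : Fin (m + 3) → A) (h0 : u 0 - 1 ∈ I)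
    (hu : ∀ i, i ≠ 0 → u i ∈ I) {i : Fin (m + 3)} (hi : i ≠ 0) (c : A) :
    RelEquiv I u (Function.update u 0 (u 0 + c * u i)) := by
  obtain ⟨j, hj0, hji⟩ := fin_exists_ne_ne 0 i
  have hu' : ∀ x : A, x - 1 ∈ I → ∀ y ∈ I,
      (Function.update (Function.update u 0 x) j y) ᵥ*
        (transvectionGL j 0 hj0 (1 : A) : Matrix (Fin (m + 3)) (Fin (m + 3)) A) =
      Function.update (Function.update u 0 (x + y)) j y := by
    intro x _ y _
    rw [vecMul_transvectionGL]
    ext l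
    by_cases hl : l = 0
    · subst hl; simp [hj0.symm]
    · by_cases hlj : l = j
      · subst hlj; simp [hl]
      · simp [hl, hlj]
  have h₁ := update_add_mul_of_ne_zero u h0 hji.symm hj0 (hu i hi) c
  refine h₁.trans (of_vecMul (transvectionGL_mem_Elem hj0 1) ?_)
  have e₁ : Function.update u j (u j + c * u i) =
      Function.update (Function.update u 0 (u 0)) j (u j + c * u i) := by simp
  have e₂ : Function.update u 0 (u 0 + c * u i) =
      Function.update (Function.update u 0 (u 0 + c * u i)) j (u j) := by
    rw [Function.update_comm hj0.symm]; simp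
  have hci := I.mul_mem_left c (hu i hi)
  have h0' : u 0 + c * u i - 1 ∈ I := by
    rw [add_sub_right_comm]; exact add_mem h0 hci
  rw [e₁, e₂, hu' _ h0 _ (add_mem (hu j hj0) hci), hu' _ h0' _ (hu j hj0)]
  convert update_add_mul_of_ne_zero
    (Function.update (Function.update u 0 (u 0 + (u j + c * u i))) j (u j + c * u i))
    ?_ hji.symm hj0 ?_ (-c) using 1
  · ext l
    by_cases hlj : l = j
    · subst hlj; simp [hi, hji.symm]
    · simp [hlj]
      congr 1
      ring
  · simpa [hj0.symm, add_sub_right_comm] using add_mem h0 (add_mem (hu j hj0) hci)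
  · simpa [hji.symm, hi] using hu i hi

theorem update_zero_add (u : Fin (m + 3) → A) (hu : ∀ i, i ≠ 0 → u i ∈ I) {x : A}
    (hx : x ∈ Ideal.span (u '' {i | i ≠ 0})) {y : A} (hy : y - 1 ∈ I) :
    RelEquiv I (Function.update u 0 y) (Function.update u 0 (y + x)) := by
  suffices H : ∀ c y, y - 1 ∈ I →
      RelEquiv I (Function.update u 0 y) (Function.update u 0 (y + c * x)) by
    simpa using H 1 y hy
  have hle : Ideal.span (u '' {i | i ≠ 0}) ≤ I := by
    rw [Ideal.span_le]
    rintro _ ⟨i, hi, rfl⟩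
    exact hu i hi
  induction hx using Submodule.span_induction with
  | mem x hx =>
    obtain ⟨i, hi, rfl⟩ := hx
    intro c y hy
    have hi' : i ≠ 0 := hi
    simpa [hi'] using update_zero_add_mul (Function.update u 0 y) (by simpa using hy)
      (fun i hi => by simpa [hi] using hu i hi) hi' c
  | zero => intro c y _; simpa using refl _
  | add a b ha' _ ha hb =>
    intro c y hy
    rw [mul_add, ← add_assoc]
    refine (ha c y hy).trans (hb c _ ?_)
    rw [add_sub_right_comm]
    exact add_mem hy (I.mul_mem_left c (hle ha'))
  | smul a x _ hx =>
    intro c y hy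
    simpa [mul_assoc] using hx (c * a) y hy

end RelEquiv

end RelativeEquivalence

theorem ringKrullDim_le_of_isIntegral (R S : Type*) [CommRing R] [CommRing S] [Algebra R S]
    [Algebra.IsIntegral R S] : ringKrullDim S ≤ ringKrullDim R :=
  Order.krullDim_le_of_strictMono (PrimeSpectrum.comap (algebraMap R S)) fun _ _ h =>
    Ideal.IsIntegral.comap_lt_comap h

/-- An ideal that becomes the unit ideal under two surjections with jointly trivial kernel is the
unit ideal. -/
theorem Ideal.eq_top_of_map_eq_top {S A B : Type*} [CommRing S] [CommRing A] [CommRing B]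
    {f : S →+* A} {g : S →+* B} (hf : Function.Surjective f) (hg : Function.Surjective g)
    (hfg : ∀ s, f s = 0 → g s = 0 → s = 0) {J : Ideal S} (hJf : J.map f = ⊤) (hJg : J.map g = ⊤) :
    J = ⊤ := by
  obtain ⟨x, hx, hx1⟩ := (Ideal.mem_map_iff_of_surjective _ hf).1 (hJf ▸ Submodule.mem_top (x := 1))
  obtain ⟨y, hy, hy1⟩ := (Ideal.mem_map_iff_of_surjective _ hg).1 (hJg ▸ Submodule.mem_top (x := 1))
  have h0 : (1 - x) * (1 - y) = 0 := by
    apply hfg <;> simp [hx1, hy1]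
  rw [Ideal.eq_top_iff_one]
  have : 1 = (1 - y) * x + y := by linear_combination h0
  rw [this]
  exact add_mem (J.mul_mem_left _ hx) hy

section IdealDouble

variable {R : Type*} [CommRing R] (I : Ideal R)

/-- The double of a ring along an ideal: pairs of elements that are congruent modulo the ideal. -/
def idealDouble : Subalgebra R (R × R) :=
  AlgHom.equalizer ((Ideal.Quotient.mkₐ R I).comp (AlgHom.fst R R R))
    ((Ideal.Quotient.mkₐ R I).comp (AlgHom.snd R R R))

variable {I}

theorem mem_idealDouble {x : R × R} : x ∈ idealDouble I ↔ x.1 - x.2 ∈ I := by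
  simp [idealDouble, AlgHom.mem_equalizer, Ideal.Quotient.mk_eq_mk_iff_sub_mem]

variable (I)

/-- The first projection of the double. -/
def idealDoubleFst : idealDouble I →+* R := (RingHom.fst R R).comp (idealDouble I).val.toRingHom

/-- The second projection of the double. -/
def idealDoubleSnd : idealDouble I →+* R := (RingHom.snd R R).comp (idealDouble I).val.toRingHom

variable {I}

@[simp]
theorem idealDoubleFst_apply (x : idealDouble I) : idealDoubleFst I x = x.1.1 := rfl

@[simp]
theorem idealDoubleSnd_apply (x : idealDouble I) : idealDoubleSnd I x = x.1.2 := rfl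

theorem idealDoubleFst_surjective : Function.Surjective (idealDoubleFst I) := fun x =>
  ⟨⟨(x, x), mem_idealDouble.2 (by simp)⟩, rfl⟩

theorem idealDoubleSnd_surjective : Function.Surjective (idealDoubleSnd I) := fun x =>
  ⟨⟨(x, x), mem_idealDouble.2 (by simp)⟩, rfl⟩

instance [IsNoetherianRing R] : Module.Finite R (idealDouble I) :=
  Module.Finite.of_injective (idealDouble I).val.toLinearMap Subtype.val_injective

instance [IsNoetherianRing R] : IsNoetherianRing (idealDouble I) :=
  IsNoetherianRing.of_finite R _

theorem ringKrullDim_idealDouble_le [IsNoetherianRing R] :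
    ringKrullDim (idealDouble I) ≤ ringKrullDim R :=
  ringKrullDim_le_of_isIntegral R (idealDouble I)

variable [IsLocalRing R]

theorem isLocalHom_idealDoubleFst (hI : I ≠ ⊤) : IsLocalHom (idealDoubleFst I) := by
  refine ⟨fun x hx => ?_⟩
  have hx2 : IsUnit x.1.2 := by
    by_contra h
    have h₁ := add_mem (IsLocalRing.le_maximalIdeal hI (mem_idealDouble.1 x.2))
      ((IsLocalRing.mem_maximalIdeal _).2 h)
    rw [sub_add_cancel] at h₁
    exact (IsLocalRing.mem_maximalIdeal _).1 h₁ hx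
  obtain ⟨s, hs⟩ := hx.exists_right_inv
  obtain ⟨t, ht⟩ := hx2.exists_right_inv
  have hst : s - t ∈ I := by
    have : s - t = -(s * t) * (x.1.1 - x.1.2) := by
      rw [idealDoubleFst_apply] at hs
      linear_combination (-s) * ht + t * hs
    rw [this]
    exact I.mul_mem_left _ (mem_idealDouble.1 x.2)
  refine IsUnit.of_mul_eq_one ⟨(s, t), mem_idealDouble.2 hst⟩ ?_
  ext
  · exact hs
  · exact ht

theorem isLocalRing_idealDouble (hI : I ≠ ⊤) : IsLocalRing (idealDouble I) :=
  have := isLocalHom_idealDoubleFst hI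
  RingHom.domain_isLocalRing (idealDoubleFst I)

theorem maximalIdeal_idealDouble_notMem_minimalPrimes [IsLocalRing (idealDouble I)]
    (h : IsLocalRing.maximalIdeal R ∉ minimalPrimes R) :
    IsLocalRing.maximalIdeal (idealDouble I) ∉ minimalPrimes (idealDouble I) := by
  intro hmin
  obtain ⟨P, hP, hle⟩ := Ideal.exists_minimalPrimes_le
    (bot_le : (⊥ : Ideal R) ≤ IsLocalRing.maximalIdeal R)
  have hPprime : P.IsPrime := hP.1.1
  have hPne : P ≠ IsLocalRing.maximalIdeal R := fun h' => h (h' ▸ hP)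
  obtain ⟨x, hx, hxP⟩ := SetLike.exists_of_lt (lt_of_le_of_ne hle hPne)
  have h₁ : IsLocalRing.maximalIdeal (idealDouble I) ≤ P.comap (idealDoubleFst I) :=
    hmin.2 ⟨inferInstance, bot_le⟩ (IsLocalRing.le_maximalIdeal Ideal.IsPrime.ne_top')
  have h₂ : (⟨(x, x), mem_idealDouble.2 (by simp)⟩ : idealDouble I) ∈
      IsLocalRing.maximalIdeal (idealDouble I) := by
    rw [IsLocalRing.mem_maximalIdeal]
    exact fun hu => (IsLocalRing.mem_maximalIdeal _).1 hx (hu.map (idealDoubleFst I))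
  exact hxP (h₁ h₂)

end IdealDouble

theorem maximalIdeal_notMem_minimalPrimes {R : Type*} [CommRing R] [IsNoetherianRing R]
    [IsLocalRing R] (h : 0 < ringKrullDim R) :
    IsLocalRing.maximalIdeal R ∉ minimalPrimes R := by
  rw [← Ideal.height_eq_zero_iff]
  intro h0
  rw [← IsLocalRing.maximalIdeal_height_eq_ringKrullDim, h0] at h
  simp at h

theorem idealDoubleSnd_sub_fst_mem {R : Type*} [CommRing R] {I : Ideal R} (x : idealDouble I) :
    idealDoubleSnd I x - idealDoubleFst I x ∈ I := by
  rw [← neg_mem_iff]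
  simpa using mem_idealDouble.1 x.2

section Polynomial

variable {D R : Type*} [CommRing D] [CommRing R] {I : Ideal R} {f g : D →+* R}

theorem mapRingHom_sub_mem (hfg : ∀ s, g s - f s ∈ I) (s : D[X]) :
    mapRingHom g s - mapRingHom f s ∈ I.map (C : R →+* R[X]) := by
  rw [Ideal.mem_map_C_iff]
  intro k
  simpa using hfg (s.coeff k)

theorem exists_mapRingHom_eq (hlift : ∀ x y, x - y ∈ I → ∃ s, f s = x ∧ g s = y) {x y : R[X]}
    (h : x - y ∈ I.map (C : R →+* R[X])) : ∃ s : D[X], mapRingHom f s = x ∧ mapRingHom g s = y := by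
  rw [Ideal.mem_map_C_iff] at h
  simp only [coeff_sub] at h
  choose d hd₁ hd₂ using fun k => hlift _ _ (h k)
  refine ⟨∑ k ∈ Finset.range (max x.natDegree y.natDegree + 1), monomial k (d k), ?_, ?_⟩
  · rw [map_sum]
    simp only [coe_mapRingHom, map_monomial, hd₁]
    exact (as_sum_range' x _ (by omega)).symm
  · rw [map_sum]
    simp only [coe_mapRingHom, map_monomial, hd₂]
    exact (as_sum_range' y _ (by omega)).symm

theorem eq_zero_of_mapRingHom_eq_zero (hinj : ∀ s, f s = 0 → g s = 0 → s = 0) (s : D[X])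
    (h₁ : mapRingHom f s = 0) (h₂ : mapRingHom g s = 0) : s = 0 := by
  ext k
  refine hinj _ ?_ ?_
  · simpa using congrArg (fun q => coeff q k) h₁
  · simpa using congrArg (fun q => coeff q k) h₂

end Polynomial

theorem RingHom.comp_vecMul_GL {S A ι : Type*} [Fintype ι] [DecidableEq ι] [CommRing S] [CommRing A]
    (f : S →+* A) (v : ι → S) (ε : GL ι S) :
    f ∘ (v ᵥ* (ε : Matrix ι ι S)) =
      (f ∘ v) ᵥ* (Matrix.GeneralLinearGroup.map f ε : Matrix ι ι A) := by
  ext i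
  exact RingHom.map_vecMul f _ v i

/-- An equivalence of rows over a ring with two projections `f`, `g` that are congruent modulo `I`
yields a relative equivalence if it projects to a loop under `f`. -/
theorem RowEquiv.relEquiv {S A : Type*} [CommRing S] [CommRing A] {m : ℕ} {I : Ideal A}
    {f g : S →+* A} (hfg : ∀ s, g s - f s ∈ I) {x y : Fin (m + 3) → S} (h : RowEquiv x y)
    (hf : f ∘ x = f ∘ y) (hy : f ∘ y = g ∘ y) : RelEquiv I (g ∘ x) (g ∘ y) := by
  obtain ⟨ε, hε, rfl⟩ := h.exists_mem_Elem
  refine ⟨_, (map_mul_map_inv_mem_ElemRel f g hfg hε).2, ?_⟩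
  rw [Units.val_mul, ← Matrix.vecMul_vecMul, ← RingHom.comp_vecMul_GL, ← hy]
  apply vecMul_mul_inv_eq
  rw [← hf, ← RingHom.comp_vecMul_GL, ← hf]

theorem RelEquiv.of_niceRow {S A : Type*} [CommRing S] [CommRing A] {m : ℕ} {I : Ideal A}
    {f g : S →+* A} (hf : Function.Surjective f) (hg : Function.Surjective g)
    (hinj : ∀ s, f s = 0 → g s = 0 → s = 0) (hfg : ∀ s, g s - f s ∈ I)
    (hlift : ∀ x y, x - y ∈ I → ∃ s, f s = x ∧ g s = y)
    (hnice : ∀ (a r : S) (v : Fin (m + 3) → S), NiceRow a r v)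
    {a r : A} (ha : a - 1 ∈ I) {u : Fin (m + 3) → A}
    (hu : Ideal.span (Set.range u) = ⊤) (hu0 : u 0 = a * r - 1) (hu1 : u 1 ∈ I) :
    RelEquiv I (Function.update u 1 (r * u 1)) u := by
  have h01 : (0 : Fin (m + 3)) ≠ 1 := zero_ne_one_fin
  have hinj' : ∀ s t, f s = f t → g s = g t → s = t := fun s t h₁ h₂ =>
    sub_eq_zero.1 (hinj _ (by simp [h₁]) (by simp [h₂]))
  obtain ⟨α, hα₁, hα₂⟩ := hlift 1 a (by simpa using neg_mem ha)
  obtain ⟨ρ, hρ₁, hρ₂⟩ := hlift (a * r) r (by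
    have : a * r - r = r * (a - 1) := by ring
    rw [this]
    exact I.mul_mem_left _ ha)
  choose d hd₁ hd₂ using fun i => hlift (u i) (u i) (by simp)
  obtain ⟨e, he₁, he₂⟩ := hlift (u 1) (r * u 1) (by
    have : u 1 - r * u 1 = (1 - r) * u 1 := by ring
    rw [this]
    exact I.mul_mem_left _ hu1)
  obtain ⟨z, hz₁, hz₂⟩ := hlift 0 (u 1) (by simpa using hu1)
  have hfd : f ∘ d = u := funext hd₁
  have hgd : g ∘ d = u := funext hd₂
  set x := Function.update d 1 e with hx
  have hfx : f ∘ x = u := by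
    rw [hx, Function.comp_update, hfd, he₁, Function.update_eq_self]
  have hgx : g ∘ x = Function.update u 1 (r * u 1) := by
    rw [hx, Function.comp_update, hgd, he₂]
  have hd0 : d 0 = ρ * α - 1 := by
    apply hinj'
    · simp [hd₁, hα₁, hρ₁, hu0]
    · simp [hd₂, hα₂, hρ₂, hu0, mul_comm]
  have hx0 : x 0 = d 0 := by simp [hx, h01]
  have hspan : ∀ φ : S →+* A, (Ideal.span (Set.range x)).map φ =
      Ideal.span (Set.range (φ ∘ x)) := by
    intro φ
    rw [Ideal.map_span, Set.range_comp]
  have hrow : Ideal.span (Set.range x) = ⊤ := by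
    refine Ideal.eq_top_of_map_eq_top hf hg hinj ?_ ?_
    · rw [hspan, hfx, hu]
    · rw [hspan, hgx, eq_top_iff, ← hu, Ideal.span_le]
      set J := Ideal.span (Set.range (Function.update u 1 (r * u 1)))
      have hJ : ∀ i, Function.update u 1 (r * u 1) i ∈ J := fun i =>
        Ideal.subset_span (Set.mem_range_self i)
      rintro _ ⟨i, rfl⟩
      by_cases hi : i = 1
      · subst hi
        have h₀ := hJ 0
        have h₁ := hJ 1
        simp only [Function.update_of_ne h01, Function.update_self] at h₀ h₁
        have : u 1 = a * (r * u 1) - u 1 * u 0 := by rw [hu0]; ring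
        rw [this]
        exact sub_mem (J.mul_mem_left _ h₁) (J.mul_mem_left _ h₀)
      · simpa [hi] using hJ i
  have h₁ := (hnice ρ α x hrow (hx0.trans hd0)).symm
  have h₂ : RowEquiv (Function.update x 1 (α * x 1)) d := by
    refine RowEquiv.of_sub_mem 1 (fun i hi => by simp [hx, hi]) ?_
    have : d 1 - Function.update x 1 (α * x 1) 1 =
        -z * Function.update x 1 (α * x 1) 0 := by
      rw [Function.update_self, Function.update_of_ne h01, hx0, hd0, hx, Function.update_self]
      apply hinj'
      · simp [hd₁, he₁, hα₁, hz₁]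
      · simp [hd₂, he₂, hα₂, hz₂, hρ₂]; ring
    rw [this]
    exact Ideal.mul_mem_left _ _ (Ideal.subset_span ⟨0, h01, rfl⟩)
  have := (h₁.trans h₂).relEquiv hfg (hfx.trans hfd.symm) (hfd.trans hgd.symm)
  rwa [hgx, hgd] at this

theorem span_range_eq_top_of_mem_Um {n : ℕ} {A : Type*} [CommRing A] {v : Fin n → A}
    (hv : v ∈ Um n A) : Ideal.span (Set.range v) = ⊤ := by
  obtain ⟨w, hw⟩ := hv
  rw [Ideal.eq_top_iff_one, ← hw]
  exact sum_mem fun i _ => Ideal.mul_mem_right _ _ (Ideal.subset_span ⟨i, rfl⟩)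

theorem RelEquiv.of_niceRow_polynomial {D R : Type*} [CommRing D] [CommRing R] {m : ℕ} {I : Ideal R}
    {f g : D →+* R} (hf : Function.Surjective f) (hg : Function.Surjective g)
    (hinj : ∀ s, f s = 0 → g s = 0 → s = 0) (hfg : ∀ s, g s - f s ∈ I)
    (hlift : ∀ x y, x - y ∈ I → ∃ s, f s = x ∧ g s = y)
    (hnice : ∀ (a r : D[X]) (v : Fin (m + 3) → D[X]), NiceRow a r v)
    {a r : R[X]} (ha : a - 1 ∈ I.map (C : R →+* R[X])) {u : Fin (m + 3) → R[X]}
    (hu : Ideal.span (Set.range u) = ⊤) (hu0 : u 0 = a * r - 1)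
    (hu1 : u 1 ∈ I.map (C : R →+* R[X])) :
    RelEquiv (I.map (C : R →+* R[X])) (Function.update u 1 (r * u 1)) u :=
  RelEquiv.of_niceRow (f := mapRingHom f) (g := mapRingHom g) (map_surjective _ hf)
    (map_surjective _ hg) (eq_zero_of_mapRingHom_eq_zero hinj) (mapRingHom_sub_mem hfg)
    (fun _ _ => exists_mapRingHom_eq hlift) hnice ha hu hu0 hu1

theorem RelEquiv.of_isLocalRing {R : Type*} [CommRing R] [IsNoetherianRing R] [IsLocalRing R]
    {m : ℕ} (hdim : ringKrullDim R = (m + 2 : ℕ)) (h2 : IsUnit (2 : R)) {I : Ideal R} (hI : I ≠ ⊤)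
    {a r : R[X]} (ha : a - 1 ∈ I.map (C : R →+* R[X])) {u : Fin (m + 3) → R[X]}
    (hu : Ideal.span (Set.range u) = ⊤) (hu0 : u 0 = a * r - 1)
    (hu1 : u 1 ∈ I.map (C : R →+* R[X])) :
    RelEquiv (I.map (C : R →+* R[X])) (Function.update u 1 (r * u 1)) u := by
  have := isLocalRing_idealDouble hI
  have h2' : IsUnit (2 : idealDouble I) := by
    have := h2.map (algebraMap R (idealDouble I))
    rwa [map_ofNat] at this
  have hmin : IsLocalRing.maximalIdeal R ∉ minimalPrimes R :=
    maximalIdeal_notMem_minimalPrimes (by rw [hdim]; exact_mod_cast Nat.succ_pos _)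
  refine RelEquiv.of_niceRow_polynomial (idealDoubleFst_surjective (I := I))
    idealDoubleSnd_surjective (fun s h₁ h₂ => Subtype.ext (Prod.ext h₁ h₂))
    idealDoubleSnd_sub_fst_mem (fun x y h => ⟨⟨(x, y), mem_idealDouble.2 h⟩, rfl, rfl⟩)
    (NiceRow.of_isLocalRing (ringKrullDim_idealDouble_le.trans hdim.le) h2'
      (maximalIdeal_idealDouble_notMem_minimalPrimes hmin)) ha hu hu0 hu1

/-- `(R, 𝔪)` a commutative noetherian local ring of Krull dimension
`d = m + 2 ≥ 2` with `2` a unit, `I` a proper ideal of `R`.  Then the group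
structure on `Um_{d+1}(R[X], I[X])/E_{d+1}(R[X], I[X])` is nice.  Here
`I[X] = I·R[X]` is the ideal of polynomials with all coefficients in `I`, and
rows of length `d + 1 = m + 3` are encoded as functions `Fin (m + 3) → R[X]`. -/
theorem niceness_polynomial_local_relative
    (R : Type*) [CommRing R] [IsNoetherianRing R] [IsLocalRing R]
    (m : ℕ) (hdim : ringKrullDim R = (m + 2 : ℕ))
    (h2 : IsUnit (2 : R))
    (I : Ideal R) (hI : I ≠ ⊤)
    (v w : Fin (m + 3) → R[X]) (p : R[X])
    (hvw : ∀ i : Fin (m + 3), i ≠ 0 → v i = w i)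
    (hv : v ∈ UmRel (m + 3) R[X] (I.map (C : R →+* R[X])))
    (hw : w ∈ UmRel (m + 3) R[X] (I.map (C : R →+* R[X])))
    (hpI : p - 1 ∈ I.map (C : R →+* R[X]))
    (hp : v 0 * p - 1 ∈ Ideal.span (v '' {i : Fin (m + 3) | i ≠ 0})) :
    ∃ ε ∈ ElemRel (m + 3) R[X] (I.map (C : R →+* R[X])),
      Matrix.vecMul
        (Function.update (Function.update v 0 (v 0 * (w 0 + p) - 1)) 1 (v 1 * (w 0 + p)))
        (ε : Matrix (Fin (m + 3)) (Fin (m + 3)) R[X])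
      = Function.update v 0 (v 0 * w 0) := by
  have h01 : (0 : Fin (m + 3)) ≠ 1 := zero_ne_one_fin
  have hv0 : v 0 - 1 ∈ I.map (C : R →+* R[X]) := by simpa using hv.2 0
  have hw0 : w 0 - 1 ∈ I.map (C : R →+* R[X]) := by simpa using hw.2 0
  have hvi : ∀ i, i ≠ 0 → v i ∈ I.map (C : R →+* R[X]) := fun i hi => by
    simpa [hi] using hv.2 i
  set q := v 0 * (w 0 + p) - 1 with hq
  have hab : v 0 * w 0 = q + -(v 0 * p - 1) := by rw [hq]; ring
  have hspan : Ideal.span (Set.range (Function.update v 0 q)) = ⊤ := by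
    rw [eq_top_iff, ← Ideal.mul_top ⊤]
    nth_rewrite 1 [← span_range_eq_top_of_mem_Um hv.1]
    rw [← span_range_eq_top_of_mem_Um hw.1, Ideal.span_mul_span', Ideal.span_le]
    set K := Ideal.span (Set.range (Function.update v 0 q))
    have hK : ∀ i, i ≠ 0 → v i ∈ K := fun i hi => Ideal.subset_span ⟨i, by simp [hi]⟩
    have hle : Ideal.span (v '' {i : Fin (m + 3) | i ≠ 0}) ≤ K := by
      rw [Ideal.span_le]
      rintro _ ⟨i, hi, rfl⟩
      exact hK i hi
    rintro _ ⟨_, ⟨i, rfl⟩, _, ⟨j, rfl⟩, rfl⟩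
    by_cases hi : i = 0
    · by_cases hj : j = 0
      · subst hi hj
        simp only [hab]
        exact add_mem (Ideal.subset_span ⟨0, by simp⟩) (neg_mem (hle hp))
      · exact K.mul_mem_left _ (hvw j hj ▸ hK j hj)
    · exact K.mul_mem_right _ (hK i hi)
  have h₁ := RelEquiv.of_isLocalRing hdim h2 hI hv0 hspan (r := w 0 + p)
    (Function.update_self ..)
    (by simpa [h01.symm] using hvi 1 h01.symm)
  have hq1 : q - 1 ∈ I.map (C : R →+* R[X]) := by
    have : q - 1 = (v 0 - 1) * (w 0 + p) + (w 0 - 1) + (p - 1) := by rw [hq]; ring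
    rw [this]
    exact add_mem (add_mem (Ideal.mul_mem_right _ _ hv0) hw0) hpI
  have h₂ := RelEquiv.update_zero_add v hvi (neg_mem hp) hq1
  rw [← hab] at h₂
  rw [Function.update_of_ne h01.symm, mul_comm] at h₁
  exact h₁.trans h₂
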